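/- Let T be NSOP₂. Then Conant-independence is symmetric: for all tuples a, b and every small elementary submodel M of 𝕄, a ⫝^{K*}_M b implies b ⫝^{K*}_M a. -/

import Mathlib

/- Common model-theoretic infrastructure for formalizing
   "NSOP₂ theories are NSOP₁" (arXiv:2206.08512).

   We work with a monster model `𝕄` of a complete theory: a sufficiently
   saturated and strongly homogeneous `L`-structure.  Tuples are functions
   `α → 𝕄`; sets of formulas with parameters are coded via `FmlP`. -/

open FirstOrder Language

universe u v w

namespace NSOP2Paper

/-- A first-order formula in free variables `α ⊕ Fin n` together with an
`n`-tuple of parameters from `𝕄`. -/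
abbrev FmlP (L : FirstOrder.Language.{u, u}) (𝕄 : Type u) (α : Type v) :=
  Σ n : ℕ, L.Formula (α ⊕ Fin n) × (Fin n → 𝕄)

/-- `a ≡_C b` : the tuples `a` and `b` satisfy the same formulas with
parameters from `C`. -/
def EqTpOver (L : FirstOrder.Language.{u, u}) {𝕄 : Type u} [L.Structure 𝕄] (C : Set 𝕄)
    {α : Type v} (a b : α → 𝕄) : Prop :=
  ∀ (n : ℕ) (φ : L.Formula (α ⊕ Fin n)) (c : Fin n → 𝕄), (∀ i, c i ∈ C) →
    (φ.Realize (Sum.elim a c) ↔ φ.Realize (Sum.elim b c))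

/-- `tp(a / C)` is finitely satisfiable in `Ms`: every formula over `C`
satisfied by `a` has a realization by a tuple from `Ms`. -/
def FinSatIn (L : FirstOrder.Language.{u, u}) {𝕄 : Type u} [L.Structure 𝕄] (Ms : Set 𝕄)
    {α : Type v} (a : α → 𝕄) (C : Set 𝕄) : Prop :=
  ∀ (n : ℕ) (φ : L.Formula (α ⊕ Fin n)) (c : Fin n → 𝕄), (∀ i, c i ∈ C) →
    φ.Realize (Sum.elim a c) →
    ∃ m : α → 𝕄, (∀ i, m i ∈ Ms) ∧ φ.Realize (Sum.elim m c)

/-- `Ms` is the underlying set of a (small) elementary submodel of `𝕄`. -/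
def IsElemSubmodel (L : FirstOrder.Language.{u, u}) {𝕄 : Type u} [L.Structure 𝕄] (Ms : Set 𝕄) : Prop :=
  ∃ S : L.ElementarySubstructure 𝕄, (S : Set 𝕄) = Ms

/-- A complete consistent global type (a complete type over the monster `𝕄`)
in variables `α`, coded as the set of formulas-with-parameters it contains. -/
structure GlobalType (L : FirstOrder.Language.{u, u}) (𝕄 : Type u) [L.Structure 𝕄] (α : Type v) where
  carrier : Set (FmlP L 𝕄 α)
  consistent : ∀ t : Finset (FmlP L 𝕄 α), ↑t ⊆ carrier →
    ∃ a : α → 𝕄, ∀ p ∈ t, p.2.1.Realize (Sum.elim a p.2.2)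
  complete : ∀ (n : ℕ) (φ : L.Formula (α ⊕ Fin n)) (c : Fin n → 𝕄),
    (⟨n, (φ, c)⟩ : FmlP L 𝕄 α) ∈ carrier ∨ (⟨n, (φ.not, c)⟩ : FmlP L 𝕄 α) ∈ carrier

variable {L : FirstOrder.Language.{u, u}} {𝕄 : Type u} [L.Structure 𝕄]

/-- The global type `q` is finitely satisfiable in `Ms` (i.e. it is a coheir of
its restriction to `Ms`). -/
def GlobalType.FinSatInM {α : Type v} (q : GlobalType L 𝕄 α) (Ms : Set 𝕄) : Prop :=
  ∀ t : Finset (FmlP L 𝕄 α), ↑t ⊆ q.carrier →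
    ∃ m : α → 𝕄, (∀ i, m i ∈ Ms) ∧ ∀ p ∈ t, p.2.1.Realize (Sum.elim m p.2.2)

/-- `a ⊨ q|_C` : the tuple `a` realizes the restriction of the global type `q`
to parameters from `C`. -/
def RealizesType {α : Type v} (q : GlobalType L 𝕄 α) (a : α → 𝕄) (C : Set 𝕄) : Prop :=
  ∀ (n : ℕ) (φ : L.Formula (α ⊕ Fin n)) (c : Fin n → 𝕄), (∀ i, c i ∈ C) →
    (⟨n, (φ, c)⟩ : FmlP L 𝕄 α) ∈ q.carrier → φ.Realize (Sum.elim a c)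

/-- The global type `q` extends `tp(a / C)`. -/
def ExtendsTpOver {α : Type v} (q : GlobalType L 𝕄 α) (C : Set 𝕄) (a : α → 𝕄) : Prop :=
  ∀ (n : ℕ) (φ : L.Formula (α ⊕ Fin n)) (c : Fin n → 𝕄), (∀ i, c i ∈ C) →
    φ.Realize (Sum.elim a c) → (⟨n, (φ, c)⟩ : FmlP L 𝕄 α) ∈ q.carrier

/-- `B` is a coheir Morley sequence over `Ms` in the global type `q`:
`q` is finitely satisfiable in `Ms` and `B i ⊨ q|_(Ms ∪ B_{<i})`. -/
def MorleyIn {α : Type v} (q : GlobalType L 𝕄 α) (Ms : Set 𝕄) (B : ℕ → α → 𝕄) : Prop :=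
  q.FinSatInM Ms ∧
    ∀ i : ℕ, RealizesType q (B i) (Ms ∪ ⋃ (j : ℕ) (_ : j < i), Set.range (B j))

/-- `B` is a coheir Morley sequence over `Ms`. -/
def CoheirMorley (L : FirstOrder.Language.{u, u}) {𝕄 : Type u} [L.Structure 𝕄] (Ms : Set 𝕄)
    {α : Type v} (B : ℕ → α → 𝕄) : Prop :=
  ∃ q : GlobalType L 𝕄 α, MorleyIn q Ms B

/-- Flatten an `ℕ`-indexed sequence of `α`-tuples into a single tuple. -/
def flatSeq {α : Type v} (I : ℕ → α → 𝕄) : ℕ × α → 𝕄 := fun p => I p.1 p.2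

/-- The sequence `I` is indiscernible over `C`. -/
def IndiscernibleOver (L : FirstOrder.Language.{u, u}) {𝕄 : Type u} [L.Structure 𝕄] (C : Set 𝕄)
    {α : Type v} (I : ℕ → α → 𝕄) : Prop :=
  ∀ (n : ℕ) (f g : Fin n → ℕ), StrictMono f → StrictMono g →
    EqTpOver L C (fun p : Fin n × α => I (f p.1) p.2) (fun p : Fin n × α => I (g p.1) p.2)

/-- `𝕄` is `κ`-saturated: every finitely satisfiable set of formulas in fewer
than `κ` variables over a parameter set of size `< κ` is realized in `𝕄`. -/
def IsSaturated (L : FirstOrder.Language.{u, u}) (𝕄 : Type u) [L.Structure 𝕄] (κ : Cardinal.{u}) : Prop :=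
  ∀ (α : Type u) (A : Set 𝕄), Cardinal.mk α < κ → Cardinal.mk A < κ →
    ∀ Γ : Set (FmlP L 𝕄 α), (∀ p ∈ Γ, ∀ i, p.2.2 i ∈ A) →
      (∀ t : Finset (FmlP L 𝕄 α), ↑t ⊆ Γ →
        ∃ a : α → 𝕄, ∀ p ∈ t, p.2.1.Realize (Sum.elim a p.2.2)) →
      ∃ a : α → 𝕄, ∀ p ∈ Γ, p.2.1.Realize (Sum.elim a p.2.2)

/-- `𝕄` is strongly `κ`-homogeneous: partial elementary maps between tuples of
length `< κ` extend to automorphisms of `𝕄`. -/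
def IsStronglyHomogeneous (L : FirstOrder.Language.{u, u}) (𝕄 : Type u) [L.Structure 𝕄]
    (κ : Cardinal.{u}) : Prop :=
  ∀ (α : Type u), Cardinal.mk α < κ → ∀ a b : α → 𝕄, EqTpOver L (∅ : Set 𝕄) a b →
    ∃ σ : 𝕄 ≃[L] 𝕄, ∀ i, σ (a i) = b i

/-- `𝕄` is a monster model (for smallness degree `κ`): sufficiently saturated
and strongly homogeneous. -/
def IsMonster (L : FirstOrder.Language.{u, u}) (𝕄 : Type u) [L.Structure 𝕄] (κ : Cardinal.{u}) : Prop :=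
  Cardinal.aleph0 < κ ∧ IsSaturated L 𝕄 κ ∧ IsStronglyHomogeneous L 𝕄 κ

/-! ### Tree combinatorics -/

/-- The meet (longest common prefix) of two finite sequences. -/
def meet {A : Type w} [DecidableEq A] : List A → List A → List A
  | a :: as, b :: bs => if a = b then a :: meet as bs else []
  | _, _ => []

/-- The meet of `η 0, …, η i`. -/
def combMeet {A : Type w} [DecidableEq A] {k : ℕ} (η : Fin k → List A) (i : Fin k) : List A :=
  (List.ofFn fun j : Fin i.val => η (Fin.castLE i.2.le j)).foldl meet (η i)

/-- `η 0, …, η (k-1)` is a descending comb: a lexicographically increasing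
antichain such that the meet of `η 0, …, η (i+1)` is a proper initial segment
of the meet of `η 0, …, η i`. -/
def DescendingComb {A : Type w} [DecidableEq A] [LT A] {k : ℕ} (η : Fin k → List A) : Prop :=
  (∀ i j : Fin k, i ≠ j → ¬ η i <+: η j) ∧
  (∀ i j : Fin k, i < j → List.Lex (· < ·) (η i) (η j)) ∧
  (∀ (i : ℕ) (h : i + 1 < k),
    combMeet η ⟨i + 1, h⟩ <+: combMeet η ⟨i, by omega⟩ ∧
    combMeet η ⟨i + 1, h⟩ ≠ combMeet η ⟨i, by omega⟩)

/-! ### Tree properties of theories (witnessed in the monster model) -/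

/-- `T = Th(𝕄)` has `SOP₁`. -/
def HasSOP1 (L : FirstOrder.Language.{u, u}) (𝕄 : Type u) [L.Structure 𝕄] : Prop :=
  ∃ (k m : ℕ) (φ : L.Formula (Fin k ⊕ Fin m)) (b : List Bool → Fin m → 𝕄),
    (∀ σ : ℕ → Bool, ∃ a : Fin k → 𝕄,
      ∀ n : ℕ, φ.Realize (Sum.elim a (b (List.ofFn fun i : Fin n => σ i)))) ∧
    ∀ η₁ η₂ : List Bool, (η₁ ++ [false]) <+: η₂ →
      ¬ ∃ a : Fin k → 𝕄, φ.Realize (Sum.elim a (b η₂)) ∧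
        φ.Realize (Sum.elim a (b (η₁ ++ [true])))

/-- `T = Th(𝕄)` has `SOP₂`. -/
def HasSOP2 (L : FirstOrder.Language.{u, u}) (𝕄 : Type u) [L.Structure 𝕄] : Prop :=
  ∃ (k m : ℕ) (φ : L.Formula (Fin k ⊕ Fin m)) (b : List Bool → Fin m → 𝕄),
    (∀ σ : ℕ → Bool, ∃ a : Fin k → 𝕄,
      ∀ n : ℕ, φ.Realize (Sum.elim a (b (List.ofFn fun i : Fin n => σ i)))) ∧
    ∀ η₁ η₂ : List Bool, ¬ η₁ <+: η₂ → ¬ η₂ <+: η₁ →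
      ¬ ∃ a : Fin k → 𝕄, φ.Realize (Sum.elim a (b η₁)) ∧ φ.Realize (Sum.elim a (b η₂))

/-- `T = Th(𝕄)` has `k`-`DCTP₁`: paths are consistent but descending combs of
size `k` are inconsistent. -/
def HasKDCTP1 (L : FirstOrder.Language.{u, u}) (𝕄 : Type u) [L.Structure 𝕄] (k : ℕ) : Prop :=
  ∃ (r m : ℕ) (φ : L.Formula (Fin r ⊕ Fin m)) (b : List ℕ → Fin m → 𝕄),
    (∀ σ : ℕ → ℕ, ∃ a : Fin r → 𝕄,
      ∀ n : ℕ, φ.Realize (Sum.elim a (b (List.ofFn fun i : Fin n => σ i)))) ∧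
    ∀ η : Fin k → List ℕ, DescendingComb η →
      ¬ ∃ a : Fin r → 𝕄, ∀ i, φ.Realize (Sum.elim a (b (η i)))

/-- `T = Th(𝕄)` has weak `k`-`TP₁`: paths are consistent but any `k` pairwise
incomparable nodes with common pairwise meet are inconsistent. -/
def HasWeakKTP1 (L : FirstOrder.Language.{u, u}) (𝕄 : Type u) [L.Structure 𝕄] (k : ℕ) : Prop :=
  ∃ (r m : ℕ) (φ : L.Formula (Fin r ⊕ Fin m)) (b : List ℕ → Fin m → 𝕄),
    (∀ σ : ℕ → ℕ, ∃ a : Fin r → 𝕄,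
      ∀ n : ℕ, φ.Realize (Sum.elim a (b (List.ofFn fun i : Fin n => σ i)))) ∧
    ∀ η : Fin k → List ℕ,
      (∀ i j, i ≠ j → ¬ η i <+: η j) →
      (∀ i j i' j' : Fin k, i ≠ j → i' ≠ j' → meet (η i) (η j) = meet (η i') (η j')) →
      ¬ ∃ a : Fin r → 𝕄, ∀ i, φ.Realize (Sum.elim a (b (η i)))

/-- `T = Th(𝕄)` has `k`-`DCTP₂`: paths are `k`-inconsistent but descending
combs are consistent. -/
def HasKDCTP2 (L : FirstOrder.Language.{u, u}) (𝕄 : Type u) [L.Structure 𝕄] (k : ℕ) : Prop :=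
  ∃ (r m : ℕ) (φ : L.Formula (Fin r ⊕ Fin m)) (b : List Bool → Fin m → 𝕄),
    (∀ σ : ℕ → Bool, ∀ s : Finset ℕ, s.card = k →
      ¬ ∃ a : Fin r → 𝕄, ∀ n ∈ s,
        φ.Realize (Sum.elim a (b (List.ofFn fun i : Fin n => σ i)))) ∧
    ∀ (l : ℕ) (η : Fin l → List Bool), DescendingComb η →
      ∃ a : Fin r → 𝕄, ∀ i, φ.Realize (Sum.elim a (b (η i)))

/-! ### Kim-dividing and Conant-dividing, with respect to coheir Morley sequences -/

/-- `φ(x, b)` Kim-divides over `Ms`: some coheir Morley sequence over `Ms`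
starting with `b` makes it inconsistent. -/
def KimDivides (L : FirstOrder.Language.{u, u}) {𝕄 : Type u} [L.Structure 𝕄] (Ms : Set 𝕄)
    {α : Type v} {n : ℕ} (φ : L.Formula (α ⊕ Fin n)) (b : Fin n → 𝕄) : Prop :=
  ∃ B : ℕ → Fin n → 𝕄, CoheirMorley L Ms B ∧ B 0 = b ∧
    ¬ ∃ a : α → 𝕄, ∀ i, φ.Realize (Sum.elim a (B i))

/-- `φ(x, b)` Kim-forks over `Ms`: it implies a finite disjunction of formulas
Kim-dividing over `Ms`. -/
def KimForks (L : FirstOrder.Language.{u, u}) {𝕄 : Type u} [L.Structure 𝕄] (Ms : Set 𝕄)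
    {α : Type v} {n : ℕ} (φ : L.Formula (α ⊕ Fin n)) (b : Fin n → 𝕄) : Prop :=
  ∃ (N : ℕ) (m : Fin N → ℕ) (ψ : ∀ j : Fin N, L.Formula (α ⊕ Fin (m j)))
    (c : ∀ j : Fin N, Fin (m j) → 𝕄),
    (∀ j, KimDivides L Ms (ψ j) (c j)) ∧
    ∀ a : α → 𝕄, φ.Realize (Sum.elim a b) → ∃ j, (ψ j).Realize (Sum.elim a (c j))

/-- `φ(x, b)` Conant-divides over `Ms`: every coheir Morley sequence over `Ms`
starting with `b` makes it inconsistent. -/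
def ConantDivides (L : FirstOrder.Language.{u, u}) {𝕄 : Type u} [L.Structure 𝕄] (Ms : Set 𝕄)
    {α : Type v} {n : ℕ} (φ : L.Formula (α ⊕ Fin n)) (b : Fin n → 𝕄) : Prop :=
  ∀ B : ℕ → Fin n → 𝕄, CoheirMorley L Ms B → B 0 = b →
    ¬ ∃ a : α → 𝕄, ∀ i, φ.Realize (Sum.elim a (B i))

/-- `φ(x, b)` Conant-forks over `Ms`. -/
def ConantForks (L : FirstOrder.Language.{u, u}) {𝕄 : Type u} [L.Structure 𝕄] (Ms : Set 𝕄)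
    {α : Type v} {n : ℕ} (φ : L.Formula (α ⊕ Fin n)) (b : Fin n → 𝕄) : Prop :=
  ∃ (N : ℕ) (m : Fin N → ℕ) (ψ : ∀ j : Fin N, L.Formula (α ⊕ Fin (m j)))
    (c : ∀ j : Fin N, Fin (m j) → 𝕄),
    (∀ j, ConantDivides L Ms (ψ j) (c j)) ∧
    ∀ a : α → 𝕄, φ.Realize (Sum.elim a b) → ∃ j, (ψ j).Realize (Sum.elim a (c j))

/-- `a ⫝^{K*}_{Ms} b` : `tp(a/Ms b)` contains no formula Conant-forking
over `Ms`. -/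
def ConantIndep (L : FirstOrder.Language.{u, u}) {𝕄 : Type u} [L.Structure 𝕄] (Ms : Set 𝕄)
    {α : Type v} {β : Type w} (a : α → 𝕄) (b : β → 𝕄) : Prop :=
  ∀ (n : ℕ) (φ : L.Formula (α ⊕ Fin n)) (d : Fin n → 𝕄),
    (∀ i, d i ∈ Ms ∪ Set.range b) → φ.Realize (Sum.elim a d) →
    ¬ ConantForks L Ms φ d

/-! ### Abstract independence relations between sets over models -/

/-- An abstract ternary relation `A ⫝_M B` between subsets of `𝕄` over
(elementary submodels of) `𝕄`. -/
structure IndRel (L : FirstOrder.Language.{u, u}) (𝕄 : Type u) [L.Structure 𝕄] where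
  rel : Set 𝕄 → Set 𝕄 → Set 𝕄 → Prop

/-- A set `S` of `α`-tuples is type-definable over `C`. -/
def TypeDefinableOver (L : FirstOrder.Language.{u, u}) {𝕄 : Type u} [L.Structure 𝕄] (C : Set 𝕄)
    {γ : Type v} (S : Set (γ → 𝕄)) : Prop :=
  ∃ Γ : Set (FmlP L 𝕄 γ), (∀ p ∈ Γ, ∀ i, p.2.2 i ∈ C) ∧
    ∀ g : γ → 𝕄, g ∈ S ↔ ∀ p ∈ Γ, p.2.1.Realize (Sum.elim g p.2.2)

namespace IndRel


/-- Invariance under automorphisms of `𝕄`. -/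
def Invariant (R : IndRel L 𝕄) : Prop :=
  ∀ (σ : 𝕄 ≃[L] 𝕄) (A Ms B : Set 𝕄), R.rel A Ms B →
    R.rel ((⇑σ) '' A) ((⇑σ) '' Ms) ((⇑σ) '' B)

/-- Monotonicity (on both sides). -/
def Mono (R : IndRel L 𝕄) : Prop :=
  ∀ (A A' Ms B B' : Set 𝕄), IsElemSubmodel L Ms → R.rel A Ms B →
    Ms ⊆ A' → A' ⊆ A → Ms ⊆ B' → B' ⊆ B → R.rel A' Ms B'

/-- Existence: for `M ⊆ A, B` there is `A' ≡_M A` with `A' ⫝_M B`. -/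
def Existence (R : IndRel L 𝕄) (κ : Cardinal.{u}) : Prop :=
  ∀ (Ms : Set 𝕄), IsElemSubmodel L Ms → Cardinal.mk Ms < κ →
    ∀ (α β : Type u), Cardinal.mk α < κ → Cardinal.mk β < κ →
      ∀ (a : α → 𝕄) (b : β → 𝕄),
        ∃ a' : α → 𝕄, EqTpOver L Ms a' a ∧
          R.rel (Ms ∪ Set.range a') Ms (Ms ∪ Set.range b)

/-- Right extension. -/
def RightExt (R : IndRel L 𝕄) (κ : Cardinal.{u}) : Prop :=
  ∀ (Ms : Set 𝕄), IsElemSubmodel L Ms → Cardinal.mk Ms < κ →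
    ∀ (α : Type u), Cardinal.mk α < κ → ∀ (a : α → 𝕄) (B C : Set 𝕄),
      Cardinal.mk B < κ → Cardinal.mk C < κ →
      R.rel (Set.range a) Ms B → B ⊆ C →
      ∃ a' : α → 𝕄, EqTpOver L B a' a ∧ R.rel (Set.range a') Ms C

/-- Quasi-strong finite character: for complete types `p = tp(a₀/Ms)` and
`q = tp(b₀/Ms)`, the set of pairs of realizations `(a, b)` with `a ⫝_Ms b`
is type-definable over `Ms`. -/
def QSFC (R : IndRel L 𝕄) (κ : Cardinal.{u}) : Prop :=
  ∀ (Ms : Set 𝕄), IsElemSubmodel L Ms → Cardinal.mk Ms < κ →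
    ∀ (α β : Type u), Cardinal.mk α < κ → Cardinal.mk β < κ →
      ∀ (a₀ : α → 𝕄) (b₀ : β → 𝕄),
        TypeDefinableOver L Ms {g : (α ⊕ β) → 𝕄 |
          EqTpOver L Ms (g ∘ Sum.inl) a₀ ∧ EqTpOver L Ms (g ∘ Sum.inr) b₀ ∧
          R.rel (Set.range (g ∘ Sum.inl)) Ms (Set.range (g ∘ Sum.inr))}

/-- The coheir chain condition. -/
def CoheirChain (R : IndRel L 𝕄) (κ : Cardinal.{u}) : Prop :=
  ∀ (Ms : Set 𝕄), IsElemSubmodel L Ms → Cardinal.mk Ms < κ →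
    ∀ (α β : Type u), Cardinal.mk α < κ → Cardinal.mk β < κ →
      ∀ (a : α → 𝕄) (b : β → 𝕄), R.rel (Set.range a) Ms (Set.range b) →
        ∀ I : ℕ → β → 𝕄, CoheirMorley L Ms I → I 0 = b →
          ∃ I' : ℕ → β → 𝕄, EqTpOver L Ms (flatSeq I') (flatSeq I) ∧
            R.rel (Set.range a) Ms (⋃ i, Set.range (I' i)) ∧
            ∀ i, EqTpOver L (Ms ∪ Set.range a) (I' i) b

/-- `R` implies `⫝ʰ` : `A ⫝_M B` implies `tp(B / M A)` is finitely
satisfiable in `M`. -/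
def StrongerThanH (R : IndRel L 𝕄) : Prop :=
  ∀ (A Ms B : Set 𝕄), IsElemSubmodel L Ms → R.rel A Ms B →
    FinSatIn L Ms (fun x : B => (x : 𝕄)) (Ms ∪ A)

end IndRel

/-- The axioms satisfied by the relations among which `⫝^CK` is weakest. -/
def GoodRel (R : IndRel L 𝕄) (κ : Cardinal.{u}) : Prop :=
  R.StrongerThanH ∧ R.Invariant ∧ R.Mono ∧ R.Existence κ ∧ R.RightExt κ ∧ R.CoheirChain κ

/-- `R` is `⫝^CK` : the weakest relation implying `⫝ʰ` and satisfying
invariance, monotonicity, existence, right extension and the coheir chain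
condition. -/
def IsCK (R : IndRel L 𝕄) (κ : Cardinal.{u}) : Prop :=
  GoodRel R κ ∧ ∀ R' : IndRel L 𝕄, GoodRel R' κ →
    ∀ A Ms B : Set 𝕄, R'.rel A Ms B → R.rel A Ms B

/-- `q` is a canonical global type over `Ms` (w.r.t. the relation `R = ⫝^CK`):
whenever `c ⊨ q|_{Ms b}` we have `b ⫝^CK_{Ms} c`. -/
def IsCanonicalGlobal (R : IndRel L 𝕄) (κ : Cardinal.{u}) (Ms : Set 𝕄) {α : Type v}
    (q : GlobalType L 𝕄 α) : Prop :=
  ∀ (β : Type u), Cardinal.mk β < κ → ∀ (b : β → 𝕄) (c : α → 𝕄),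
    RealizesType q c (Ms ∪ Set.range b) → R.rel (Set.range b) Ms (Set.range c)

/-- A canonical Morley sequence over `Ms`: a coheir Morley sequence in a
canonical coheir. -/
def CanonicalMorley (R : IndRel L 𝕄) (κ : Cardinal.{u}) (Ms : Set 𝕄) {α : Type v}
    (I : ℕ → α → 𝕄) : Prop :=
  ∃ q : GlobalType L 𝕄 α, IsCanonicalGlobal R κ Ms q ∧ MorleyIn q Ms I

/-- `q` is a strong canonical global type over `Ms`. -/
def IsStrongCanonical (R : IndRel L 𝕄) (κ : Cardinal.{u}) (Ms : Set 𝕄) {α : Type v}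
    (q : GlobalType L 𝕄 α) : Prop :=
  ∀ (β : Type u), Cardinal.mk β < κ → ∀ (b : β → 𝕄) (c : α → 𝕄),
    RealizesType q c (Ms ∪ Set.range b) →
    ∀ (γ : Type u), Cardinal.mk γ < κ → ∀ (a : γ → 𝕄),
      ∃ a' : γ → 𝕄, EqTpOver L (Ms ∪ Set.range c) a' a ∧
        ∃ q' : GlobalType L 𝕄 (γ ⊕ α), IsCanonicalGlobal R κ Ms q' ∧
          ExtendsTpOver q' (Ms ∪ Set.range b) (Sum.elim a' c)

/-! ### `M`-invariant ideals and `𝓘`-Kim-dividing -/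

/-- An `Ms`-invariant ideal on the definable subsets of `𝕄` (in variables `α`). -/
structure InvIdeal (L : FirstOrder.Language.{u, u}) (𝕄 : Type u) [L.Structure 𝕄] (Ms : Set 𝕄)
    (α : Type v) where
  mem : Set (α → 𝕄) → Prop
  definable_of_mem : ∀ S, mem S → ∃ (n : ℕ) (ψ : L.Formula (α ⊕ Fin n)) (c : Fin n → 𝕄),
    S = {a : α → 𝕄 | ψ.Realize (Sum.elim a c)}
  union_mem : ∀ S T, mem S → mem T → mem (S ∪ T)
  subset_mem : ∀ S T, mem S →
    (∃ (n : ℕ) (ψ : L.Formula (α ⊕ Fin n)) (c : Fin n → 𝕄),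
      T = {a : α → 𝕄 | ψ.Realize (Sum.elim a c)}) →
    T ⊆ S → mem T
  invariant : ∀ σ : 𝕄 ≃[L] 𝕄, (∀ x ∈ Ms, σ x = x) → ∀ S, mem S →
    mem ((fun a => (⇑σ) ∘ a) '' S)

/-- `φ(x, b)` `𝓘`-Kim-divides over `Ms`. -/
def IKimDivides {Ms : Set 𝕄} {α : Type v} (I : InvIdeal L 𝕄 Ms α) {n : ℕ}
    (φ : L.Formula (α ⊕ Fin n)) (b : Fin n → 𝕄) : Prop :=
  ∃ (B : ℕ → Fin n → 𝕄) (k : ℕ), CoheirMorley L Ms B ∧ B 0 = b ∧ 0 < k ∧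
    ∀ s : Finset ℕ, s.card = k →
      I.mem {a : α → 𝕄 | ∀ i ∈ s, φ.Realize (Sum.elim a (B i))}

/-- `φ(x, b)` `𝓘`-Kim-forks over `Ms`. -/
def IKimForks {Ms : Set 𝕄} {α : Type v} (I : InvIdeal L 𝕄 Ms α) {n : ℕ}
    (φ : L.Formula (α ⊕ Fin n)) (b : Fin n → 𝕄) : Prop :=
  ∃ (N : ℕ) (m : Fin N → ℕ) (ψ : ∀ j : Fin N, L.Formula (α ⊕ Fin (m j)))
    (c : ∀ j : Fin N, Fin (m j) → 𝕄),
    (∀ j, IKimDivides I (ψ j) (c j)) ∧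
    ∀ a : α → 𝕄, φ.Realize (Sum.elim a b) → ∃ j, (ψ j).Realize (Sum.elim a (c j))

/-- `φ(x, b)` `𝓘`-quasi-divides over `Ms`. -/
def IQuasiDivides {Ms : Set 𝕄} {α : Type v} (I : InvIdeal L 𝕄 Ms α) {n : ℕ}
    (φ : L.Formula (α ⊕ Fin n)) (b : Fin n → 𝕄) : Prop :=
  ∃ (mm : ℕ) (b' : Fin mm → Fin n → 𝕄), 0 < mm ∧ (∀ j, EqTpOver L Ms (b' j) b) ∧
    I.mem {a : α → 𝕄 | ∀ j, φ.Realize (Sum.elim a (b' j))}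

/-! ### `h^⫝`-inconsistency and the derived relation `⫝'` -/

/-- A family of formulas is `h^⫝`-inconsistent with respect to `P = tp(a₀/Ms)`. -/
def HInconsistent (R : IndRel L 𝕄) (Ms : Set 𝕄) {α : Type v} (a₀ : α → 𝕄)
    {ι : Type w} (m : ι → ℕ) (φ : ∀ i : ι, L.Formula (α ⊕ Fin (m i)))
    (b : ∀ i : ι, Fin (m i) → 𝕄) : Prop :=
  ¬ ∃ a : α → 𝕄, EqTpOver L Ms a a₀ ∧
      R.rel (Set.range a) Ms (⋃ i, Set.range (b i)) ∧
      ∀ i, (φ i).Realize (Sum.elim a (b i))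

/-- A single formula is `h^⫝`-inconsistent with respect to `P = tp(a₀/Ms)`. -/
def HInconsistentSingle (R : IndRel L 𝕄) (Ms : Set 𝕄) {α : Type v} (a₀ : α → 𝕄)
    {n : ℕ} (φ : L.Formula (α ⊕ Fin n)) (b : Fin n → 𝕄) : Prop :=
  ¬ ∃ a : α → 𝕄, EqTpOver L Ms a a₀ ∧ R.rel (Set.range a) Ms (Set.range b) ∧
      φ.Realize (Sum.elim a b)

/-- `φ(x, b)` `h^⫝`-Kim-divides with respect to `tp(a₀/Ms)`. -/
def HKimDivides (R : IndRel L 𝕄) (Ms : Set 𝕄) {α : Type v} (a₀ : α → 𝕄)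
    {n : ℕ} (φ : L.Formula (α ⊕ Fin n)) (b : Fin n → 𝕄) : Prop :=
  ∃ B : ℕ → Fin n → 𝕄, CoheirMorley L Ms B ∧ B 0 = b ∧
    HInconsistent R Ms a₀ (fun _ : ℕ => n) (fun _ => φ) B

/-- `φ(x, b)` `h^⫝`-Kim-forks with respect to `tp(a₀/Ms)`. -/
def HKimForks (R : IndRel L 𝕄) (Ms : Set 𝕄) {α : Type v} (a₀ : α → 𝕄)
    {n : ℕ} (φ : L.Formula (α ⊕ Fin n)) (b : Fin n → 𝕄) : Prop :=
  ∃ (N : ℕ) (m : Fin N → ℕ) (ψ : ∀ j : Fin N, L.Formula (α ⊕ Fin (m j)))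
    (c : ∀ j : Fin N, Fin (m j) → 𝕄),
    (∀ j, HKimDivides R Ms a₀ (ψ j) (c j)) ∧
    ∀ a : α → 𝕄, φ.Realize (Sum.elim a b) → ∃ j, (ψ j).Realize (Sum.elim a (c j))

/-- `φ(x, b)` `h^⫝`-quasi-divides with respect to `tp(a₀/Ms)`. -/
def HQuasiDivides (R : IndRel L 𝕄) (Ms : Set 𝕄) {α : Type v} (a₀ : α → 𝕄)
    {n : ℕ} (φ : L.Formula (α ⊕ Fin n)) (b : Fin n → 𝕄) : Prop :=
  ∃ (mm : ℕ) (b' : Fin mm → Fin n → 𝕄), 0 < mm ∧ (∀ j, EqTpOver L Ms (b' j) b) ∧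
    HInconsistent R Ms a₀ (fun _ : Fin mm => n) (fun _ => φ) b'

/-- The derived relation `⫝'` on tuples:
`tp(a / Ms b)` contains no formula `h^⫝`-Kim-forking w.r.t. `tp(a/Ms)`. -/
def DerivedIndep (R : IndRel L 𝕄) (Ms : Set 𝕄) {α : Type v} {β : Type w}
    (a : α → 𝕄) (b : β → 𝕄) : Prop :=
  ∀ (n : ℕ) (φ : L.Formula (α ⊕ Fin n)) (d : Fin n → 𝕄),
    (∀ i, d i ∈ Ms ∪ Set.range b) → φ.Realize (Sum.elim a d) →
    ¬ HKimForks R Ms a φ d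

/-- The derived relation `⫝'` as a relation between sets over models. -/
def derived (R : IndRel L 𝕄) : IndRel L 𝕄 where
  rel A Ms B := ∀ (n : ℕ) (φ : L.Formula (↥A ⊕ Fin n)) (d : Fin n → 𝕄),
    (∀ i, d i ∈ Ms ∪ B) → φ.Realize (Sum.elim (fun x : A => (x : 𝕄)) d) →
    ¬ HKimForks R Ms (fun x : A => (x : 𝕄)) φ d

/-! ### Coheir trees -/

/-- The tuple, indexed by extensions, consisting of the part of the tree `c`
lying (weakly) above the node `ν` (where `ν` has length `Lh`). -/
def subtreeTupleLen {α : Type v} {n : ℕ} (c : {l : List ℕ // l.length ≤ n} → α → 𝕄)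
    (Lh : ℕ) (ν : List ℕ) (hν : ν.length = Lh) :
    ({s : List ℕ // Lh + s.length ≤ n} × α) → 𝕄 :=
  fun p => c ⟨ν ++ p.1.1, by rw [List.length_append, hν]; exact p.1.2⟩ p.2

end NSOP2Paper

namespace NSOP2Paper

section Combinatorics

variable {X : Type*} {Y : Type*} (R : X → Y → Prop)

/-- The family of instances of `R` indexed by `F` is consistent. -/
def Con (F : List Y) : Prop := ∃ x, ∀ y ∈ F, R x y

variable {R}

lemma Con.mono {F G : List Y} (h : Con R F) (hGF : ∀ y ∈ G, y ∈ F) : Con R G :=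
  let ⟨x, hx⟩ := h
  ⟨x, fun y hy => hx y (hGF y hy)⟩

/-- Finite `A + 1`-branching trees with labels in `Y` at their inner nodes. -/
inductive LTree (Y : Type*) (A : ℕ) where
  | leaf : LTree Y A
  | node : Y → (Fin (A + 1) → LTree Y A) → LTree Y A

namespace LTree

variable {A m : ℕ}

/-- Every branch of the tree has length at least `n`. -/
def Full : ℕ → LTree Y A → Prop
  | 0, _ => True
  | _ + 1, leaf => False
  | n + 1, node _ c => ∀ i, Full n (c i)

/-- `z` is a label of the tree. -/
def Mem (z : Y) : LTree Y A → Prop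
  | leaf => False
  | node y c => z = y ∨ ∃ i, Mem z (c i)

variable (R) in
/-- The labels along any branch of the tree are consistent together with `F`. -/
def PathCon : LTree Y A → List Y → Prop
  | leaf, F => Con R F
  | node y c, F => ∀ i, PathCon (c i) (y :: F)

/-- One step in the definition of `NestedIncon`. -/
def NestedStep (P : LTree Y A → List Y → Prop) : LTree Y A → List Y → Prop
  | leaf, _ => True
  | node _ c, F => (∀ i, NestedStep P (c i) F) ∧
      ∀ i j, i < j → ∀ z, Mem z (c j) → P (c i) (z :: F)

variable (R) in
/-- Descending combs of length `k` in the tree are inconsistent together with `F`. -/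
def NestedIncon : ℕ → LTree Y A → List Y → Prop
  | 0 => fun _ F => ¬ Con R F
  | k + 1 => NestedStep (NestedIncon k)

/-- `Sub S T` says that `S` embeds in `T` preserving levels and the order of siblings. -/
inductive Sub : LTree Y m → LTree Y A → Prop
  | leaf (T : LTree Y A) : Sub LTree.leaf T
  | node (y : Y) (c : Fin (A + 1) → LTree Y A) (c' : Fin (m + 1) → LTree Y m)
      (e : Fin (m + 1) → Fin (A + 1)) (he : StrictMono e) (h : ∀ i, Sub (c' i) (c (e i))) :
      Sub (LTree.node y c') (LTree.node y c)

/-- `Branch T π T'` says that `π` is an initial segment of a branch of `T` leading to the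
subtree `T'`. -/
inductive Branch : LTree Y A → List Y → LTree Y A → Prop
  | nil (T : LTree Y A) : Branch T [] T
  | cons (y : Y) (c : Fin (A + 1) → LTree Y A) (i : Fin (A + 1)) (π : List Y) (T' : LTree Y A)
      (h : Branch (c i) π T') : Branch (node y c) (y :: π) T'

lemma PathCon.mono {T : LTree Y A} {F G : List Y} (h : PathCon R T F)
    (hGF : ∀ y ∈ G, y ∈ F) : PathCon R T G := by
  induction T generalizing F G with
  | leaf => exact Con.mono h hGF
  | node y c ih =>
    intro i
    refine ih i (h i) ?_
    intro z hz
    rcases List.mem_cons.1 hz with rfl | hz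
    · exact List.mem_cons_self
    · exact List.mem_cons_of_mem _ (hGF z hz)

lemma PathCon.con {T : LTree Y A} {F : List Y} (h : PathCon R T F) : Con R F := by
  induction T generalizing F with
  | leaf => exact h
  | node y c ih => exact (ih 0 (h 0)).mono fun z hz => List.mem_cons_of_mem _ hz

lemma NestedIncon.child {k : ℕ} {y : Y} {c : Fin (A + 1) → LTree Y A} {F : List Y}
    (h : NestedIncon R k (node y c) F) (i : Fin (A + 1)) : NestedIncon R k (c i) F := by
  cases k with
  | zero => exact h
  | succ k => exact h.1 i

lemma Sub.mem {S : LTree Y m} {T : LTree Y A} (h : Sub S T) {z : Y} (hz : Mem z S) : Mem z T := by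
  induction h with
  | leaf T => exact hz.elim
  | node y c c' e he h ih =>
    rcases hz with rfl | ⟨i, hi⟩
    · exact Or.inl rfl
    · exact Or.inr ⟨e i, ih i hi⟩

lemma NestedIncon.sub {k : ℕ} {S : LTree Y m} {T : LTree Y A} {F : List Y}
    (h : NestedIncon R k T F) (hST : Sub S T) : NestedIncon R k S F := by
  induction k generalizing S T F with
  | zero => exact h
  | succ k ihk =>
    induction hST with
    | leaf T => trivial
    | node y c c' e he hs ih =>
      exact ⟨fun i => ih i (h.1 (e i)), fun i j hij z hz =>
        ihk (h.2 (e i) (e j) (he hij) z ((hs j).mem hz)) (hs i)⟩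

lemma Branch.pathCon {T T' : LTree Y A} {π F : List Y} (hb : Branch T π T')
    (h : PathCon R T F) : PathCon R T' (π ++ F) := by
  induction hb generalizing F with
  | nil T => exact h
  | cons y c i π T' hb ih =>
    exact (ih (h i)).mono fun z hz => by simp only [List.mem_append, List.mem_cons] at hz ⊢; tauto

lemma Branch.nestedIncon {k : ℕ} {T T' : LTree Y A} {π F : List Y} (hb : Branch T π T')
    (h : NestedIncon R k T F) : NestedIncon R k T' F := by
  induction hb with
  | nil T => exact h
  | cons y c i π T' hb ih => exact ih (h.child i)

lemma Branch.mem {T T' : LTree Y A} {π : List Y} (hb : Branch T π T') {z : Y}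
    (hz : Mem z T') : Mem z T := by
  induction hb with
  | nil T => exact hz
  | cons y c i π T' hb ih => exact Or.inr ⟨i, ih hz⟩

/-- In a tall and wide tree there is either a branch all of which is inconsistent with each element
of `C`, or a large subtree whose paths are consistent with some element of `C`. -/
lemma exists_branch_or_sub (C : Finset Y) (hC : C.card * m < A + 1) (n n' : ℕ) (T : LTree Y A)
    (F : List Y) (hT : Full (n + n') T) :
    (∃ π T', Branch T π T' ∧ π.length = n ∧ Full n' T' ∧ ∀ c ∈ C, ¬ Con R (c :: (π ++ F))) ∨
    ∃ c ∈ C, ∃ S : LTree Y m, Full n S ∧ Sub S T ∧ PathCon R S (c :: F) := by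
  classical
  induction n generalizing T F with
  | zero =>
    by_cases h : ∃ c ∈ C, Con R (c :: F)
    · obtain ⟨c, hc, h⟩ := h
      exact Or.inr ⟨c, hc, leaf, trivial, Sub.leaf T, h⟩
    · refine Or.inl ⟨[], T, Branch.nil T, rfl, by simpa using hT, fun c hc h' => h ⟨c, hc, h'⟩⟩
  | succ n ih =>
    cases T with
    | leaf => rw [Nat.succ_add] at hT; exact hT.elim
    | node y c =>
      rw [Nat.succ_add] at hT
      have key := fun i => ih (c i) (y :: F) (hT i)
      by_cases h : ∃ i π T', Branch (c i) π T' ∧ π.length = n ∧ Full n' T' ∧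
          ∀ d ∈ C, ¬ Con R (d :: (π ++ y :: F))
      · obtain ⟨i, π, T', hb, hl, hf, hc⟩ := h
        refine Or.inl ⟨y :: π, T', Branch.cons y c i π T' hb, by simp [hl], hf, fun d hd hcon =>
          hc d hd (hcon.mono fun z hz => ?_)⟩
        simp only [List.mem_append, List.mem_cons, List.cons_append] at hz ⊢
        tauto
      · have key' : ∀ i, ∃ d ∈ C, ∃ S : LTree Y m, Full n S ∧ Sub S (c i) ∧
            PathCon R S (d :: y :: F) := fun i =>
          (key i).resolve_left fun ⟨π, T', h'⟩ => h ⟨i, π, T', h'⟩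
        choose d hd S hS hSub hPC using key'
        obtain ⟨z, hz, hcard⟩ := Finset.exists_lt_card_fiber_of_mul_lt_card_of_maps_to
          (s := (Finset.univ : Finset (Fin (A + 1)))) (t := C) (f := d) (n := m)
          (fun i _ => hd i) (by simpa using hC)
        let e := Finset.orderEmbOfCardLe (Finset.univ.filter fun i => d i = z)
          (k := m + 1) hcard
        have he : ∀ i, d (e i) = z := fun i =>
          (Finset.mem_filter.1 (Finset.orderEmbOfCardLe_mem _ hcard i)).2
        refine Or.inr ⟨z, hz, node y fun i => S (e i), fun i => hS _,
          Sub.node y c _ e e.strictMono fun i => hSub _, fun i => (hPC (e i)).mono fun w hw => ?_⟩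
        simp only [List.mem_cons] at hw ⊢
        rw [he]
        tauto

end LTree

open LTree

variable (R) in
/-- There are arbitrarily large trees with consistent paths and inconsistent descending combs of
length `k`, over `s` extra elements. -/
def HasTrees (s k : ℕ) : Prop :=
  ∀ A n : ℕ, ∃ F : List Y, F.length = s ∧ ∃ T : LTree Y A, Full n T ∧ PathCon R T F ∧
    NestedIncon R k T F

variable (R) in
/-- Arbitrarily tall finite binary trees with consistent paths and inconsistent incomparable
pairs. -/
def HasBinaryTrees : Prop :=
  ∃ l : ℕ, ∀ h : ℕ, ∃ g : List Bool → List Y,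
    (∀ η, η.length < h → (g η).length = l) ∧
    (∀ η, η.length < h → ∃ x, ∀ ν, ν <+: η → ∀ y ∈ g ν, R x y) ∧
    ∀ η ν, η.length < h → ν.length < h → ¬ η <+: ν → ¬ ν <+: η → ¬ Con R (g η ++ g ν)

lemma exists_binary {m k N A : ℕ} {F : List Y} (hA : 1 ≤ A)
    (hno : ∀ c (S : LTree Y m), Full N S → PathCon R S (c :: F) → ¬ NestedIncon R k S (c :: F))
    (h : ℕ) (T : LTree Y A) (acc : List Y) (C : Finset Y) (hT : NestedIncon R (k + 1) T F)
    (hP : PathCon R T (acc ++ F)) (hCT : ∀ c ∈ C, NestedIncon R k T (c :: F))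
    (hfull : Full (h * (N + 1)) T) (hcard : (C.card + 2 ^ h) * m < A + 1) :
    ∃ (g : List Bool → List Y) (H : Finset Y), H.card + 1 ≤ 2 ^ h ∧ (∀ z ∈ H, Mem z T) ∧
      (∀ η, η.length < h → (g η).length = N + 1) ∧
      (∀ η, η.length < h → ∃ z ∈ H, z ∈ g η) ∧
      (∀ η, η.length < h → ∃ x, (∀ y ∈ acc ++ F, R x y) ∧ ∀ ν, ν <+: η → ∀ y ∈ g ν, R x y) ∧
      (∀ η, η.length < h → ∀ c ∈ C, ¬ Con R (c :: (g η ++ F))) ∧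
      ∀ η ν, η.length < h → ν.length < h → ¬ η <+: ν → ¬ ν <+: η →
        ¬ Con R (g η ++ g ν ++ F) := by
  classical
  induction h generalizing T acc C with
  | zero => exact ⟨fun _ => [], ∅, by simp, by simp, by simp, by simp, by simp, by simp, by simp⟩
  | succ h ih =>
    have hC : C.card * m < A + 1 := lt_of_le_of_lt (Nat.mul_le_mul_right _ (Nat.le_add_right _ _)) hcard
    have hfull' : Full (N + (h * (N + 1) + 1)) T := by
      convert hfull using 1; ring
    rcases exists_branch_or_sub (R := R) C hC N _ T F hfull' with
      ⟨π, T', hb, hl, hf, hinc⟩ | ⟨c, hc, S, hS, hSub, hPC⟩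
    swap
    · exact absurd ((hCT c hc).sub hSub) (hno c S hS hPC)
    cases T' with
    | leaf => exact hf.elim
    | node y ch =>
      have hN' := hb.nestedIncon hT
      have hP' := hb.pathCon hP
      have hCT' : ∀ c ∈ C, ∀ i, NestedIncon R k (ch i) (c :: F) := fun c hc i =>
        (hb.nestedIncon (hCT c hc)).child i
      let i₀ : Fin (A + 1) := ⟨0, by omega⟩
      let i₁ : Fin (A + 1) := ⟨1, by omega⟩
      have hi : i₀ < i₁ := Fin.mk_lt_mk.2 one_pos
      have hPch : ∀ i, PathCon R (ch i) (((y :: π) ++ acc) ++ F) := fun i =>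
        (hP' i).mono fun z hz => by
          simp only [List.mem_append, List.mem_cons] at hz ⊢; tauto
      obtain ⟨g₁, H₁, hH₁, hM₁, hlen₁, hex₁, hpath₁, hinc₁, hincomp₁⟩ :=
        ih (ch i₁) (y :: π ++ acc) C (hN'.child _) (hPch _) (fun c hc => hCT' c hc _) (hf _)
          (lt_of_le_of_lt (Nat.mul_le_mul_right _ (by rw [pow_succ]; omega)) hcard)
      have hcu := Finset.card_union_le C H₁
      obtain ⟨g₀, H₀, hH₀, hM₀, hlen₀, hex₀, hpath₀, hinc₀, hincomp₀⟩ :=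
        ih (ch i₀) (y :: π ++ acc) (C ∪ H₁) (hN'.child _) (hPch _)
          (fun c hc => (Finset.mem_union.1 hc).elim (fun hc => hCT' c hc _)
            fun hc => hN'.2 i₀ i₁ hi c (hM₁ c hc)) (hf _)
          (lt_of_le_of_lt (Nat.mul_le_mul_right _ (by rw [pow_succ]; omega)) hcard)
      have hcross : ∀ η ν, η.length < h → ν.length < h → ¬ Con R (g₁ η ++ g₀ ν ++ F) := by
        intro η ν hη hν hcon
        obtain ⟨z, hz, hzg⟩ := hex₁ η hη
        refine hinc₀ ν hν z (Finset.mem_union_right _ hz) (hcon.mono fun w hw => ?_)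
        simp only [List.mem_append, List.mem_cons] at hw ⊢
        rcases hw with rfl | hw | hw
        · exact Or.inl (Or.inl hzg)
        · exact Or.inl (Or.inr hw)
        · exact Or.inr hw
      let g : List Bool → List Y
        | [] => y :: π
        | true :: η => g₁ η
        | false :: η => g₀ η
      refine ⟨g, insert y (H₁ ∪ H₀), ?_, ?_, ?_, ?_, ?_, ?_, ?_⟩
      · have h1 := Finset.card_insert_le y (H₁ ∪ H₀)
        have h2 := Finset.card_union_le H₁ H₀
        rw [pow_succ]; omega
      · intro z hz
        refine hb.mem ?_
        rcases Finset.mem_insert.1 hz with rfl | hz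
        · exact Or.inl rfl
        · exact (Finset.mem_union.1 hz).elim (fun hz => Or.inr ⟨i₁, hM₁ z hz⟩)
            fun hz => Or.inr ⟨i₀, hM₀ z hz⟩
      · rintro (_ | ⟨(_ | _), η⟩) hη
        · simp [g, hl]
        · exact hlen₀ η (by simpa using hη)
        · exact hlen₁ η (by simpa using hη)
      · rintro (_ | ⟨(_ | _), η⟩) hη
        · exact ⟨y, Finset.mem_insert_self _ _, List.mem_cons_self⟩
        · obtain ⟨z, hz, hzg⟩ := hex₀ η (by simpa using hη)
          exact ⟨z, by simp [hz], hzg⟩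
        · obtain ⟨z, hz, hzg⟩ := hex₁ η (by simpa using hη)
          exact ⟨z, by simp [hz], hzg⟩
      · rintro (_ | ⟨(_ | _), η⟩) hη
        · obtain ⟨x, hx⟩ := (hPch i₀).con
          refine ⟨x, fun z hz => hx z ?_, ?_⟩
          · simp only [List.mem_append, List.mem_cons] at hz ⊢; tauto
          · intro ν hν z hz
            obtain rfl := List.prefix_nil.1 hν
            refine hx z ?_
            simp only [g, List.mem_append, List.mem_cons] at hz ⊢; tauto
        · obtain ⟨x, hx, hx'⟩ := hpath₀ η (by simpa using hη)
          refine ⟨x, fun z hz => hx z ?_, ?_⟩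
          · simp only [List.mem_append, List.mem_cons] at hz ⊢; tauto
          · rintro (_ | ⟨b, ν⟩) hν z hz
            · refine hx z ?_
              simp only [g, List.mem_append, List.mem_cons] at hz ⊢; tauto
            · obtain ⟨rfl, hν'⟩ := List.cons_prefix_cons.1 hν
              exact hx' ν hν' z hz
        · obtain ⟨x, hx, hx'⟩ := hpath₁ η (by simpa using hη)
          refine ⟨x, fun z hz => hx z ?_, ?_⟩
          · simp only [List.mem_append, List.mem_cons] at hz ⊢; tauto
          · rintro (_ | ⟨b, ν⟩) hν z hz
            · refine hx z ?_
              simp only [g, List.mem_append, List.mem_cons] at hz ⊢; tauto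
            · obtain ⟨rfl, hν'⟩ := List.cons_prefix_cons.1 hν
              exact hx' ν hν' z hz
      · rintro (_ | ⟨(_ | _), η⟩) hη c hc hcon
        · refine hinc c hc (hcon.mono fun z hz => ?_)
          simp only [g, List.mem_append, List.mem_cons] at hz ⊢; tauto
        · exact hinc₀ η (by simpa using hη) c (Finset.mem_union_left _ hc) hcon
        · exact hinc₁ η (by simpa using hη) c hc hcon
      · rintro (_ | ⟨b, η⟩) (_ | ⟨b', ν⟩) hη hν h1 h2
        · exact (h1 (List.prefix_refl _)).elim
        · exact (h1 List.nil_prefix).elim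
        · exact (h2 List.nil_prefix).elim
        · have hη' : η.length < h := by simpa using hη
          have hν' : ν.length < h := by simpa using hν
          rw [List.cons_prefix_cons] at h1 h2
          cases b <;> cases b'
          · exact hincomp₀ η ν hη' hν' (fun h => h1 ⟨rfl, h⟩) (fun h => h2 ⟨rfl, h⟩)
          · intro hcon
            refine hcross ν η hν' hη' (hcon.mono fun w hw => ?_)
            simp only [g, List.mem_append] at hw ⊢; tauto
          · exact hcross η ν hη' hν'
          · exact hincomp₁ η ν hη' hν' (fun h => h1 ⟨rfl, h⟩) (fun h => h2 ⟨rfl, h⟩)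

/-- Large trees with consistent paths and inconsistent descending combs give rise to binary
trees as in the definition of `SOP₂`. -/
theorem HasTrees.hasBinaryTrees {s k : ℕ} (h : HasTrees R s k) : HasBinaryTrees R := by
  classical
  induction k generalizing s with
  | zero =>
    obtain ⟨F, -, T, -, hP, hN⟩ := h 0 0
    exact absurd hP.con hN
  | succ k ih =>
    by_cases h' : HasTrees R (s + 1) k
    · exact ih h'
    simp only [HasTrees] at h'
    push Not at h'
    obtain ⟨m, N, hno⟩ := h'
    refine ⟨N + 1 + s, fun h₀ => ?_⟩
    obtain ⟨F, hF, T, hT, hP, hN⟩ := h (2 ^ h₀ * m + 1) (h₀ * (N + 1))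
    obtain ⟨g, H, -, -, hlen, -, hpath, -, hinc⟩ := exists_binary (m := m) (k := k) (N := N)
      (by omega) (fun c S hS hPC => hno (c :: F) (by simp [hF]) S hS hPC) h₀ T [] ∅ hN
      (by simpa using hP) (by simp) hT (by simp)
    refine ⟨fun η => g η ++ F, fun η hη => by simp [hlen η hη, hF], fun η hη => ?_,
      fun η ν hη hν h1 h2 hcon => hinc η ν hη hν h1 h2 (hcon.mono fun z hz => ?_)⟩
    · obtain ⟨x, hx, hx'⟩ := hpath η hη
      refine ⟨x, fun ν hν y hy => ?_⟩
      rcases List.mem_append.1 hy with hy | hy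
      · exact hx' ν hν y hy
      · exact hx y (by simpa using hy)
    · simp only [List.mem_append] at hz ⊢; tauto

end Combinatorics

section DefinableSpaces

/-- A space of finite tuples from `M`. -/
class TupleSpace (M : Type u) (α : Type u) where
  /-- The index type of the tuples. -/
  idx : Type
  finite_idx : Finite idx
  /-- The coordinates of a point. -/
  coord : α ≃ (idx → M)

attribute [instance] TupleSpace.finite_idx

open TupleSpace

variable {M : Type u}

instance TupleSpace.self : TupleSpace M M where
  idx := Unit
  finite_idx := inferInstance
  coord := (Equiv.funUnique Unit M).symm

instance TupleSpace.punit : TupleSpace M PUnit.{u + 1} where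
  idx := Empty
  finite_idx := inferInstance
  coord := Equiv.ofUnique _ _

instance TupleSpace.prod {α β : Type u} [TupleSpace M α] [TupleSpace M β] :
    TupleSpace M (α × β) where
  idx := idx M α ⊕ idx M β
  finite_idx := inferInstance
  coord := (Equiv.prodCongr coord coord).trans (Equiv.sumArrowEquivProdArrow _ _ _).symm

instance TupleSpace.pi {ι : Type} [Finite ι] {α : Type u} [TupleSpace M α] :
    TupleSpace M (ι → α) where
  idx := ι × idx M α
  finite_idx := inferInstance
  coord := (Equiv.piCongrRight fun _ : ι => (coord : α ≃ (idx M α → M))).trans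
    (Equiv.curry ι (idx M α) M).symm

/-- Trees of height exactly `n` with labels in `Y` at inner nodes and in `Z` at leaves. -/
def LabTree (Z Y : Type u) (A : ℕ) : ℕ → Type u
  | 0 => Z
  | n + 1 => Y × (Fin (A + 1) → LabTree Z Y A n)

/-- The tuple space structure on trees. -/
@[reducible]
def LabTree.tupleSpace {Z Y : Type u} [TupleSpace M Z] [TupleSpace M Y] (A : ℕ) :
    ∀ n, TupleSpace M (LabTree Z Y A n)
  | 0 => inferInstanceAs (TupleSpace M Z)
  | n + 1 =>
    letI : TupleSpace M (LabTree Z Y A n) := LabTree.tupleSpace A n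
    inferInstanceAs (TupleSpace M (Y × (Fin (A + 1) → LabTree Z Y A n)))

instance {Z Y : Type u} [TupleSpace M Z] [TupleSpace M Y] (A n : ℕ) :
    TupleSpace M (LabTree Z Y A n) :=
  LabTree.tupleSpace A n

variable {α β γ : Type u} [TupleSpace M α] [TupleSpace M β] [TupleSpace M γ]

variable (M) in
/-- Maps all of whose coordinates are coordinates of the argument or constants. -/
@[fun_prop]
def CoordMap (f : α → β) : Prop :=
  ∀ i : idx M β, ∃ t : idx M α ⊕ M, ∀ a, (coord (f a) : idx M β → M) i = Sum.elim (coord a) id t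

namespace CoordMap

@[fun_prop]
lemma id : CoordMap M (fun a : α => a) := fun i => ⟨Sum.inl i, fun _ => rfl⟩

@[fun_prop]
lemma const (b : β) : CoordMap M (fun _ : α => b) := fun i => ⟨Sum.inr (coord b i), fun _ => rfl⟩

@[fun_prop]
lemma comp {g : β → γ} {f : α → β} (hg : CoordMap M g) (hf : CoordMap M f) :
    CoordMap M (fun a => g (f a)) := by
  intro i
  obtain ⟨t | t, ht⟩ := hg i
  · obtain ⟨s, hs⟩ := hf t
    exact ⟨s, fun a => by rw [ht, ← hs]; rfl⟩
  · exact ⟨Sum.inr t, fun a => by rw [ht]; rfl⟩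

@[fun_prop]
lemma fst : CoordMap M (fun p : α × β => p.1) := fun i => ⟨Sum.inl (Sum.inl i), fun _ => rfl⟩

@[fun_prop]
lemma snd : CoordMap M (fun p : α × β => p.2) := fun i => ⟨Sum.inl (Sum.inr i), fun _ => rfl⟩

@[fun_prop]
lemma prodMk {f : α → β} {g : α → γ} (hf : CoordMap M f) (hg : CoordMap M g) :
    CoordMap M (fun a => (f a, g a)) := by
  rintro (i | i)
  · exact hf i
  · exact hg i

@[fun_prop]
lemma apply {ι : Type} [Finite ι] (i : ι) : CoordMap M (fun f : ι → α => f i) :=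
  fun j => ⟨Sum.inl (i, j), fun _ => rfl⟩

@[fun_prop]
lemma pi {ι : Type} [Finite ι] {f : α → ι → β} (hf : ∀ i, CoordMap M fun a => f a i) :
    CoordMap M f := by
  rintro ⟨i, j⟩
  exact hf i j

lemma precomp {ι κ : Type} [Finite ι] [Finite κ] (e : κ → ι) :
    CoordMap M (fun f : ι → α => fun j => f (e j)) := by fun_prop

section
variable {Z Y : Type u} [TupleSpace M Z] [TupleSpace M Y] {A n : ℕ}

lemma label : CoordMap M (fun t : LabTree Z Y A (n + 1) => t.1) :=
  fst (α := Y) (β := Fin (A + 1) → LabTree Z Y A n)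

lemma children : CoordMap M (fun t : LabTree Z Y A (n + 1) => t.2) :=
  snd (α := Y) (β := Fin (A + 1) → LabTree Z Y A n)

end

end CoordMap

variable (L : FirstOrder.Language.{u, u}) [L.Structure M]

variable (M) in
/-- Predicates definable with parameters on tuple spaces. -/
def Dfn (P : α → Prop) : Prop :=
  (Set.univ : Set M).Definable L {v : idx M α → M | P (coord.symm v)}

variable {L}

namespace Dfn

lemma of_definable {P : α → Prop} {s : Set (idx M α → M)} (hs : (Set.univ : Set M).Definable L s)
    (h : ∀ v, v ∈ s ↔ P (coord.symm v)) : Dfn M L P := by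
  obtain rfl : s = {v : idx M α → M | P (coord.symm v)} := by ext v; exact h v
  exact hs

lemma comp {P : β → Prop} (hP : Dfn M L P) {f : α → β} (hf : CoordMap M f) :
    Dfn M L fun a => P (f a) := by
  choose t ht using hf
  obtain ⟨φ, hφ⟩ := hP
  let tm : idx M β → L[[(Set.univ : Set M)]].Term (idx M α) := fun i =>
    Sum.elim Term.var (fun m => (L.con (⟨m, trivial⟩ : (Set.univ : Set M))).term) (t i)
  refine ⟨φ.subst tm, ?_⟩
  ext v
  have : (fun i => (tm i).realize v) = coord (f (coord.symm v)) := by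
    funext i
    simp only [tm, ht]
    cases t i with
    | inl j => simp
    | inr m => simp
  have h1 : P (f (coord.symm v)) ↔ coord (f (coord.symm v)) ∈ {v : idx M β → M | P (coord.symm v)} := by
    simp
  rw [hφ, ← this] at h1
  simpa [Formula.Realize, BoundedFormula.realize_subst] using h1

lemma and {P Q : α → Prop} (hP : Dfn M L P) (hQ : Dfn M L Q) : Dfn M L fun a => P a ∧ Q a :=
  Set.Definable.inter hP hQ

lemma or {P Q : α → Prop} (hP : Dfn M L P) (hQ : Dfn M L Q) : Dfn M L fun a => P a ∨ Q a :=
  Set.Definable.union hP hQ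

lemma not {P : α → Prop} (hP : Dfn M L P) : Dfn M L fun a => ¬ P a :=
  Set.Definable.compl hP

lemma imp {P Q : α → Prop} (hP : Dfn M L P) (hQ : Dfn M L Q) : Dfn M L fun a => P a → Q a := by
  simpa only [imp_iff_not_or] using hP.not.or hQ

lemma const (p : Prop) : Dfn M L fun _ : α => p := by
  by_cases h : p
  · exact of_definable Set.definable_univ fun v => by simp [h]
  · exact of_definable Set.definable_empty fun v => by simp [h]

lemma forall_finite {ι : Type*} [Finite ι] {P : ι → α → Prop} (hP : ∀ i, Dfn M L (P i)) :
    Dfn M L fun a => ∀ i, P i a := by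
  exact of_definable (Set.definable_iInter_of_finite hP) fun v => by simp

lemma ex {P : α → β → Prop} (hP : Dfn M L fun p : α × β => P p.1 p.2) :
    Dfn M L fun a => ∃ b, P a b := by
  refine of_definable (Set.Definable.exists_of_finite (α := idx M α) (β := idx M β) hP) fun v => ?_
  simp only [Set.mem_ofPred_eq]
  constructor
  · rintro ⟨u, hu⟩
    exact ⟨_, hu⟩
  · rintro ⟨b, hb⟩
    refine ⟨coord b, ?_⟩
    change P (coord.symm v) ((coord (M := M)).symm (coord b))
    rwa [Equiv.symm_apply_apply]

lemma eq {f g : α → β} (hf : CoordMap M f) (hg : CoordMap M g) : Dfn M L fun a => f a = g a := by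
  have key : Dfn M L fun p : M × M => p.1 = p.2 := by
    refine ⟨Term.equal (Term.var (Sum.inl ())) (Term.var (Sum.inr ())), ?_⟩
    ext v
    simp
    rfl
  have : (fun a => f a = g a) = fun a => ∀ i, (coord (f a) : idx M β → M) i = coord (g a) i := by
    funext a
    rw [← (coord (M := M)).injective.eq_iff (a := f a), funext_iff]
  rw [this]
  refine forall_finite fun i => key.comp (f := fun a => (coord (f a) i, coord (g a) i)) ?_
  refine CoordMap.prodMk ?_ ?_
  · rintro ⟨⟩; exact hf i
  · rintro ⟨⟩; exact hg i

/-- The image of a definable set under a coordinate map is definable. -/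
lemma image {P : α → Prop} (hP : Dfn M L P) {f : α → β} (hf : CoordMap M f) :
    Dfn M L fun b => ∃ a, P a ∧ f a = b :=
  ex ((hP.comp CoordMap.snd).and (eq (hf.comp CoordMap.snd) CoordMap.fst))

end Dfn

lemma Dfn.forall_mem_list {P : α → β → Prop} (hP : Dfn M L fun p : α × β => P p.1 p.2)
    (fs : List (α → β)) (hfs : ∀ f ∈ fs, CoordMap M f) :
    Dfn M L fun a => ∀ b ∈ fs.map (fun f => f a), P a b := by
  induction fs with
  | nil => simpa using Dfn.const True
  | cons f fs ih =>
    simp only [List.map_cons, List.forall_mem_cons]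
    have hf := hfs f List.mem_cons_self
    exact (hP.comp (f := fun a => (a, f a)) (by fun_prop)).and
      (ih fun g hg => hfs g (List.mem_cons_of_mem _ hg))

lemma Dfn.con {X Y : Type u} [TupleSpace M X] [TupleSpace M Y] {R : X → Y → Prop}
    (hR : Dfn M L fun p : X × Y => R p.1 p.2) (fs : List (α → Y)) (hfs : ∀ f ∈ fs, CoordMap M f) :
    Dfn M L fun a => Con R (fs.map fun f => f a) := by
  refine Dfn.ex ?_
  have := Dfn.forall_mem_list (α := α × X) (β := Y) (P := fun a y => R a.2 y)
    (hR.comp (f := fun p : (α × X) × Y => (p.1.2, p.2)) (by fun_prop))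
    (fs.map fun f p => f p.1) (by
      simp only [List.mem_map, forall_exists_index, and_imp, forall_apply_eq_imp_iff₂]
      intro f hf
      exact (hfs f hf).comp CoordMap.fst)
  simpa only [List.map_map, Function.comp_def] using this

namespace LabTree

variable {Z Y : Type u} {A n : ℕ}

/-- Forget the leaf labels. -/
def toTree : ∀ {n : ℕ}, LabTree Z Y A n → LTree Y A
  | 0, _ => LTree.leaf
  | _ + 1, t => LTree.node t.1 fun i => toTree (t.2 i)

lemma full_toTree (t : LabTree Z Y A n) : LTree.Full n t.toTree := by
  induction n with
  | zero => trivial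
  | succ n ih => exact fun i => ih (t.2 i)

/-- Positions of the inner nodes. -/
def Pos (A : ℕ) : ℕ → Type
  | 0 => Empty
  | n + 1 => Option (Fin (A + 1) × Pos A n)

instance Pos.finite (A : ℕ) : ∀ n, Finite (Pos A n)
  | 0 => inferInstanceAs (Finite Empty)
  | n + 1 =>
    haveI := Pos.finite A n
    inferInstanceAs (Finite (Option (Fin (A + 1) × Pos A n)))

/-- The label at a given position. -/
def nodeAt : ∀ {n : ℕ}, Pos A n → LabTree Z Y A n → Y
  | 0, p, _ => Empty.elim p
  | _ + 1, none, t => t.1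
  | _ + 1, some (i, p), t => nodeAt p (t.2 i)

lemma mem_toTree {t : LabTree Z Y A n} {y : Y} : LTree.Mem y t.toTree ↔ ∃ p, nodeAt p t = y := by
  induction n with
  | zero => exact ⟨fun h => h.elim, fun ⟨p, _⟩ => Empty.elim p⟩
  | succ n ih =>
    constructor
    · rintro (rfl | ⟨i, hi⟩)
      · exact ⟨none, rfl⟩
      · obtain ⟨p, hp⟩ := ih.1 hi
        exact ⟨some (i, p), hp⟩
    · rintro ⟨_ | ⟨i, p⟩, hp⟩
      · exact Or.inl hp.symm
      · exact Or.inr ⟨i, ih.2 ⟨p, hp⟩⟩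

/-- Every branch, together with its leaf, satisfies `S`. -/
def Paths (S : Z → List Y → Prop) : ∀ {n : ℕ}, LabTree Z Y A n → List Y → Prop
  | 0, t, F => S t F
  | _ + 1, t, F => ∀ i, Paths S (t.2 i) (t.1 :: F)

lemma Paths.pathCon {X : Type*} {R : X → Y → Prop} {S : Z → List Y → Prop}
    (hS : ∀ z F, S z F → Con R F) {t : LabTree Z Y A n} {F : List Y} (h : Paths S t F) :
    LTree.PathCon R t.toTree F := by
  induction n generalizing F with
  | zero => exact hS _ _ h
  | succ n ih => exact fun i => ih (h i)

variable [TupleSpace M Z] [TupleSpace M Y]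

lemma coordMap_nodeAt (p : Pos A n) : CoordMap M (nodeAt p : LabTree Z Y A n → Y) := by
  induction n with
  | zero => exact Empty.elim p
  | succ n ih =>
    rcases p with _ | ⟨i, p⟩
    · exact CoordMap.label
    · exact (ih p).comp ((CoordMap.apply i).comp CoordMap.children)

lemma dfn_paths {S : Z → List Y → Prop}
    (hS : ∀ (α : Type u) [TupleSpace M α] (z : α → Z) (fs : List (α → Y)), CoordMap M z →
      (∀ f ∈ fs, CoordMap M f) → Dfn M L fun a => S (z a) (fs.map fun f => f a))
    (t : α → LabTree Z Y A n) (ht : CoordMap M t) (fs : List (α → Y))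
    (hfs : ∀ f ∈ fs, CoordMap M f) : Dfn M L fun a => Paths S (t a) (fs.map fun f => f a) := by
  induction n generalizing fs with
  | zero => exact hS _ _ _ ht hfs
  | succ n ih =>
    refine Dfn.forall_finite fun i => ?_
    refine ih (fun a => (t a).2 i) ((CoordMap.apply i).comp (CoordMap.children.comp ht))
      ((fun a => (t a).1) :: fs) ?_
    simp only [List.forall_mem_cons]
    exact ⟨CoordMap.label.comp ht, hfs⟩

lemma dfn_nestedIncon {X : Type u} [TupleSpace M X] {R : X → Y → Prop}
    (hR : Dfn M L fun p : X × Y => R p.1 p.2) (k : ℕ)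
    (t : α → LabTree Z Y A n) (ht : CoordMap M t) (fs : List (α → Y))
    (hfs : ∀ f ∈ fs, CoordMap M f) :
    Dfn M L fun a => LTree.NestedIncon R k (t a).toTree (fs.map fun f => f a) := by
  suffices H : ∀ (α : Type u) [TupleSpace M α] (n : ℕ) (t : α → LabTree Z Y A n)
      (_ : CoordMap M t) (fs : List (α → Y)) (_ : ∀ f ∈ fs, CoordMap M f),
      Dfn M L fun a => LTree.NestedIncon R k (t a).toTree (fs.map fun f => f a) from
    H α n t ht fs hfs
  induction k with
  | zero => exact fun α _ n t ht fs hfs => (Dfn.con hR fs hfs).not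
  | succ k ihk =>
    intro α _ n t ht fs hfs
    induction n with
    | zero => exact Dfn.const True
    | succ n ih =>
      have hch : ∀ i, CoordMap M fun a => (t a).2 i := fun i =>
        (CoordMap.apply i).comp (CoordMap.children.comp ht)
      refine Dfn.and (Dfn.forall_finite fun i => ih _ (hch i)) ?_
      refine Dfn.forall_finite fun i => Dfn.forall_finite fun j => (Dfn.const (i < j)).imp ?_
      have key : ∀ p : Pos A n, Dfn M L fun a =>
          LTree.NestedIncon R k ((t a).2 i).toTree (nodeAt p ((t a).2 j) :: fs.map fun f => f a) :=
        fun p => ihk α n _ (hch i) ((fun a => nodeAt p ((t a).2 j)) :: fs) (by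
          simp only [List.forall_mem_cons]
          exact ⟨(coordMap_nodeAt p).comp (hch j), hfs⟩)
      have := Dfn.forall_finite key
      simpa only [mem_toTree, forall_exists_index, forall_apply_eq_imp_iff] using this

end LabTree

end DefinableSpaces

section Ultrafilters

open Filter TupleSpace

lemma exists_ultrafilter_of_directed {α ι : Type*} [Nonempty ι] (B : ι → α → Prop)
    (hdir : ∀ i j, ∃ k, ∀ a, B k a → B i a ∧ B j a) (hne : ∀ i, ∃ a, B i a) :
    ∃ U : Ultrafilter α, ∀ i, ∀ᶠ a in U, B i a := by
  have : NeBot (⨅ i, 𝓟 {a | B i a}) := by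
    refine iInf_neBot_of_directed' ?_ fun i => principal_neBot_iff.2 (hne i)
    intro i j
    obtain ⟨k, hk⟩ := hdir i j
    exact ⟨k, principal_mono.2 fun a ha => (hk a ha).1, principal_mono.2 fun a ha => (hk a ha).2⟩
  refine ⟨Ultrafilter.of (⨅ i, 𝓟 {a | B i a}), fun i => ?_⟩
  exact Ultrafilter.of_le _ (mem_iInf_of_mem i (mem_principal_self _))

/-- The `k`-fold iterated power of an ultrafilter, the coordinate `0` being innermost. -/
def ultraPow {α : Type*} (V : Ultrafilter α) : ∀ k : ℕ, Ultrafilter (Fin k → α)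
  | 0 => pure Fin.elim0
  | k + 1 => (ultraPow V k).bind fun y => V.map fun b => Fin.cons b y

/-- The product of two ultrafilters, the first one being innermost. -/
def ultraProd {α β : Type*} (U : Ultrafilter α) (V : Ultrafilter β) : Ultrafilter (α × β) :=
  V.bind fun b => U.map fun a => (a, b)

section
variable {α β : Type*}

@[simp]
lemma eventually_ultraPow_zero {V : Ultrafilter α} {P : (Fin 0 → α) → Prop} :
    (∀ᶠ y in ultraPow V 0, P y) ↔ P Fin.elim0 := Iff.rfl

lemma eventually_ultraPow_succ {V : Ultrafilter α} {k : ℕ} {P : (Fin (k + 1) → α) → Prop} :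
    (∀ᶠ y in ultraPow V (k + 1), P y) ↔ ∀ᶠ y in ultraPow V k, ∀ᶠ b in V, P (Fin.cons b y) :=
  Iff.rfl

lemma eventually_ultraProd {U : Ultrafilter α} {V : Ultrafilter β} {P : α × β → Prop} :
    (∀ᶠ p in ultraProd U V, P p) ↔ ∀ᶠ b in V, ∀ᶠ a in U, P (a, b) :=
  Iff.rfl

lemma eventually_ultraMap {U : Ultrafilter α} {f : α → β} {P : β → Prop} :
    (∀ᶠ b in U.map f, P b) ↔ ∀ᶠ a in U, P (f a) :=
  Iff.rfl

lemma Ultrafilter.ext_eventually {U V : Ultrafilter α}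
    (h : ∀ P : α → Prop, (∀ᶠ a in U, P a) ↔ ∀ᶠ a in V, P a) : U = V :=
  Ultrafilter.ext fun s => h (· ∈ s)

lemma ultraPow_map (V : Ultrafilter α) (f : α → β) (k : ℕ) :
    ultraPow (V.map f) k = (ultraPow V k).map (fun y i => f (y i)) := by
  induction k with
  | zero =>
    refine Ultrafilter.ext_eventually fun P => ?_
    rw [eventually_ultraMap, eventually_ultraPow_zero, eventually_ultraPow_zero]
    exact iff_of_eq (congrArg P (Subsingleton.elim _ _))
  | succ k ih =>
    refine Ultrafilter.ext_eventually fun P => ?_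
    rw [eventually_ultraMap, eventually_ultraPow_succ, eventually_ultraPow_succ, ih,
      eventually_ultraMap]
    refine eventually_congr (Eventually.of_forall fun y => ?_)
    rw [eventually_ultraMap]
    refine eventually_congr (Eventually.of_forall fun b => iff_of_eq (congrArg P ?_))
    funext i
    refine Fin.cases rfl (fun i => rfl) i

lemma ultraPow_map_apply (V : Ultrafilter α) {k : ℕ} (i : Fin k) :
    (ultraPow V k).map (fun y => y i) = V := by
  refine Ultrafilter.ext_eventually fun P => ?_
  rw [eventually_ultraMap]
  induction k with
  | zero => exact i.elim0
  | succ k ih =>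
    rw [eventually_ultraPow_succ]
    refine Fin.cases ?_ (fun i => ?_) i
    · simp only [Fin.cons_zero]
      exact eventually_const
    · simp only [Fin.cons_succ, eventually_const]
      exact ih i

end

variable {M : Type u} {L : FirstOrder.Language.{u, u}} [L.Structure M]
variable {α β γ : Type u} [TupleSpace M α] [TupleSpace M β] [TupleSpace M γ]

variable (M L) in
/-- Two ultrafilters agree on definable sets. -/
def SameType (U V : Ultrafilter α) : Prop :=
  ∀ P : α → Prop, Dfn M L P → ((∀ᶠ a in U, P a) ↔ ∀ᶠ a in V, P a)

namespace SameType

lemma refl (U : Ultrafilter α) : SameType M L U U := fun _ _ => Iff.rfl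

lemma symm {U V : Ultrafilter α} (h : SameType M L U V) : SameType M L V U :=
  fun P hP => (h P hP).symm

lemma trans {U V W : Ultrafilter α} (h : SameType M L U V) (h' : SameType M L V W) :
    SameType M L U W :=
  fun P hP => (h P hP).trans (h' P hP)

lemma of_imp {U V : Ultrafilter α}
    (h : ∀ P : α → Prop, Dfn M L P → (∀ᶠ a in U, P a) → ∀ᶠ a in V, P a) : SameType M L U V := by
  refine fun P hP => ⟨h P hP, fun hV => ?_⟩
  by_contra hU
  exact (Ultrafilter.eventually_not.1 (h _ hP.not (Ultrafilter.eventually_not.2 hU))) hV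

lemma map {U V : Ultrafilter α} (h : SameType M L U V) {f : α → β} (hf : CoordMap M f) :
    SameType M L (U.map f) (V.map f) :=
  fun _ hP => h _ (hP.comp hf)

/-- A lift along a coordinate map of a type to an extension of a given ultrafilter. -/
lemma exists_lift {U : Ultrafilter α} {f : α → β} (hf : CoordMap M f) {V' : Ultrafilter β}
    (h : SameType M L V' (U.map f)) : ∃ V : Ultrafilter α, SameType M L V U ∧ V.map f = V' := by
  let ι := {p : (α → Prop) × (β → Prop) //
    Dfn M L p.1 ∧ (∀ᶠ a in U, p.1 a) ∧ ∀ᶠ b in V', p.2 b}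
  have : Nonempty ι := ⟨⟨(fun _ => True, fun _ => True), Dfn.const _, by simp, by simp⟩⟩
  obtain ⟨V, hV⟩ := exists_ultrafilter_of_directed (fun (p : ι) a => p.1.1 a ∧ p.1.2 (f a))
    (fun p q => ⟨⟨(fun a => p.1.1 a ∧ q.1.1 a, fun b => p.1.2 b ∧ q.1.2 b),
      p.2.1.and q.2.1, p.2.2.1.and q.2.2.1, p.2.2.2.and q.2.2.2⟩, fun a ha => by
        simp only at ha; tauto⟩)
    (fun p => by
      have h1 := (h _ (p.2.1.image hf)).2 (p.2.2.1.mono fun a ha => ⟨a, ha, rfl⟩)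
      obtain ⟨b, ⟨a, ha, rfl⟩, hb⟩ := (h1.and p.2.2.2).exists
      exact ⟨a, ha, hb⟩)
  refine ⟨V, (of_imp fun P hP hPU => ?_).symm, ?_⟩
  · exact (hV ⟨(P, fun _ => True), hP, hPU, by simp⟩).mono fun a ha => ha.1
  · refine Ultrafilter.eq_of_le fun s hs => ?_
    exact (hV ⟨(fun _ => True, (· ∈ s)), Dfn.const _, by simp, hs⟩).mono fun a ha => ha.2

end SameType

variable (M L) in
/-- Auxiliary form of `Good` with explicit ambient type. -/
def GoodOn : ℕ → ∀ (α : Type u) [TupleSpace M α], Ultrafilter α → Prop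
  | 0 => fun _ _ _ => True
  | n + 1 => fun α _ U => ∀ V : Ultrafilter α, SameType M L V U → ∀ (k : ℕ) (A : α → Prop),
      (∀ᶠ a in U, A a) → ∃ Q : Ultrafilter (Fin k → α), GoodOn n (Fin k → α) Q ∧
        SameType M L Q (ultraPow V k) ∧ ∀ i, ∀ᶠ t : Fin k → α in Q, A (t i)

variable (M L) in
/-- Ultrafilters which admit well-behaved iterated powers up to depth `n`. -/
abbrev Good (n : ℕ) (U : Ultrafilter α) : Prop := GoodOn M L n α U

lemma Good.map {n : ℕ} {U : Ultrafilter α} (h : Good M L n U) {f : α → β} (hf : CoordMap M f) :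
    Good M L n (U.map f) := by
  suffices H : ∀ (α β : Type u) [TupleSpace M α] [TupleSpace M β] (U : Ultrafilter α)
      (_ : Good M L n U) (f : α → β) (_ : CoordMap M f), Good M L n (U.map f) from
    H α β U h f hf
  clear h hf f U
  induction n with
  | zero => intros; trivial
  | succ n ih =>
    intro α β _ _ U h f hf V' hV' k A hA
    obtain ⟨V, hV, rfl⟩ := hV'.exists_lift hf
    obtain ⟨Q, hQ, hQV, hQA⟩ := h V hV k _ hA
    have hf' : CoordMap M fun (y : Fin k → α) i => f (y i) := by fun_prop
    refine ⟨Q.map fun (y : Fin k → α) i => f (y i), ih _ _ Q hQ _ hf', ?_, fun i => hQA i⟩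
    rw [ultraPow_map]
    exact hQV.map hf'

lemma Good.pred {n : ℕ} {U : Ultrafilter α} (h : Good M L (n + 1) U) : Good M L n U := by
  suffices H : ∀ (α : Type u) [TupleSpace M α] (U : Ultrafilter α), Good M L (n + 1) U →
      Good M L n U from H α U h
  clear h U
  induction n with
  | zero => intros; trivial
  | succ n ih =>
    intro α _ U h V hV k A hA
    obtain ⟨Q, hQ, hQ'⟩ := h V hV k A hA
    exact ⟨Q, ih _ Q hQ, hQ'⟩

lemma Good.mono {m n : ℕ} (hmn : m ≤ n) {U : Ultrafilter α} (h : Good M L n U) :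
    Good M L m U := by
  induction n, hmn using Nat.le_induction with
  | base => exact h
  | succ n _ ih => exact ih h.pred

variable (M L) in
/-- Sets which no ultrafilter of type `P` satisfying `Good (n + 1)` may contain. -/
def StrongSet (n : ℕ) (P : Ultrafilter α) (A : α → Prop) : Prop :=
  ∃ V : Ultrafilter α, SameType M L V P ∧ ∃ k, ¬ ∃ Q : Ultrafilter (Fin k → α), Good M L n Q ∧
    SameType M L Q (ultraPow V k) ∧ ∀ i, ∀ᶠ t : Fin k → α in Q, A (t i)

lemma good_succ_iff {n : ℕ} {P U : Ultrafilter α} (h : SameType M L U P) :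
    Good M L (n + 1) U ↔ ∀ A : α → Prop, StrongSet M L n P A → ¬ ∀ᶠ a in U, A a := by
  constructor
  · rintro hU A ⟨V, hV, k, hk⟩ hA
    exact hk (hU V (hV.trans h.symm) k A hA)
  · intro hU V hV k A hA
    by_contra hk
    exact hU A ⟨V, hV.trans h, k, hk⟩ hA

variable (M L) in
/-- Sets which cannot contain all of finitely many images of an ultrafilter satisfying `Good n`. -/
def WeakSet (n : ℕ) (P : Ultrafilter α) (B : α → Prop) : Prop :=
  ∃ (H : Type u) (_ : TupleSpace M H) (P' : Ultrafilter H) (ι : Type) (_ : Finite ι)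
    (g : ι → H → α), (∀ i, CoordMap M (g i)) ∧ (∀ i, SameType M L (P'.map (g i)) P) ∧
    ¬ ∃ Q : Ultrafilter H, Good M L n Q ∧ SameType M L Q P' ∧ ∀ i, ∀ᶠ h in Q, B (g i h)

variable (M L) in
/-- The intermediate statement in the proof of `WeakSet.or_strongSet`. -/
def WeakTail (n : ℕ) (P V : Ultrafilter α) (A B : α → Prop) (t : ℕ) : Prop :=
  ∃ (H : Type u) (_ : TupleSpace M H) (P' : Ultrafilter H) (κ : Type) (_ : Finite κ)
    (g : κ → H → α), (∀ j, CoordMap M (g j)) ∧ (∀ j, SameType M L (P'.map (g j)) P) ∧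
    ∀ Q : Ultrafilter (H × (Fin t → α)), Good M L n Q →
      SameType M L Q (ultraProd P' (ultraPow V t)) →
      (∀ j, ∀ᶠ q : H × (Fin t → α) in Q, A (g j q.1) ∨ B (g j q.1)) → (∀ i, ∀ᶠ q : H × (Fin t → α) in Q, A (q.2 i) ∨ B (q.2 i)) →
      ∃ i, ∀ᶠ q : H × (Fin t → α) in Q, B (q.2 i)

/-- Amalgamation of finitely many copies of `R` over images of `P`. -/
lemma exists_amalgam {ι : Type} [Finite ι] (P : Ultrafilter α) (R : Ultrafilter β)
    {g : ι → α → γ} {p : β → γ} (hp : CoordMap M p)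
    (h : ∀ i, SameType M L (P.map (g i)) (R.map p)) :
    ∃ W : Ultrafilter (α × (ι → β)), SameType M L (W.map Prod.fst) P ∧
      (∀ i, SameType M L (W.map fun w => w.2 i) R) ∧ ∀ i, ∀ᶠ w : α × (ι → β) in W, g i w.1 = p (w.2 i) := by
  let J := {q : (α → Prop) × (β → Prop) //
    Dfn M L q.2 ∧ (∀ᶠ a in P, q.1 a) ∧ ∀ᶠ b in R, q.2 b}
  have : Nonempty J := ⟨⟨(fun _ => True, fun _ => True), Dfn.const _, by simp, by simp⟩⟩
  obtain ⟨W, hW⟩ := exists_ultrafilter_of_directed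
    (fun (q : J) (w : α × (ι → β)) => q.1.1 w.1 ∧ ∀ i, q.1.2 (w.2 i) ∧ g i w.1 = p (w.2 i))
    (fun q r => ⟨⟨(fun a => q.1.1 a ∧ r.1.1 a, fun b => q.1.2 b ∧ r.1.2 b),
      q.2.1.and r.2.1, q.2.2.1.and r.2.2.1, q.2.2.2.and r.2.2.2⟩, fun w hw =>
        ⟨⟨hw.1.1, fun i => ⟨(hw.2 i).1.1, (hw.2 i).2⟩⟩, hw.1.2,
          fun i => ⟨(hw.2 i).1.2, (hw.2 i).2⟩⟩⟩)
    (fun q => by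
      have h1 : ∀ᶠ a in P, ∀ i, ∃ b, q.1.2 b ∧ p b = g i a := eventually_all.2 fun i =>
        (h i _ (q.2.1.image hp)).2 (q.2.2.2.mono fun b hb => ⟨b, hb, rfl⟩)
      obtain ⟨a, ha, ha'⟩ := (h1.and q.2.2.1).exists
      choose b hb using ha
      exact ⟨(a, b), ha', fun i => ⟨(hb i).1, (hb i).2.symm⟩⟩)
  refine ⟨W, (SameType.of_imp fun Q hQ hQU => ?_).symm,
    fun i => (SameType.of_imp fun Q hQ hQU => ?_).symm, fun i => ?_⟩
  · exact (hW ⟨(Q, fun _ => True), Dfn.const _, hQU, by simp⟩).mono fun a ha => ha.1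
  · exact (hW ⟨(fun _ => True, Q), hQ, by simp, hQU⟩).mono fun a ha => (ha.2 i).1
  · exact (hW (Classical.arbitrary J)).mono fun a ha => (ha.2 i).2

lemma WeakTail.pred {n : ℕ} {P V : Ultrafilter α} (hV : SameType M L V P) {A B : α → Prop}
    (hB : WeakSet M L n P B) {t : ℕ} (ht : WeakTail M L n P V A B (t + 1)) :
    WeakTail M L n P V A B t := by
  obtain ⟨HB, _, PB, ι, _, b, hb, hbP, hno⟩ := hB
  obtain ⟨H, _, P', κ, _, g, hg, hgP, hQ⟩ := ht
  obtain ⟨W, hW1, hW2, hW3⟩ := exists_amalgam (L := L) (p := Prod.snd) PB (ultraProd P' V)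
    CoordMap.snd fun i => (hbP i).trans <| hV.symm.trans <| by
      refine fun Q _ => ?_
      rw [eventually_ultraMap, eventually_ultraProd]
      simp only [eventually_const]
  refine ⟨HB × (ι → H × α), inferInstance, W, (ι × κ) ⊕ ι, inferInstance,
    Sum.elim (fun ij w => g ij.2 (w.2 ij.1).1) (fun i w => (w.2 i).2), ?_, ?_, ?_⟩
  · rintro (⟨i, j⟩ | i)
    · have := hg j
      simp only [Sum.elim_inl]; fun_prop
    · simp only [Sum.elim_inr]; fun_prop
  · rintro (⟨i, j⟩ | i)
    · refine SameType.trans ?_ (hgP j)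
      have := (hW2 i).map (f := fun w => g j w.1) (by have := hg j; fun_prop)
      refine this.trans fun Q _ => ?_
      rw [eventually_ultraMap, eventually_ultraMap, eventually_ultraProd]
      simp only [eventually_const]
    · refine SameType.trans ?_ hV
      have := (hW2 i).map (f := fun w => w.2) (by fun_prop)
      refine this.trans fun Q _ => ?_
      rw [eventually_ultraMap, eventually_ultraProd]
      simp only [eventually_const]
  · intro Q hQgood hQtype hQg hQtail
    by_contra hcon
    push Not at hcon
    let f : ι → (HB × (ι → H × α)) × (Fin t → α) → H × (Fin (t + 1) → α) :=
      fun i q => ((q.1.2 i).1, Fin.cons (q.1.2 i).2 q.2)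
    have hf : ∀ i, CoordMap M (f i) := by
      intro i
      refine CoordMap.prodMk (by fun_prop) (CoordMap.pi fun j => ?_)
      refine Fin.cases ?_ (fun j => ?_) j
      · simp only [Fin.cons_zero]; fun_prop
      · simp only [Fin.cons_succ]; fun_prop
    have hall : ∀ i, ∀ᶠ q : (HB × (ι → H × α)) × (Fin t → α) in Q, B (q.1.2 i).2 := by
      intro i
      have := hQ (Q.map (f i)) (hQgood.map (hf i)) ?_ ?_ ?_
      · obtain ⟨j, hj⟩ := this
        revert hj
        refine Fin.cases (fun hj => hj) (fun j hj => ?_) j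
        exact (Ultrafilter.eventually_not.1 (hcon j) hj).elim
      · refine (hQtype.map (hf i)).trans fun S hS => ?_
        rw [eventually_ultraMap, eventually_ultraProd, eventually_ultraProd,
          eventually_ultraPow_succ]
        refine eventually_congr (Eventually.of_forall fun y => ?_)
        have hS' := hW2 i (fun w => S (w.1, Fin.cons w.2 y)) (hS.comp ?_)
        · rw [eventually_ultraProd] at hS'
          exact hS'
        · refine CoordMap.prodMk (by fun_prop) (CoordMap.pi fun j => ?_)
          refine Fin.cases ?_ (fun j => ?_) j
          · simp only [Fin.cons_zero]; fun_prop
          · simp only [Fin.cons_succ]; fun_prop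
      · exact fun j => hQg (Sum.inl (i, j))
      · refine fun j => Fin.cases (hQg (Sum.inr i)) (fun j => hQtail j) j
    refine hno ⟨Q.map fun q => q.1.1, hQgood.map (by fun_prop), ?_, fun i => ?_⟩
    · refine (hQtype.map (f := fun q => q.1.1) (by fun_prop)).trans (SameType.trans ?_ hW1)
      intro S _
      rw [eventually_ultraMap, eventually_ultraProd]
      simp only [eventually_const]
      rfl
    · have h1 : ∀ᶠ q : (HB × (ι → H × α)) × (Fin t → α) in Q, b i q.1.1 = (q.1.2 i).2 := by
        refine (hQtype _ (Dfn.eq ((hb i).comp (by fun_prop)) (by fun_prop))).2 ?_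
        rw [eventually_ultraProd]
        exact Eventually.of_forall fun y => hW3 i
      rw [eventually_ultraMap]
      filter_upwards [h1, hall i] with q hq hq'
      rwa [hq]

lemma WeakSet.or_strongSet {n : ℕ} {P : Ultrafilter α} {A B : α → Prop}
    (hB : WeakSet M L n P B) (hA : StrongSet M L n P A) :
    WeakSet M L n P fun a => A a ∨ B a := by
  obtain ⟨V, hV, k, hk⟩ := hA
  have htail : WeakTail M L n P V A B k := by
    refine ⟨PUnit, inferInstance, pure PUnit.unit, Empty, inferInstance, fun e => e.elim,
      fun e => e.elim, fun e => e.elim, fun Q hQ hQt _ hQAB => ?_⟩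
    by_contra hcon
    push Not at hcon
    refine hk ⟨Q.map Prod.snd, hQ.map CoordMap.snd, ?_, fun i => ?_⟩
    · refine (hQt.map CoordMap.snd).trans fun S _ => ?_
      rw [eventually_ultraMap, eventually_ultraProd]
      simp only [eventually_const]
    · rw [eventually_ultraMap]
      refine (hQAB i).mp ((hcon i).mono fun q hq hq' => ?_)
      exact hq'.resolve_right hq
  have h0 : ∀ t, WeakTail M L n P V A B t → WeakTail M L n P V A B 0 := by
    intro t ht
    induction t with
    | zero => exact ht
    | succ t ih => exact ih (ht.pred hV hB)
  obtain ⟨H, _, P', κ, _, g, hg, hgP, hQ⟩ := h0 k htail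
  refine ⟨H × (Fin 0 → α), inferInstance, ultraProd P' (ultraPow V 0), κ, inferInstance,
    fun j q => g j q.1, fun j => (hg j).comp CoordMap.fst, fun j => ?_, ?_⟩
  · refine SameType.trans (fun S _ => ?_) (hgP j)
    rw [eventually_ultraMap, eventually_ultraProd, eventually_ultraPow_zero]
    rfl
  · rintro ⟨Q, hQ1, hQ2, hQ3⟩
    obtain ⟨i, -⟩ := hQ Q hQ1 hQ2 hQ3 fun i => i.elim0
    exact i.elim0

theorem exists_good (n : ℕ) (P : Ultrafilter α) :
    ∃ U : Ultrafilter α, SameType M L U P ∧ Good M L n U := by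
  suffices H : ∀ (α : Type u) [TupleSpace M α] (P : Ultrafilter α),
      ∃ U : Ultrafilter α, SameType M L U P ∧ Good M L n U from H α P
  clear P
  induction n with
  | zero => exact fun α _ P => ⟨P, SameType.refl P, trivial⟩
  | succ n ih =>
    intro α _ P
    have hweak : ∀ l : List (α → Prop), (∀ A ∈ l, StrongSet M L n P A) →
        WeakSet M L n P fun a => ∃ A ∈ l, A a := by
      intro l hl
      induction l with
      | nil =>
        refine ⟨α, inferInstance, P, Unit, inferInstance, fun _ a => a, fun _ => CoordMap.id,
          fun _ => SameType.refl P, ?_⟩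
        rintro ⟨Q, -, -, hQ⟩
        obtain ⟨a, ha⟩ := (hQ ()).exists
        simp at ha
      | cons A l ihl =>
        have := (ihl fun B hB => hl B (List.mem_cons_of_mem _ hB)).or_strongSet
          (hl A List.mem_cons_self)
        simpa only [List.exists_mem_cons_iff] using this
    let J := {l : List (α → Prop) // ∀ A ∈ l, StrongSet M L n P A}
    have : Nonempty J := ⟨⟨[], by simp⟩⟩
    obtain ⟨U, hU⟩ := exists_ultrafilter_of_directed (fun (l : J) a => ∀ A ∈ l.1, ¬ A a)
      (fun l l' => ⟨⟨l.1 ++ l'.1, fun A hA => (List.mem_append.1 hA).elim (l.2 A) (l'.2 A)⟩,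
        fun a ha => ⟨fun A hA => ha A (List.mem_append_left _ hA),
          fun A hA => ha A (List.mem_append_right _ hA)⟩⟩)
      (fun l => by
        by_contra hcon
        push Not at hcon
        obtain ⟨H, _, P', ι, _, g, hg, hgP, hno⟩ := hweak l.1 l.2
        obtain ⟨Q, hQ, hQ'⟩ := ih H P'
        exact hno ⟨Q, hQ', hQ, fun i => Eventually.of_forall fun h => hcon _⟩)
    have hU' : ∀ A : α → Prop, StrongSet M L n P A → ¬ ∀ᶠ a in U, A a := by
      intro A hA
      rw [← Ultrafilter.eventually_not]
      exact (hU ⟨[A], by simpa using hA⟩).mono fun a ha => ha A (by simp)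
    have hUP : SameType M L U P := by
      refine (SameType.of_imp fun D hD hDP => ?_).symm
      by_contra hcon
      refine hU' (fun a => ¬ D a) ⟨P, SameType.refl P, 1, ?_⟩ (Ultrafilter.eventually_not.2 hcon)
      rintro ⟨Q, -, hQ, hQD⟩
      have h1 := (hQ.map (CoordMap.apply (0 : Fin 1))) D hD
      rw [ultraPow_map_apply] at h1
      exact Ultrafilter.eventually_not.1 (hQD 0) (h1.2 hDP)
    exact ⟨U, hUP, (good_succ_iff hUP).2 hU'⟩

lemma isClosed_sameType (P : Ultrafilter α) : IsClosed {U : Ultrafilter α | SameType M L U P} := by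
  have : {U : Ultrafilter α | SameType M L U P} =
      ⋂ (D : α → Prop) (_ : Dfn M L D) (_ : ∀ᶠ a in P, D a), {U | {a | D a} ∈ U} := by
    ext U
    simp only [Set.mem_ofPred_eq, Set.mem_iInter]
    exact ⟨fun h D hD hDP => (h D hD).2 hDP, fun h => (SameType.of_imp h).symm⟩
  rw [this]
  exact isClosed_iInter fun D => isClosed_iInter fun _ => isClosed_iInter fun _ =>
    ultrafilter_isClosed_basic _

lemma isClosed_good (n : ℕ) (P : Ultrafilter α) :
    IsClosed {U : Ultrafilter α | SameType M L U P ∧ Good M L n U} := by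
  cases n with
  | zero => simpa [Good, GoodOn] using isClosed_sameType (M := M) (L := L) P
  | succ n =>
    have : {U : Ultrafilter α | SameType M L U P ∧ Good M L (n + 1) U} =
        {U | SameType M L U P} ∩ ⋂ (A : α → Prop) (_ : StrongSet M L n P A),
          {U : Ultrafilter α | {a | ¬ A a} ∈ U} := by
      ext U
      simp only [Set.mem_ofPred_eq, Set.mem_inter_iff, Set.mem_iInter]
      refine and_congr_right fun h => ?_
      rw [good_succ_iff h]
      exact forall₂_congr fun A _ => Ultrafilter.eventually_not.symm
    rw [this]
    exact (isClosed_sameType P).inter (isClosed_iInter fun A => isClosed_iInter fun _ =>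
      ultrafilter_isClosed_basic _)

variable (M L) in
/-- Ultrafilters with well-behaved iterated powers. -/
def VeryGood (U : Ultrafilter α) : Prop := ∀ n, Good M L n U

lemma VeryGood.map {U : Ultrafilter α} (h : VeryGood M L U) {f : α → β} (hf : CoordMap M f) :
    VeryGood M L (U.map f) := fun n => (h n).map hf

theorem exists_veryGood (P : Ultrafilter α) :
    ∃ U : Ultrafilter α, SameType M L U P ∧ VeryGood M L U := by
  obtain ⟨U, hU⟩ := IsCompact.nonempty_iInter_of_directed_nonempty_isCompact_isClosed
    (fun n : ℕ => {U : Ultrafilter α | SameType M L U P ∧ Good M L n U})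
    (fun m n => ⟨max m n, fun U hU => ⟨hU.1, hU.2.mono (le_max_left _ _)⟩,
      fun U hU => ⟨hU.1, hU.2.mono (le_max_right _ _)⟩⟩)
    (fun n => exists_good n P) (fun n => (isClosed_good n P).isCompact)
    (fun n => isClosed_good n P)
  rw [Set.mem_iInter] at hU
  exact ⟨U, (hU 0).1, fun n => (hU n).2⟩

theorem VeryGood.exists_pow {U V : Ultrafilter α} (hU : VeryGood M L U)
    (hV : SameType M L V U) (k : ℕ) :
    ∃ Q : Ultrafilter (Fin k → α), VeryGood M L Q ∧ SameType M L Q (ultraPow V k) ∧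
      ∀ i, Q.map (fun y => y i) = U := by
  let J := ℕ × {A : α → Prop // ∀ᶠ a in U, A a}
  have : Nonempty J := ⟨(0, ⟨fun _ => True, by simp⟩)⟩
  let C : J → Set (Ultrafilter (Fin k → α)) := fun p =>
    {Q | SameType M L Q (ultraPow V k) ∧ Good M L p.1 Q} ∩
      ⋂ i, {Q | {y : Fin k → α | p.2.1 (y i)} ∈ Q}
  have hclosed : ∀ p, IsClosed (C p) := fun p => (isClosed_good _ _).inter
    (isClosed_iInter fun i => ultrafilter_isClosed_basic _)
  obtain ⟨Q, hQ⟩ := IsCompact.nonempty_iInter_of_directed_nonempty_isCompact_isClosed C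
    (fun p q => ⟨(max p.1 q.1, ⟨fun a => p.2.1 a ∧ q.2.1 a, p.2.2.and q.2.2⟩),
      fun Q hQ => ⟨⟨hQ.1.1, hQ.1.2.mono (le_max_left _ _)⟩, Set.mem_iInter.2 fun i =>
        mem_of_superset (Set.mem_iInter.1 hQ.2 i) fun a ha => ha.1⟩,
      fun Q hQ => ⟨⟨hQ.1.1, hQ.1.2.mono (le_max_right _ _)⟩, Set.mem_iInter.2 fun i =>
        mem_of_superset (Set.mem_iInter.1 hQ.2 i) fun a ha => ha.2⟩⟩)
    (fun p => by
      obtain ⟨Q, h1, h2, h3⟩ := hU (p.1 + 1) V hV k p.2.1 p.2.2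
      exact ⟨Q, ⟨h2, h1⟩, Set.mem_iInter.2 h3⟩)
    (fun p => (hclosed p).isCompact) hclosed
  rw [Set.mem_iInter] at hQ
  refine ⟨Q, fun n => (hQ (n, ⟨fun _ => True, by simp⟩)).1.2,
    (hQ (0, ⟨fun _ => True, by simp⟩)).1.1, fun i => Ultrafilter.eq_of_le fun s hs => ?_⟩
  exact Set.mem_iInter.1 (hQ (0, ⟨(· ∈ s), hs⟩)).2 i

end Ultrafilters

section IteratedProducts

open Filter TupleSpace

variable {Y : Type*}

/-- `S` holds almost everywhere for the iterated product of the ultrafilters in the list, the head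
being innermost. -/
def AE : List (Ultrafilter Y) → (List Y → Prop) → Prop
  | [], S => S []
  | V :: Vs, S => AE Vs fun F => ∀ᶠ b in V, S (b :: F)

lemma AE.mono {Vs : List (Ultrafilter Y)} {S S' : List Y → Prop} (h : AE Vs S)
    (hS : ∀ F, F.length = Vs.length → S F → S' F) : AE Vs S' := by
  induction Vs generalizing S S' with
  | nil => exact hS [] rfl h
  | cons V Vs ih =>
    refine ih (S := fun F => ∀ᶠ b in V, S (b :: F)) h fun F hF hb => ?_
    exact hb.mono fun b => hS _ (by simp [hF])

lemma ae_congr {Vs : List (Ultrafilter Y)} {S S' : List Y → Prop}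
    (hS : ∀ F, F.length = Vs.length → (S F ↔ S' F)) : AE Vs S ↔ AE Vs S' :=
  ⟨fun h => h.mono fun F hF => (hS F hF).1, fun h => h.mono fun F hF => (hS F hF).2⟩

lemma AE.and {Vs : List (Ultrafilter Y)} {S S' : List Y → Prop} (h : AE Vs S) (h' : AE Vs S') :
    AE Vs fun F => S F ∧ S' F := by
  induction Vs generalizing S S' with
  | nil => exact ⟨h, h'⟩
  | cons V Vs ih =>
    exact (ih (S := fun F => ∀ᶠ b in V, S (b :: F)) (S' := fun F => ∀ᶠ b in V, S' (b :: F))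
      h h').mono fun F _ hF => hF.1.and hF.2

lemma ae_not {Vs : List (Ultrafilter Y)} {S : List Y → Prop} :
    (AE Vs fun F => ¬ S F) ↔ ¬ AE Vs S := by
  induction Vs generalizing S with
  | nil => exact Iff.rfl
  | cons V Vs ih =>
    exact Iff.trans (ae_congr (Vs := Vs) fun F _ => Ultrafilter.eventually_not) ih

lemma ae_const {Vs : List (Ultrafilter Y)} {p : Prop} : (AE Vs fun _ => p) ↔ p := by
  induction Vs with
  | nil => exact Iff.rfl
  | cons V Vs ih =>
    exact Iff.trans (ae_congr (Vs := Vs) fun F _ => eventually_const) ih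

lemma ae_append {Vs Ws : List (Ultrafilter Y)} {S : List Y → Prop} :
    AE (Vs ++ Ws) S ↔ AE Ws fun G => AE Vs fun F => S (F ++ G) := by
  induction Vs generalizing S with
  | nil => exact Iff.rfl
  | cons V Vs ih => exact ih

lemma ae_forall {ι : Type*} [Finite ι] {Vs : List (Ultrafilter Y)} {S : ι → List Y → Prop}
    (h : ∀ i, AE Vs (S i)) : AE Vs fun F => ∀ i, S i F := by
  induction Vs generalizing S with
  | nil => exact h
  | cons V Vs ih => exact (ih h).mono fun F _ hF => eventually_all.2 hF

lemma ae_replicate {V : Ultrafilter Y} {k : ℕ} {S : List Y → Prop} :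
    AE (List.replicate k V) S ↔ ∀ᶠ y : Fin k → Y in ultraPow V k, S (List.ofFn y) := by
  induction k generalizing S with
  | zero => simp [AE]
  | succ k ih =>
    rw [List.replicate_succ, AE, ih, eventually_ultraPow_succ]
    simp only [List.ofFn_succ, Fin.cons_zero, Fin.cons_succ]

lemma ae_sublists {Vs : List (Ultrafilter Y)} {K : ℕ} {S : List Y → Prop}
    (h : ∀ Vs', Vs'.Sublist Vs → Vs'.length = K → AE Vs' S) :
    AE Vs fun F => ∀ G : List Y, G.Sublist F → G.length = K → S G := by
  induction Vs generalizing K S with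
  | nil =>
    intro G hG hK
    obtain rfl := List.sublist_nil.1 hG
    exact h [] (List.Sublist.refl _) hK
  | cons V Vs ih =>
    have h1 := ih fun Vs' hVs => h Vs' (hVs.cons V)
    cases K with
    | zero =>
      refine h1.mono fun F _ hF => Eventually.of_forall fun b G _ hG => ?_
      obtain rfl := List.length_eq_zero_iff.1 hG
      exact hF [] (List.nil_sublist _) rfl
    | succ K =>
      have h2 := ih (K := K) (S := fun G => ∀ᶠ b in V, S (b :: G)) fun Vs' hVs hK =>
        h (V :: Vs') (hVs.cons_cons V) (by simp [hK])
      refine (h1.and h2).mono fun F _ hF => ?_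
      have hfin : {G : List Y | G.Sublist F}.Finite := by
        simpa only [List.mem_sublists] using List.finite_toSet F.sublists
      have h3 : ∀ᶠ b in V, ∀ G ∈ {G : List Y | G.Sublist F}, G.length = K → S (b :: G) := by
        rw [eventually_all_finite hfin]
        intro G hG
        by_cases hK : G.length = K
        · exact (hF.2 G hG hK).mono fun b hb _ => hb
        · exact Eventually.of_forall fun b h => (hK h).elim
      refine h3.mono fun b hb G hG hK => ?_
      rcases List.sublist_cons_iff.1 hG with hG | ⟨G', rfl, hG⟩
      · exact hF.1 G hG hK
      · exact hb G' (List.cons_sublist_cons.1 hG) (by simpa using hK)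

lemma eventually_ultraPow_pair {V : Ultrafilter Y} {m : ℕ} {i j : Fin m} (hij : i < j)
    {P : Y → Y → Prop} :
    (∀ᶠ y : Fin m → Y in ultraPow V m, P (y i) (y j)) ↔ ∀ᶠ b in V, ∀ᶠ a in V, P a b := by
  induction m with
  | zero => exact i.elim0
  | succ m ih =>
    rw [eventually_ultraPow_succ]
    obtain ⟨j, rfl⟩ := Fin.exists_succ_eq.2 (Fin.ne_zero_of_lt hij)
    rcases Fin.eq_zero_or_eq_succ i with rfl | ⟨i, rfl⟩
    · simp only [Fin.cons_zero, Fin.cons_succ]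
      exact (eventually_ultraMap (f := fun y : Fin m → Y => y j)
        (P := fun b => ∀ᶠ a in V, P a b)).symm.trans (by rw [ultraPow_map_apply])
    · simp only [Fin.cons_succ, eventually_const]
      exact ih (Fin.succ_lt_succ_iff.1 hij)

end IteratedProducts

section KimLemma

open Filter TupleSpace LabTree

variable {M : Type u} {L : FirstOrder.Language.{u, u}} [L.Structure M]
variable {X Y Z : Type u} {R : X → Y → Prop}

variable (R) in
/-- Combs in `T`-almost all trees, followed by a long product of ultrafilters in `𝒱`, are
inconsistent. -/
def CombIncon (𝒱 : Set (Ultrafilter Y)) (K : ℕ) {A n : ℕ}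
    (T : Ultrafilter (LabTree Z Y A n)) : Prop :=
  ∀ (k : ℕ) (Vs : List (Ultrafilter Y)), (∀ V ∈ Vs, V ∈ 𝒱) → Vs.length + k = K →
    AE Vs fun F => ∀ᶠ t : LabTree Z Y A n in T, LTree.NestedIncon R k t.toTree F

lemma CombIncon.zero {𝒱 : Set (Ultrafilter Y)} {K A : ℕ}
    (h0 : ∀ Vs : List (Ultrafilter Y), (∀ V ∈ Vs, V ∈ 𝒱) → Vs.length = K →
      AE Vs fun F => ¬ Con R F) (T : Ultrafilter (LabTree Z Y A 0)) : CombIncon R 𝒱 K T := by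
  intro k Vs hVs hk
  cases k with
  | zero => exact (h0 Vs hVs hk).mono fun F _ hF => Eventually.of_forall fun t => hF
  | succ k => exact ae_const.2 trivial |>.mono fun F _ _ => Eventually.of_forall fun t => trivial

variable [TupleSpace M X] [TupleSpace M Y] [TupleSpace M Z]

lemma CombIncon.succ (hR : Dfn M L fun p : X × Y => R p.1 p.2) {𝒱 : Set (Ultrafilter Y)}
    {K A n : ℕ}
    (h0 : ∀ Vs : List (Ultrafilter Y), (∀ V ∈ Vs, V ∈ 𝒱) → Vs.length = K →
      AE Vs fun F => ¬ Con R F)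
    {T : Ultrafilter (LabTree Z Y A n)} (hT : CombIncon R 𝒱 K T)
    (hnode : ∀ p, T.map (nodeAt p) ∈ 𝒱) {T' : Ultrafilter (LabTree Z Y A (n + 1))}
    (hT' : SameType M L (T'.map fun t => t.2) (ultraPow T (A + 1))) : CombIncon R 𝒱 K T' := by
  intro k Vs hVs hk
  cases k with
  | zero => exact (h0 Vs hVs hk).mono fun F _ hF => Eventually.of_forall fun t => hF
  | succ k =>
    have hcm : ∀ (F : List Y) (t : (Fin (A + 1) → LabTree Z Y A n) → LabTree Z Y A n)
        (k : ℕ), CoordMap M t → Dfn M L fun c => LTree.NestedIncon R k (t c).toTree F := by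
      intro F t k ht
      have := dfn_nestedIncon hR k t ht (F.map fun y _ => y) (by
        simp only [List.mem_map, forall_exists_index, and_imp, forall_apply_eq_imp_iff₂]
        exact fun y _ => CoordMap.const y)
      simpa only [List.map_map, Function.comp_def, List.map_id'] using this
    have h1 : AE Vs fun F => ∀ᶠ t : LabTree Z Y A (n + 1) in T', ∀ i : Fin (A + 1),
        LTree.NestedIncon R (k + 1) (t.2 i).toTree F := by
      refine (hT (k + 1) Vs hVs hk).mono fun F _ hF => eventually_all.2 fun i => ?_
      refine (hT' _ (hcm F (fun c => c i) (k + 1) (by fun_prop))).2 ?_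
      have := eventually_ultraMap (U := ultraPow T (A + 1)) (f := fun c => c i)
        (P := fun t => LTree.NestedIncon R (k + 1) t.toTree F)
      rw [ultraPow_map_apply] at this
      exact this.1 hF
    have h2 : AE Vs fun F => ∀ (p : Pos A n) (i j : Fin (A + 1)), ∀ᶠ t : LabTree Z Y A (n + 1) in T', i < j →
        LTree.NestedIncon R k (t.2 i).toTree (nodeAt p (t.2 j) :: F) := by
      refine ae_forall fun p => ae_forall fun i => ae_forall fun j => ?_
      by_cases hij : i < j
      swap
      · exact (ae_const.2 trivial).mono fun F _ _ =>
          Eventually.of_forall fun t h => (hij h).elim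
      have h3 : AE (T.map (nodeAt p) :: Vs) fun F =>
          ∀ᶠ t : LabTree Z Y A n in T, LTree.NestedIncon R k t.toTree F := hT k _ (by
        simp only [List.forall_mem_cons]
        exact ⟨hnode p, hVs⟩) (by simp only [List.length_cons]; omega)
      refine AE.mono (Vs := Vs) h3 fun F _ hF => ?_
      rw [eventually_ultraMap] at hF
      have hdef : Dfn M L fun c : Fin (A + 1) → LabTree Z Y A n =>
          LTree.NestedIncon R k (c i).toTree (nodeAt p (c j) :: F) := by
        have := dfn_nestedIncon hR k (fun c : Fin (A + 1) → LabTree Z Y A n => c i) (by fun_prop)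
          ((fun c => nodeAt p (c j)) :: F.map fun y _ => y) (by
          simp only [List.forall_mem_cons, List.mem_map, forall_exists_index, and_imp,
            forall_apply_eq_imp_iff₂]
          exact ⟨(coordMap_nodeAt p).comp (by fun_prop), fun y _ => CoordMap.const y⟩)
        simpa only [List.map_cons, List.map_map, Function.comp_def, List.map_id'] using this
      have h4 := (hT' _ hdef).2 ((eventually_ultraPow_pair hij
        (P := fun t s => LTree.NestedIncon R k t.toTree (nodeAt p s :: F))).2 hF)
      exact (eventually_ultraMap.1 h4).mono fun t ht _ => ht
    refine (h1.and h2).mono fun F _ hF => ?_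
    have h3 : ∀ᶠ t : LabTree Z Y A (n + 1) in T', ∀ (p : Pos A n) (i j : Fin (A + 1)), i < j →
        LTree.NestedIncon R k (t.2 i).toTree (nodeAt p (t.2 j) :: F) := by
      simpa only [eventually_all] using hF.2
    filter_upwards [hF.1, h3] with t ht ht'
    refine ⟨ht, fun i j hij z hz => ?_⟩
    obtain ⟨p, rfl⟩ := mem_toTree.1 hz
    exact ht' p i j hij

lemma dfn_pathsCon (hR : Dfn M L fun p : X × Y => R p.1 p.2) {A n : ℕ}
    {α : Type u} [TupleSpace M α] (t : α → LabTree Z Y A n) (ht : CoordMap M t)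
    (fs : List (α → Y)) (hfs : ∀ f ∈ fs, CoordMap M f) :
    Dfn M L fun a => Paths (fun _ F => Con R F) (t a) (fs.map fun f => f a) :=
  dfn_paths (fun _ _ _ fs _ hfs => Dfn.con hR fs hfs) t ht fs hfs

/-- The trees constructed in the proof of Kim's lemma. -/
lemma exists_tree_ultrafilter (hR : Dfn M L fun p : X × Y => R p.1 p.2) {U : Ultrafilter Y}
    (hU : VeryGood M L U) {K : ℕ} (hK : AE (List.replicate K U) fun F => ¬ Con R F) (A n : ℕ)
    (Ws : List (Ultrafilter Y)) (hn : Ws.length = n) (hWs : ∀ V ∈ Ws, SameType M L V U) :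
    ∃ Q : Ultrafilter (Y × LabTree PUnit.{u + 1} Y A n), VeryGood M L Q ∧
      Q.map Prod.fst = U ∧ (∀ p, Q.map (fun z => nodeAt p z.2) = U) ∧
      (∀ Vs, AE (Ws ++ Vs) (Con R) →
        AE Vs fun F => ∀ᶠ z : Y × LabTree PUnit.{u + 1} Y A n in Q,
          Paths (fun _ F => Con R F) z.2 F) ∧
      CombIncon R {U} K (Q.map Prod.snd) := by
  have h0 : ∀ Vs : List (Ultrafilter Y), (∀ V ∈ Vs, V ∈ ({U} : Set _)) → Vs.length = K →
      AE Vs fun F => ¬ Con R F := by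
    intro Vs hVs hlen
    rw [List.eq_replicate_iff.2 ⟨hlen, hVs⟩]
    exact hK
  induction n generalizing Ws with
  | zero =>
    obtain rfl := List.length_eq_zero_iff.1 hn
    refine ⟨U.map fun y => (y, PUnit.unit),
      hU.map (CoordMap.prodMk CoordMap.id (CoordMap.const PUnit.unit)), ?_,
      fun p => Empty.elim p, fun Vs hVs => ?_, CombIncon.zero h0 _⟩
    · exact Ultrafilter.ext_eventually fun P => Iff.rfl
    · exact AE.mono hVs fun F _ hF => Eventually.of_forall fun z => hF
  | succ n ih =>
    obtain ⟨Ws, V, rfl⟩ : ∃ Ws' V, Ws = Ws' ++ [V] :=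
      ⟨Ws.dropLast, Ws.getLast (by rintro rfl; simp at hn), (List.dropLast_append_getLast _).symm⟩
    obtain ⟨Q, hQ, hQ1, hQ2, hQ3, hQ4⟩ := ih Ws (by simpa using hn)
      fun W hW => hWs W (List.mem_append_left _ hW)
    have hVU : SameType M L V U := hWs V (by simp)
    obtain ⟨Q', hQ', hQ'Q, hQ'c⟩ := hQ.exists_pow (SameType.refl Q) (A + 1)
    have hmap0 : Q'.map (fun c => (c 0).1) = U := by
      rw [← hQ1, ← hQ'c 0]
      rfl
    obtain ⟨r, hr, hrV⟩ := SameType.exists_lift (f := fun c : Fin (A + 1) → _ => (c 0).1)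
      (U := Q') (V' := V) (M := M) (L := L) (by fun_prop) (by rwa [hmap0])
    obtain ⟨J, hJ, hJr, hJc⟩ := hQ'.exists_pow hr 2
    let f : (Fin 2 → Fin (A + 1) → Y × LabTree PUnit.{u + 1} Y A n) →
        Y × LabTree PUnit.{u + 1} Y A (n + 1) :=
      fun J => ((J 0 0).1, ((J 1 0).1, fun i => (J 0 i).2))
    have hf2 : CoordMap M fun J => (f J).2 :=
      CoordMap.prodMk (α := Fin 2 → Fin (A + 1) → Y × LabTree PUnit.{u + 1} Y A n) (β := Y) (γ := Fin (A + 1) → LabTree PUnit.{u + 1} Y A n)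
        (f := fun J => (J 1 0).1) (g := fun J i => (J 0 i).2) (by fun_prop) (by fun_prop)
    have hf : CoordMap M f := CoordMap.prodMk (by fun_prop) hf2
    refine ⟨J.map f, hJ.map hf, ?_, ?_, ?_, ?_⟩
    · rw [← hmap0, ← hJc 0]
      rfl
    · rintro (_ | ⟨i, p⟩)
      · rw [← hmap0, ← hJc 1]
        rfl
      · rw [← hQ2 p, ← hQ'c i, ← hJc 0]
        rfl
    · intro Vs hVs
      rw [List.append_assoc] at hVs
      have h1 : AE Vs fun F => ∀ᶠ y in V, ∀ᶠ z : Y × LabTree PUnit.{u + 1} Y A n in Q,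
          Paths (fun _ F => Con R F) z.2 (y :: F) :=
        hQ3 (V :: Vs) hVs
      refine h1.mono fun F _ hF => ?_
      rw [eventually_ultraMap]
      have hd : Dfn M L fun J => Paths (fun _ F => Con R F) (f J).2 F := by
        have := dfn_pathsCon hR _ hf2 (F.map fun y _ => y) (by
          simp only [List.mem_map, forall_exists_index, and_imp, forall_apply_eq_imp_iff₂]
          exact fun y _ => CoordMap.const y)
        simpa only [List.map_map, Function.comp_def, List.map_id'] using this
      refine (hJr _ hd).2 ?_
      rw [eventually_ultraPow_succ, eventually_ultraPow_succ, eventually_ultraPow_zero]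
      rw [← hrV, eventually_ultraMap] at hF
      refine hF.mono fun c hc => ?_
      have hd' : ∀ i, Dfn M L fun c' : Fin (A + 1) → Y × LabTree PUnit.{u + 1} Y A n =>
          Paths (fun _ F => Con R F) (c' i).2 ((c 0).1 :: F) := by
        intro i
        have := dfn_pathsCon hR (fun c' : Fin (A + 1) → Y × LabTree PUnit.{u + 1} Y A n => (c' i).2)
          (by fun_prop) (((c 0).1 :: F).map fun y _ => y) (by
            simp only [List.mem_map, forall_exists_index, and_imp, forall_apply_eq_imp_iff₂]
            exact fun y _ => CoordMap.const y)
        simpa only [List.map_map, Function.comp_def, List.map_id'] using this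
      refine eventually_all.2 fun i => (hr _ (hd' i)).2 ?_
      rw [← hQ'c i] at hc
      exact hc
    · have hch : SameType M L (((J.map f).map Prod.snd).map fun t => t.2)
          (ultraPow (Q.map Prod.snd) (A + 1)) := by
        rw [ultraPow_map]
        have h1 : ((J.map f).map Prod.snd).map (fun t => t.2) =
            Q'.map fun c i => (c i).2 := by
          rw [← hJc 0]
          rfl
        rw [h1]
        exact hQ'Q.map (by fun_prop)
      refine hQ4.succ hR h0 (fun p => ?_) hch
      exact hQ2 p

/-- Kim's lemma: if a definable family divides along a very good ultrafilter, then it divides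
uniformly along all iterated products of ultrafilters of the same type. -/
theorem VeryGood.kim (hR : Dfn M L fun p : X × Y => R p.1 p.2)
    (hno : ∀ k, ¬ HasTrees R 0 k) {U : Ultrafilter Y} (hU : VeryGood M L U) {k : ℕ}
    (hk : AE (List.replicate k U) fun F => ¬ Con R F) :
    ∃ K, ∀ Vs : List (Ultrafilter Y), (∀ V ∈ Vs, SameType M L V U) → Vs.length = K →
      AE Vs fun F => ¬ Con R F := by
  by_contra hcon
  push Not at hcon
  refine hno k fun A n => ⟨[], rfl, ?_⟩
  obtain ⟨Ws, hWs, hlen, hW⟩ := hcon n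
  obtain ⟨Q, -, -, -, h1, h2⟩ := exists_tree_ultrafilter hR hU hk A n Ws hlen hWs
  have h3 : ∀ᶠ z : Y × LabTree PUnit.{u + 1} Y A n in Q,
      Paths (fun _ F => Con R F) z.2 [] := h1 [] (by
    rw [List.append_nil]
    by_contra h
    exact hW (ae_not.2 h))
  have h4 : ∀ᶠ z : Y × LabTree PUnit.{u + 1} Y A n in Q,
      LTree.NestedIncon R k z.2.toTree [] := by
    exact h2 k [] (by simp) (by simp)
  obtain ⟨z, hz, hz'⟩ := (h3.and h4).exists
  exact ⟨z.2.toTree, full_toTree _, hz.pathCon fun _ _ h => h, hz'⟩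

end KimLemma

section DividingUltrafilters

open Filter TupleSpace LabTree

variable {M : Type u} {L : FirstOrder.Language.{u, u}} [L.Structure M]

variable (M L) in
/-- No definable relation has arbitrarily large trees with inconsistent combs. -/
def NoTrees : Prop :=
  ∀ (X Y : Type u) [TupleSpace M X] [TupleSpace M Y] (R : X → Y → Prop),
    Dfn M L (fun p : X × Y => R p.1 p.2) → ∀ k, ¬ HasTrees R 0 k

variable {X Y Z : Type u} [TupleSpace M Y] [TupleSpace M Z]

variable (M L) in
/-- The family `θ` divides along iterated powers of every ultrafilter of the same type as `P`. -/
def Div (θ : X → Z → Prop) (P : Ultrafilter Z) : Prop :=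
  ∀ V : Ultrafilter Z, SameType M L V P → ∃ k, AE (List.replicate k V) fun F => ¬ Con θ F

lemma Div.mono {θ θ' : X → Z → Prop} {P : Ultrafilter Z} (h : Div M L θ P)
    (hθ : ∀ x z, θ' x z → θ x z) : Div M L θ' P := fun V hV =>
  let ⟨k, hk⟩ := h V hV
  ⟨k, hk.mono fun _ _ hF hcon => hF (hcon.imp fun x hx y hy => hθ x y (hx y hy))⟩

lemma Div.congr {θ : X → Z → Prop} {P P' : Ultrafilter Z} (h : Div M L θ P)
    (hP : SameType M L P' P) : Div M L θ P' := fun V hV => h V (hV.trans hP)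

lemma Div.of_uniform {θ : X → Z → Prop} {P : Ultrafilter Z} {K : ℕ}
    (h : ∀ Vs : List (Ultrafilter Z), (∀ V ∈ Vs, SameType M L V P) → Vs.length = K →
      AE Vs fun F => ¬ Con θ F) : Div M L θ P := fun V hV =>
  ⟨K, h _ (fun W hW => by rwa [List.eq_of_mem_replicate hW]) List.length_replicate⟩

lemma Div.false (P : Ultrafilter Z) : Div M L (fun (_ : X) (_ : Z) => False) P := fun _ _ =>
  ⟨1, Eventually.of_forall fun b ⟨_, hx⟩ => hx b List.mem_cons_self⟩

lemma div_compl {P : Ultrafilter Z} {D : Z → Prop} (hD : Dfn M L D) (h : ∀ᶠ z in P, D z) :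
    Div M L (fun (_ : X) z => ¬ D z) P := fun _ hV =>
  ⟨1, ((hV D hD).2 h).mono fun b hb ⟨_, hx⟩ => hx b List.mem_cons_self hb⟩

lemma ae_replicate_map {V : Ultrafilter Z} {f : Z → Y} {k : ℕ} {S : List Y → Prop} :
    AE (List.replicate k (V.map f)) S ↔ AE (List.replicate k V) fun F => S (F.map f) := by
  induction k generalizing S with
  | zero => exact Iff.rfl
  | succ k ih => exact ih

lemma con_map {θ : X → Y → Prop} {f : Z → Y} {F : List Z} :
    Con θ (F.map f) ↔ Con (fun x z => θ x (f z)) F := by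
  simp [Con]

lemma div_comp {θ : X → Y → Prop} {f : Z → Y} (hf : CoordMap M f) {P : Ultrafilter Z} :
    Div M L (fun x z => θ x (f z)) P ↔ Div M L θ (P.map f) := by
  constructor
  · intro h V' hV'
    obtain ⟨V, hV, rfl⟩ := hV'.exists_lift hf
    obtain ⟨k, hk⟩ := h V hV
    refine ⟨k, ae_replicate_map.2 ?_⟩
    simpa only [con_map] using hk
  · intro h V hV
    obtain ⟨k, hk⟩ := h _ (hV.map hf)
    refine ⟨k, ?_⟩
    simpa only [ae_replicate_map, con_map] using hk

variable [TupleSpace M X]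

lemma VeryGood.div (hno : NoTrees M L) {θ : X → Z → Prop}
    (hθ : Dfn M L fun p : X × Z => θ p.1 p.2) {P U : Ultrafilter Z} (hU : VeryGood M L U)
    (hUP : SameType M L U P) {k : ℕ} (hk : AE (List.replicate k U) fun F => ¬ Con θ F) :
    ∃ K, ∀ Vs : List (Ultrafilter Z), (∀ V ∈ Vs, SameType M L V P) → Vs.length = K →
      AE Vs fun F => ¬ Con θ F := by
  obtain ⟨K, hK⟩ := hU.kim hθ (hno _ _ _ hθ) hk
  exact ⟨K, fun Vs hVs => hK Vs fun V hV => (hVs V hV).trans hUP.symm⟩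

lemma Div.uniform (hno : NoTrees M L) {θ : X → Z → Prop}
    (hθ : Dfn M L fun p : X × Z => θ p.1 p.2) {P : Ultrafilter Z} (h : Div M L θ P) :
    ∃ K, ∀ Vs : List (Ultrafilter Z), (∀ V ∈ Vs, SameType M L V P) → Vs.length = K →
      AE Vs fun F => ¬ Con θ F := by
  obtain ⟨U, hUP, hU⟩ := exists_veryGood (M := M) (L := L) P
  obtain ⟨k, hk⟩ := h U hUP
  exact hU.div hno hθ hUP hk

lemma Div.or (hno : NoTrees M L) {θ₁ θ₂ : X → Z → Prop}
    (hθ₁ : Dfn M L fun p : X × Z => θ₁ p.1 p.2) (hθ₂ : Dfn M L fun p : X × Z => θ₂ p.1 p.2)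
    {P : Ultrafilter Z} (h₁ : Div M L θ₁ P) (h₂ : Div M L θ₂ P) :
    Div M L (fun x z => θ₁ x z ∨ θ₂ x z) P := by
  classical
  obtain ⟨K₁, hK₁⟩ := h₁.uniform hno hθ₁
  obtain ⟨K₂, hK₂⟩ := h₂.uniform hno hθ₂
  intro V hV
  have hsub : ∀ Vs, List.Sublist Vs (List.replicate (K₁ + K₂) V) →
      ∀ W ∈ Vs, SameType M L W P := fun Vs hVs W hW => by
    rwa [List.eq_of_mem_replicate (hVs.subset hW)]
  have h1 := ae_sublists (K := K₁) fun Vs hVs => hK₁ Vs (hsub Vs hVs)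
  have h2 := ae_sublists (K := K₂) fun Vs hVs => hK₂ Vs (hsub Vs hVs)
  refine ⟨K₁ + K₂, (h1.and h2).mono fun F hlen hF => ?_⟩
  rintro ⟨x, hx⟩
  rw [List.length_replicate] at hlen
  have key : ∀ (θ : X → Z → Prop) (K : ℕ),
      (∀ G : List Z, G.Sublist F → G.length = K → ¬ Con θ G) →
      (F.filter fun z => decide (θ x z)).length < K := by
    intro θ K hG
    by_contra! hle
    refine hG _ ((List.take_sublist K _).trans List.filter_sublist)
      (List.length_take_of_le hle) ⟨x, fun z hz => ?_⟩
    simpa using (List.mem_filter.1 (List.mem_of_mem_take hz)).2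
  have k1 := key θ₁ K₁ hF.1
  have k2 := key θ₂ K₂ hF.2
  have k3 : F.length ≤ (F.filter fun z => decide (θ₁ x z)).length +
      (F.filter fun z => decide (θ₂ x z)).length := by
    clear k1 k2 h1 h2 hF hlen key
    induction F with
    | nil => simp
    | cons z F ih =>
      have := ih fun y hy => hx y (List.mem_cons_of_mem _ hy)
      have hz := hx z List.mem_cons_self
      by_cases p1 : θ₁ x z <;> by_cases p2 : θ₂ x z <;>
        simp_all only [List.filter_cons, List.length_cons, decide_true, decide_false, if_true] <;>
        simp_all <;> omega
  omega

lemma Div.exists_mem_list (hno : NoTrees M L) {P : Ultrafilter Z} (l : List (X → Z → Prop))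
    (hl : ∀ θ ∈ l, Dfn M L (fun p : X × Z => θ p.1 p.2) ∧ Div M L θ P) :
    Dfn M L (fun p : X × Z => ∃ θ ∈ l, θ p.1 p.2) ∧ Div M L (fun x z => ∃ θ ∈ l, θ x z) P := by
  induction l with
  | nil => simpa using ⟨Dfn.const False, Div.false P⟩
  | cons θ l ih =>
    simp only [List.exists_mem_cons_iff]
    have h1 := ih fun θ' h => hl θ' (List.mem_cons_of_mem _ h)
    have h2 := hl θ List.mem_cons_self
    exact ⟨h2.1.or h1.1, Div.or hno h2.1 h1.1 h2.2 h1.2⟩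

lemma ae_replicate_ultraPow {U : Ultrafilter Z} {A k : ℕ} {S : List Z → Prop} :
    (AE (List.replicate k (ultraPow U A)) fun G => S (G.flatMap List.ofFn)) ↔
      AE (List.replicate (k * A) U) S := by
  induction k generalizing S with
  | zero => simp [AE]
  | succ k ih =>
    rw [Nat.succ_mul, Nat.add_comm (k * A), List.replicate_add A (k * A),
      ae_append (Vs := List.replicate A U)]
    exact (ih (S := fun G => ∀ᶠ y : Fin A → Z in ultraPow U A, S (List.ofFn y ++ G))).trans
      (ae_congr fun G _ => (ae_replicate (S := fun F => S (F ++ G))).symm)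

lemma VeryGood.not_div_ultraPow (hno : NoTrees M L) {θ : X → Z → Prop}
    (hθ : Dfn M L fun p : X × Z => θ p.1 p.2) {P U : Ultrafilter Z} (h : ¬ Div M L θ P)
    (hU : VeryGood M L U) (hUP : SameType M L U P) (A : ℕ) :
    ¬ Div M L (fun x (t : Fin A → Z) => ∀ i, θ x (t i)) (ultraPow U A) := by
  intro hdiv
  obtain ⟨k, hk⟩ := hdiv _ (SameType.refl _)
  have hk' : AE (List.replicate (k * A) U) fun F => ¬ Con θ F := by
    rw [← ae_replicate_ultraPow]
    refine hk.mono fun G _ hG hcon => hG ?_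
    obtain ⟨x, hx⟩ := hcon
    refine ⟨x, fun t ht i => hx _ ?_⟩
    simp only [List.mem_flatMap, List.mem_ofFn]
    exact ⟨t, ht, i, rfl⟩
  obtain ⟨K, hK⟩ := hU.div hno hθ hUP hk'
  exact h (Div.of_uniform hK)

variable (M L) in
/-- No definable set in `W` divides. -/
def NonDiv (W : Ultrafilter (X × Z)) : Prop :=
  ∀ θ : X → Z → Prop, Dfn M L (fun p : X × Z => θ p.1 p.2) → (∀ᶠ w : X × Z in W, θ w.1 w.2) →
    ¬ Div M L θ (W.map Prod.snd)

theorem exists_nonDiv (hno : NoTrees M L) (P : Ultrafilter Z) {ι : Type*} [Nonempty ι]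
    (B : ι → X → Z → Prop) (hdir : ∀ i j, ∃ k, ∀ x z, B k x z → B i x z ∧ B j x z)
    (hB : ∀ i, ¬ Div M L (B i) P) :
    ∃ W : Ultrafilter (X × Z), (∀ i, ∀ᶠ w : X × Z in W, B i w.1 w.2) ∧
      SameType M L (W.map Prod.snd) P ∧ NonDiv M L W := by
  let J := {l : List (X → Z → Prop) //
    ∀ θ ∈ l, Dfn M L (fun p : X × Z => θ p.1 p.2) ∧ Div M L θ P}
  have : Nonempty J := ⟨⟨[], by simp⟩⟩
  obtain ⟨W, hW⟩ := exists_ultrafilter_of_directed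
    (fun (j : ι × J) (w : X × Z) => B j.1 w.1 w.2 ∧ ∀ θ ∈ j.2.1, ¬ θ w.1 w.2)
    (fun j j' => by
      obtain ⟨k, hk⟩ := hdir j.1 j'.1
      refine ⟨⟨k, ⟨j.2.1 ++ j'.2.1, fun θ hθ =>
        (List.mem_append.1 hθ).elim (j.2.2 θ) (j'.2.2 θ)⟩⟩, fun w hw => ?_⟩
      exact ⟨⟨(hk _ _ hw.1).1, fun θ h => hw.2 θ (List.mem_append_left _ h)⟩,
        ⟨(hk _ _ hw.1).2, fun θ h => hw.2 θ (List.mem_append_right _ h)⟩⟩)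
    (fun j => by
      by_contra hcon
      push Not at hcon
      exact hB j.1 ((Div.exists_mem_list hno j.2.1 j.2.2).2.mono
        fun x z hxz => hcon (x, z) hxz))
  have h1 : ∀ θ : X → Z → Prop, Dfn M L (fun p : X × Z => θ p.1 p.2) → Div M L θ P →
      ∀ᶠ w : X × Z in W, ¬ θ w.1 w.2 := fun θ hθ hd =>
    (hW (Classical.arbitrary ι, ⟨[θ], by simpa using ⟨hθ, hd⟩⟩)).mono
      fun w hw => hw.2 θ (by simp)
  have h2 : SameType M L (W.map Prod.snd) P := by
    refine (SameType.of_imp fun D hD hDP => ?_).symm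
    rw [eventually_ultraMap]
    exact (h1 (fun _ z => ¬ D z) (hD.comp CoordMap.snd).not (div_compl hD hDP)).mono
      fun w hw => not_not.1 hw
  refine ⟨W, fun i => (hW (i, Classical.arbitrary J)).mono fun w hw => hw.1, h2,
    fun θ hθ hθW hd => ?_⟩
  exact Ultrafilter.eventually_not.1 (h1 θ hθ (hd.congr h2.symm)) hθW

end DividingUltrafilters

section Symmetry

open Filter TupleSpace LabTree

variable {M : Type u} {L : FirstOrder.Language.{u, u}} [L.Structure M]
variable {X Y : Type u} [TupleSpace M X] [TupleSpace M Y]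

lemma CombIncon.congr {Z : Type u} [TupleSpace M Z] {R : X → Y → Prop}
    (hR : Dfn M L fun p : X × Y => R p.1 p.2) {𝒱 : Set (Ultrafilter Y)} {K A n : ℕ}
    {T T' : Ultrafilter (LabTree Z Y A n)} (h : CombIncon R 𝒱 K T) (hT : SameType M L T' T) :
    CombIncon R 𝒱 K T' := fun k Vs hVs hk => (h k Vs hVs hk).mono fun F _ hF => by
  refine (hT _ ?_).2 hF
  have := dfn_nestedIncon hR k (fun t : LabTree Z Y A n => t) CoordMap.id
    (F.map fun y _ => y) (by
      simp only [List.mem_map, forall_exists_index, and_imp, forall_apply_eq_imp_iff₂]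
      exact fun y _ => CoordMap.const y)
  simpa only [List.map_map, Function.comp_def, List.map_id'] using this

lemma LabTree.Paths.union {Z Y : Type u} {A n : ℕ} {Ψ : Y → Z → Prop} {t : LabTree Z Y A n}
    {F G H : List Y} (hF : Paths (fun z F => ∀ y ∈ F, Ψ y z) t F)
    (hG : Paths (fun z F => ∀ y ∈ F, Ψ y z) t G) (hH : ∀ y ∈ H, y ∈ F ∨ y ∈ G) :
    Paths (fun z F => ∀ y ∈ F, Ψ y z) t H := by
  induction n generalizing F G H with
  | zero => exact fun y hy => (hH y hy).elim (hF y) (hG y)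
  | succ n ih =>
    refine fun i => ih (hF i) (hG i) fun y hy => ?_
    simp only [List.mem_cons] at hy ⊢
    have := hH y
    tauto

lemma dfn_pathsAll {Ψ : X → Y → Prop} (hΨ : Dfn M L fun p : X × Y => Ψ p.1 p.2) {A n : ℕ} :
    Dfn M L fun w : X × LabTree Y X A n => Paths (fun y F => ∀ x ∈ F, Ψ x y) w.2 [w.1] :=
  dfn_paths (S := fun y F => ∀ x ∈ F, Ψ x y) (fun α _ z fs hz hfs =>
    Dfn.forall_mem_list (P := fun a x => Ψ x (z a))
      (hΨ.comp (f := fun p : α × X => (p.2, z p.1)) (by fun_prop)) fs hfs)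
    (fun w : X × LabTree Y X A n => w.2) CoordMap.snd [fun w => w.1]
    (by simpa using CoordMap.fst)

lemma exists_symmetry_ultrafilter (hno : NoTrees M L) {W₀ : Ultrafilter (X × Y)}
    (hW₀ : NonDiv M L W₀) {Ψ : X → Y → Prop} (hΨ : Dfn M L fun p : X × Y => Ψ p.1 p.2)
    (hΨW : ∀ᶠ w : X × Y in W₀, Ψ w.1 w.2) {K : ℕ}
    (hK : ∀ Vs : List (Ultrafilter X), (∀ V ∈ Vs, SameType M L V (W₀.map Prod.fst)) →
      Vs.length = K → AE Vs fun F => ¬ Con (fun y x => Ψ x y) F) (A n : ℕ) :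
    ∃ W : Ultrafilter (X × LabTree Y X A n), NonDiv M L W ∧
      SameType M L (W.map Prod.fst) (W₀.map Prod.fst) ∧
      (∀ᶠ w : X × LabTree Y X A n in W, Paths (fun y F => ∀ x ∈ F, Ψ x y) w.2 [w.1]) ∧
      (∀ p, SameType M L ((W.map Prod.snd).map (nodeAt p)) (W₀.map Prod.fst)) ∧
      CombIncon (fun y x => Ψ x y) {V | SameType M L V (W₀.map Prod.fst)} K
        (W.map Prod.snd) := by
  have hR : Dfn M L fun p : Y × X => Ψ p.2 p.1 :=
    hΨ.comp (f := fun p : Y × X => (p.2, p.1)) (by fun_prop)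
  induction n with
  | zero =>
    refine ⟨W₀, hW₀, SameType.refl _, ?_, fun p => Empty.elim p, CombIncon.zero hK _⟩
    exact hΨW.mono fun w hw x hx => by rwa [List.mem_singleton.1 hx]
  | succ n ih =>
    obtain ⟨W, hW, hW1, hW2, hW3, hW4⟩ := ih
    obtain ⟨U, hUW, hU⟩ := exists_veryGood (M := M) (L := L) (W.map Prod.snd)
    let J := {θ : X → LabTree Y X A n → Prop //
      Dfn M L (fun p : X × LabTree Y X A n => θ p.1 p.2) ∧ ∀ᶠ w : X × LabTree Y X A n in W, θ w.1 w.2}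
    have : Nonempty J := ⟨⟨fun _ _ => True, Dfn.const True, by simp⟩⟩
    obtain ⟨W', hW'1, hW'2, hW'3⟩ := exists_nonDiv hno (ultraPow U (A + 1))
      (fun (θ : J) x t => ∀ i, θ.1 x (t i))
      (fun θ θ' => ⟨⟨fun x t => θ.1 x t ∧ θ'.1 x t, θ.2.1.and θ'.2.1, θ.2.2.and θ'.2.2⟩,
        fun x t h => ⟨fun i => (h i).1, fun i => (h i).2⟩⟩)
      (fun θ => hU.not_div_ultraPow hno θ.2.1 (hW θ.1 θ.2.1 θ.2.2) hUW (A + 1))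
    have hW'W : ∀ i, SameType M L (W'.map fun w => (w.1, w.2 i)) W := fun i =>
      SameType.symm <| SameType.of_imp fun D hD hDW => eventually_ultraMap.2 <|
        (hW'1 ⟨fun x t => D (x, t), hD, hDW⟩).mono fun w hw => hw i
    let J' := {θ : X → (Fin (A + 1) → LabTree Y X A n) → Prop //
      Dfn M L (fun p : X × (Fin (A + 1) → LabTree Y X A n) => θ p.1 p.2) ∧
        ∀ᶠ w : X × (Fin (A + 1) → LabTree Y X A n) in W', θ w.1 w.2}
    have : Nonempty J' := ⟨⟨fun _ _ => True, Dfn.const True, by simp⟩⟩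
    obtain ⟨W'', hW''1, hW''2, hW''3⟩ := exists_nonDiv hno W'
      (fun (θ : J') x (t : X × (Fin (A + 1) → LabTree Y X A n)) => θ.1 x t.2)
      (fun θ θ' => ⟨⟨fun x t => θ.1 x t ∧ θ'.1 x t, θ.2.1.and θ'.2.1, θ.2.2.and θ'.2.2⟩,
        fun x t h => h⟩)
      (fun θ => by
        rw [div_comp (θ := θ.1) CoordMap.snd]
        exact hW'3 θ.1 θ.2.1 θ.2.2)
    have hW''W : SameType M L (W''.map fun w => (w.1, w.2.2)) W' :=
      SameType.symm <| SameType.of_imp fun D hD hDW => eventually_ultraMap.2 <|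
        (hW''1 ⟨fun x t => D (x, t), hD, hDW⟩).mono fun w hw => hw
    have hch : SameType M L ((W''.map Prod.snd).map Prod.snd) (ultraPow U (A + 1)) :=
      (hW''2.map CoordMap.snd).trans hW'2
    have hlab : SameType M L (W'.map Prod.fst) (W₀.map Prod.fst) :=
      ((hW'W 0).map CoordMap.fst).trans hW1
    refine ⟨W'', hW''3, (hW''W.map CoordMap.fst).trans hlab, ?_, ?_, ?_⟩
    · have hd := dfn_pathsAll (A := A) (n := n) hΨ
      have h1 : ∀ i, ∀ᶠ w : X × (Fin (A + 1) → LabTree Y X A n) in W',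
        Paths (fun y F => ∀ x ∈ F, Ψ x y) (w.2 i) [w.1] := fun i =>
        (hW'W i _ hd).2 hW2
      have hd' : ∀ i, Dfn M L fun w : X × (Fin (A + 1) → LabTree Y X A n) =>
          Paths (fun y F => ∀ x ∈ F, Ψ x y) (w.2 i) [w.1] := fun i =>
        hd.comp (f := fun w : X × (Fin (A + 1) → LabTree Y X A n) => (w.1, w.2 i)) (by fun_prop)
      have h2 : ∀ᶠ w : X × X × (Fin (A + 1) → LabTree Y X A n) in W'', ∀ i,
        Paths (fun y F => ∀ x ∈ F, Ψ x y) (w.2.2 i) [w.1] :=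
        eventually_all.2 fun i => (hW''W _ (hd' i)).2 (h1 i)
      have h3 : ∀ᶠ w : X × X × (Fin (A + 1) → LabTree Y X A n) in W'', ∀ i,
        Paths (fun y F => ∀ x ∈ F, Ψ x y) (w.2.2 i) [w.2.1] :=
        eventually_all.2 fun i => (hW''2 _ (hd' i)).2 (h1 i)
      filter_upwards [h2, h3] with w hw hw'
      refine fun i => (hw i).union (hw' i) fun y hy => ?_
      simp only [List.mem_cons, List.not_mem_nil, or_false] at hy ⊢
      exact hy.symm
    · rintro (_ | ⟨i, p⟩)
      · exact (hW''2.map CoordMap.fst).trans hlab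
      · have h1 : SameType M L (((W''.map Prod.snd).map Prod.snd).map fun t => t i) U := by
          have := hch.map (CoordMap.apply i)
          rwa [ultraPow_map_apply] at this
        exact ((h1.trans hUW).map (coordMap_nodeAt p)).trans (hW3 p)
    · exact (hW4.congr hR hUW).succ hR hK
        (fun p => (hUW.map (coordMap_nodeAt p)).trans (hW3 p)) hch

/-- Symmetry of non-dividing at the level of ultrafilters. -/
theorem NonDiv.symm (hno : NoTrees M L) {W₀ : Ultrafilter (X × Y)} (hW₀ : NonDiv M L W₀)
    {Ψ : X → Y → Prop} (hΨ : Dfn M L fun p : X × Y => Ψ p.1 p.2)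
    (hΨW : ∀ᶠ w : X × Y in W₀, Ψ w.1 w.2) :
    ¬ Div M L (fun y x => Ψ x y) (W₀.map Prod.fst) := by
  intro hdiv
  have hR : Dfn M L fun p : Y × X => Ψ p.2 p.1 :=
    hΨ.comp (f := fun p : Y × X => (p.2, p.1)) (by fun_prop)
  obtain ⟨K, hK⟩ := hdiv.uniform hno hR
  refine hno Y X (fun y x => Ψ x y) hR K fun A n => ⟨[], rfl, ?_⟩
  obtain ⟨W, -, -, h1, -, h2⟩ := exists_symmetry_ultrafilter hno hW₀ hΨ hΨW hK A n
  have h3 : ∀ᶠ w : X × LabTree Y X A n in W,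
      LTree.NestedIncon (fun y x => Ψ x y) K w.2.toTree [] := h2 K [] (by simp) (by simp)
  obtain ⟨w, hw, hw'⟩ := (h1.and h3).exists
  refine ⟨w.2.toTree, full_toTree _, ?_, hw'⟩
  exact (hw.pathCon fun y F h => ⟨y, h⟩).mono fun y hy => by simp at hy

end Symmetry

section Formulas

variable {L : FirstOrder.Language.{u, u}}

lemma exists_formula_support {γ : Type v} (χ : L.Formula γ) :
    ∃ F : Finset γ, ∀ {γ' : Type w} (g : γ' → γ), (∀ x ∈ F, x ∈ Set.range g) →
      ∃ φ : L.Formula γ', ∀ (N : Type u) [L.Structure N] (v : γ → N),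
        φ.Realize (v ∘ g) ↔ χ.Realize v := by
  classical
  refine ⟨χ.freeVarFinset, fun {γ'} g hg => ?_⟩
  choose f hf using hg
  exact ⟨χ.restrictFreeVar fun x => f x.1 x.2, fun N _ v =>
    BoundedFormula.realize_restrictFreeVar v fun x => by simp [hf]⟩

/-- A formula involves only finitely many parameters. -/
lemma exists_formula_finite_params {ι : Type v} {δ : Type w} (χ : L.Formula (ι ⊕ δ)) :
    ∃ (r : ℕ) (h : Fin r → δ) (φ : L.Formula (ι ⊕ Fin r)),
      ∀ (N : Type u) [L.Structure N] (x : ι → N) (c : δ → N),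
        φ.Realize (Sum.elim x (c ∘ h)) ↔ χ.Realize (Sum.elim x c) := by
  obtain ⟨F, hF⟩ := exists_formula_support χ
  let e := Finset.equivFin F.toRight
  obtain ⟨φ, hφ⟩ := hF (Sum.map id fun i => (e.symm i).1) (by
    rintro (i | d) hx
    · exact ⟨Sum.inl i, rfl⟩
    · exact ⟨Sum.inr (e ⟨d, by simpa using hx⟩), by simp⟩)
  refine ⟨_, fun i => (e.symm i).1, φ, fun N _ x c => ?_⟩
  rw [← hφ]
  exact iff_of_eq (congrArg _ (by ext (i | i) <;> rfl))

/-- Finitely many formulas involve only finitely many variables. -/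
lemma exists_finite_variables {β : Type v} {J : Type*} [Finite J] {γ : J → Type w}
    (χ : ∀ j, L.Formula (β ⊕ γ j)) :
    ∃ (q : ℕ) (f : Fin q → β), f.Injective ∧ ∀ j, ∃ φ : L.Formula (Fin q ⊕ γ j),
      ∀ (N : Type u) [L.Structure N] (x : β → N) (y : γ j → N),
        φ.Realize (Sum.elim (x ∘ f) y) ↔ (χ j).Realize (Sum.elim x y) := by
  classical
  cases nonempty_fintype J
  choose F hF using fun j => exists_formula_support (χ j)
  let G := Finset.univ.biUnion fun j => (F j).toLeft
  refine ⟨_, fun i => (G.equivFin.symm i).1,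
    Subtype.val_injective.comp (Equiv.injective _), fun j => ?_⟩
  obtain ⟨φ, hφ⟩ := hF j (Sum.map (fun i => (G.equivFin.symm i).1) id) (by
    rintro (i | d) hx
    · refine ⟨Sum.inl (G.equivFin ⟨i, ?_⟩), by simp⟩
      exact Finset.mem_biUnion.2 ⟨j, Finset.mem_univ _, by simpa using hx⟩
    · exact ⟨Sum.inr d, rfl⟩)
  refine ⟨φ, fun N _ x y => ?_⟩
  rw [← hφ]
  exact iff_of_eq (congrArg _ (by ext (i | i) <;> rfl))

/-- The formula expressing that finitely many instances of a formula are simultaneously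
consistent. -/
lemma exists_formula_con {I : Type} [Finite I] {J K : Type} {E : Type w}
    (ψ : L.Formula ((I ⊕ J) ⊕ E)) (T : Finset K) :
    ∃ χ : L.Formula ((K × J) ⊕ E), ∀ (N : Type u) [L.Structure N] (y : K → J → N) (e : E → N),
      χ.Realize (Sum.elim (fun p => y p.1 p.2) e) ↔
        ∃ x : I → N, ∀ i ∈ T, ψ.Realize (Sum.elim (Sum.elim x (y i)) e) := by
  refine ⟨Formula.iExs I (Formula.iInf fun i : T => ψ.relabel
    (Sum.elim (Sum.elim Sum.inr fun j => Sum.inl (Sum.inl (i.1, j))) fun d => Sum.inl (Sum.inr d))),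
    fun N _ y e => ?_⟩
  rw [Formula.realize_iExs]
  refine exists_congr fun x => ?_
  rw [Formula.realize_iInf, Subtype.forall]
  refine forall₂_congr fun i hi => ?_
  rw [Formula.realize_relabel]
  exact iff_of_eq (congrArg _ (by ext ((j | j) | j) <;> rfl))

end Formulas

section Representation

open Filter TupleSpace

variable {L : FirstOrder.Language.{u, u}} {𝕄 : Type u} [L.Structure 𝕄]
  {S : L.ElementarySubstructure 𝕄} {ι κ : Type}

/-- The tuple `z` satisfies `χ`, a formula with parameters from `S`. -/
def Holds (χ : L.Formula (ι ⊕ S)) (z : ι → 𝕄) : Prop := χ.Realize (Sum.elim z (↑))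

lemma holds_coe {χ : L.Formula (ι ⊕ S)} {v : ι → S} :
    Holds χ (fun i => (v i : 𝕄)) ↔ χ.Realize (Sum.elim v id) := by
  have h : (Sum.elim (fun i => (v i : 𝕄)) (↑) : ι ⊕ S → 𝕄) = S.subtype ∘ Sum.elim v id := by
    ext (i | i) <;> rfl
  rw [Holds, h, S.subtype.map_formula]

lemma holds_not {χ : L.Formula (ι ⊕ S)} {z : ι → 𝕄} : Holds χ.not z ↔ ¬ Holds χ z :=
  Formula.realize_not

lemma holds_relabel {χ : L.Formula (ι ⊕ S)} {z : κ → 𝕄} (g : ι → κ) :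
    Holds (χ.relabel (Sum.map g id)) z ↔ Holds χ (z ∘ g) := by
  rw [Holds, Formula.realize_relabel]
  exact iff_of_eq (congrArg _ (by ext (i | i) <;> rfl))

lemma exists_formula_of_definable {s : Set (ι → S)} (hs : (Set.univ : Set S).Definable L s) :
    ∃ χ : L.Formula (ι ⊕ S), ∀ v, v ∈ s ↔ Holds χ fun i => (v i : 𝕄) := by
  obtain ⟨φ, rfl⟩ := Set.definable_iff_exists_formula_sum.1 hs
  refine ⟨φ.relabel (Sum.elim (fun m => Sum.inr m.1) Sum.inl), fun v => ?_⟩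
  rw [holds_coe, Formula.realize_relabel]
  exact iff_of_eq (congrArg φ.Realize (by ext (i | i) <;> rfl))

lemma definable_holds (χ : L.Formula (ι ⊕ S)) :
    (Set.univ : Set S).Definable L {v : ι → S | Holds χ fun i => (v i : 𝕄)} := by
  refine Set.definable_iff_exists_formula_sum.2
    ⟨χ.relabel (Sum.elim Sum.inr fun m => Sum.inl ⟨m, trivial⟩), ?_⟩
  ext v
  rw [Set.mem_ofPred_eq, Set.mem_ofPred_eq, holds_coe, Formula.realize_relabel]
  exact iff_of_eq (congrArg _ (by ext (i | i) <;> rfl))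

lemma dfn_holds [Finite ι] (χ : L.Formula (ι ⊕ S)) :
    Dfn S L fun v : ι → S => Holds χ fun i => (v i : 𝕄) := by
  refine Dfn.of_definable (definable_holds (χ.relabel (Sum.map (fun i => (i, ())) id)))
    fun v => holds_relabel _

lemma exists_formula_of_dfn [Finite ι] {P : (ι → S) → Prop} (hP : Dfn S L P) :
    ∃ χ : L.Formula (ι ⊕ S), ∀ v, P v ↔ Holds χ fun i => (v i : 𝕄) := by
  obtain ⟨χ, hχ⟩ := exists_formula_of_definable hP
  refine ⟨χ.relabel (Sum.map Prod.fst id), fun v => ?_⟩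
  rw [holds_relabel]
  exact hχ fun i => v i.1

/-- The ultrafilter `V` on tuples from `S` and the tuple `z` have the same type over `S`. -/
def Rep (V : Ultrafilter (ι → S)) (z : ι → 𝕄) : Prop :=
  ∀ χ : L.Formula (ι ⊕ S), Holds χ z → ∀ᶠ v : ι → S in V, Holds χ fun i => (v i : 𝕄)

/-- Consistency of instances over `S` can be tested in `S`. -/
lemma exists_holds_iff [Finite ι] (ψ : L.Formula ((ι ⊕ κ) ⊕ S)) {K : Type} (T : Finset K)
    (y : K → κ → S) :
    (∃ x : ι → 𝕄, ∀ i ∈ T, Holds ψ (Sum.elim x fun j => (y i j : 𝕄))) ↔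
      ∃ x : ι → S, ∀ i ∈ T, Holds ψ (Sum.elim (fun j => (x j : 𝕄)) fun j => (y i j : 𝕄)) := by
  obtain ⟨χ, hχ⟩ := exists_formula_con ψ T
  refine (hχ 𝕄 (fun i j => (y i j : 𝕄)) (↑)).symm.trans ?_
  refine (holds_coe (v := fun p : K × κ => y p.1 p.2)).trans ((hχ S y id).trans ?_)
  refine exists_congr fun x => forall₂_congr fun i _ => ?_
  refine (holds_coe (v := Sum.elim x (y i))).symm.trans (iff_of_eq (congrArg _ ?_))
  ext (j | j) <;> rfl

lemma exists_rep [Finite ι] (z : ι → 𝕄) : ∃ V : Ultrafilter (ι → S), Rep V z := by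
  have : Nonempty {χ : L.Formula (ι ⊕ S) // Holds χ z} := ⟨⟨⊤, Formula.realize_top.2 trivial⟩⟩
  obtain ⟨V, hV⟩ := exists_ultrafilter_of_directed
    (fun (χ : {χ : L.Formula (ι ⊕ S) // Holds χ z}) (v : ι → S) => Holds χ.1 fun i => (v i : 𝕄))
    (fun χ χ' => ⟨⟨χ.1 ⊓ χ'.1, Formula.realize_inf.2 ⟨χ.2, χ'.2⟩⟩,
      fun v hv => Formula.realize_inf.1 hv⟩)
    (fun χ => by
      have h := (exists_holds_iff (κ := Empty) (χ.1.relabel (Sum.map Sum.inl id))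
        {()} fun _ => Empty.elim).1 ⟨z, fun _ _ => (holds_relabel _).2 χ.2⟩
      obtain ⟨x, hx⟩ := h
      exact ⟨x, (holds_relabel _).1 (hx () (by simp))⟩)
  exact ⟨V, fun χ hχ => hV ⟨χ, hχ⟩⟩

namespace Rep

variable {V V' : Ultrafilter (ι → S)} {z : ι → 𝕄}

lemma eventually_iff (h : Rep V z) (χ : L.Formula (ι ⊕ S)) :
    (∀ᶠ v : ι → S in V, Holds χ fun i => (v i : 𝕄)) ↔ Holds χ z := by
  refine ⟨fun hV => ?_, h χ⟩
  by_contra hz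
  have h' := h _ (holds_not.2 hz)
  simp only [holds_not, Ultrafilter.eventually_not] at h'
  exact h' hV

lemma sameType [Finite ι] (h : Rep V z) (h' : Rep V' z) : SameType S L V V' := by
  intro P hP
  obtain ⟨χ, hχ⟩ := exists_formula_of_dfn hP
  simp only [hχ, h.eventually_iff, h'.eventually_iff]

lemma of_sameType [Finite ι] (h : Rep V z) (h' : SameType S L V' V) : Rep V' z :=
  fun χ hχ => (h' _ (dfn_holds χ)).2 (h χ hχ)

lemma map (h : Rep V z) (g : κ → ι) : Rep (V.map fun v => v ∘ g) (z ∘ g) :=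
  fun _ hχ => (h _ ((holds_relabel g).2 hχ)).mono fun _ hv => (holds_relabel g).1 hv

end Rep

end Representation

section CoheirSequences

open Filter

variable {L : FirstOrder.Language.{u, u}} {𝕄 : Type u} [L.Structure 𝕄]
  {S : L.ElementarySubstructure 𝕄} {m n : ℕ}

/-- The ultrafilter `V` on tuples from `S` generates the global type `q`. -/
def Generates (V : Ultrafilter (Fin m → S)) (q : GlobalType L 𝕄 (Fin m)) : Prop :=
  ∀ (r : ℕ) (φ : L.Formula (Fin m ⊕ Fin r)) (e : Fin r → 𝕄),
    (⟨r, (φ, e)⟩ : FmlP L 𝕄 (Fin m)) ∈ q.carrier →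
      ∀ᶠ v : Fin m → S in V, φ.Realize (Sum.elim (fun i => (v i : 𝕄)) e)

variable {V : Ultrafilter (Fin m → S)} {q : GlobalType L 𝕄 (Fin m)}

lemma GlobalType.FinSatInM.exists_generates (hq : q.FinSatInM (S : Set 𝕄)) :
    ∃ V : Ultrafilter (Fin m → S), Generates V q := by
  classical
  let J := {t : Finset (FmlP L 𝕄 (Fin m)) // ↑t ⊆ q.carrier}
  have : Nonempty J := ⟨⟨∅, by simp⟩⟩
  obtain ⟨V, hV⟩ := exists_ultrafilter_of_directed
    (fun (t : J) (v : Fin m → S) => ∀ p ∈ t.1, p.2.1.Realize (Sum.elim (fun i => (v i : 𝕄)) p.2.2))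
    (fun s t => ⟨⟨s.1 ∪ t.1, by simpa using ⟨s.2, t.2⟩⟩, fun v hv =>
      ⟨fun p hp => hv p (Finset.mem_union_left _ hp),
        fun p hp => hv p (Finset.mem_union_right _ hp)⟩⟩)
    (fun t => by
      obtain ⟨v, hv, h⟩ := hq t.1 t.2
      exact ⟨fun i => ⟨v i, hv i⟩, h⟩)
  refine ⟨V, fun r φ e h => ?_⟩
  exact (hV ⟨{⟨r, (φ, e)⟩}, by simpa using h⟩).mono fun v hv => hv _ (Finset.mem_singleton_self _)

lemma Generates.eventually_iff (hV : Generates V q) {b : Fin m → 𝕄} {C : Set 𝕄}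
    (hb : RealizesType q b C) {δ : Type w} (χ : L.Formula (Fin m ⊕ δ)) {c : δ → 𝕄}
    (hc : ∀ d, c d ∈ C) :
    (∀ᶠ v : Fin m → S in V, χ.Realize (Sum.elim (fun i => (v i : 𝕄)) c)) ↔
      χ.Realize (Sum.elim b c) := by
  obtain ⟨r, h, φ, hφ⟩ := exists_formula_finite_params χ
  simp only [← hφ]
  have hmem : ∀ i, (c ∘ h) i ∈ C := fun i => hc _
  rcases q.complete r φ (c ∘ h) with h1 | h1
  · exact iff_of_true (hV _ _ _ h1) (hb _ _ _ hmem h1)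
  · have h2 := hV _ _ _ h1
    simp only [Formula.realize_not, Ultrafilter.eventually_not] at h2
    exact iff_of_false h2 (hb _ _ _ hmem h1)

lemma Generates.rep (hV : Generates V q) {b : Fin m → 𝕄} {C : Set 𝕄}
    (hb : RealizesType q b C) (hC : (S : Set 𝕄) ⊆ C) : Rep V b :=
  fun χ hχ => (hV.eventually_iff hb χ fun s => hC s.2).2 hχ

variable {B : ℕ → Fin m → 𝕄}

lemma MorleyIn.rep (hB : MorleyIn q (S : Set 𝕄) B) (hV : Generates V q) (i : ℕ) : Rep V (B i) :=
  hV.rep (hB.2 i) Set.subset_union_left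

lemma MorleyIn.eq_of_mem (hB : MorleyIn q (S : Set 𝕄) B) {j : Fin m} (hj : B 0 j ∈ S) (i : ℕ) :
    B i j = B 0 j := by
  obtain ⟨V, hV⟩ := hB.1.exists_generates
  let χ : L.Formula (Fin m ⊕ S) := Term.equal (Term.var (Sum.inl j)) (Term.var (Sum.inr ⟨_, hj⟩))
  have h : Holds χ (B 0) := by simp [χ, Holds]
  have hi := ((hB.rep hV i).eventually_iff χ).1 (((hB.rep hV 0).eventually_iff χ).2 h)
  simpa [χ, Holds] using hi

/-- Properties of an initial segment of a coheir sequence are computed by the iterated powers of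
a generating ultrafilter. -/
lemma MorleyIn.holds_iff (hB : MorleyIn q (S : Set 𝕄) B) (hV : Generates V q)
    (χ : L.Formula ((ℕ × Fin m) ⊕ S)) (k : ℕ) (w : ℕ → Fin m → S) :
    (Holds χ fun p => if p.1 < k then B p.1 p.2 else (w p.1 p.2 : 𝕄)) ↔
      AE (List.replicate k V) fun F => Holds χ fun p => ((F[p.1]?.getD (w p.1)) p.2 : 𝕄) := by
  induction k generalizing w with
  | zero => simp [AE]
  | succ k ih =>
    let c : (ℕ × Fin m) ⊕ S → 𝕄 :=
      Sum.elim (fun p => if p.1 < k then B p.1 p.2 else (w p.1 p.2 : 𝕄)) (↑)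
    let χ' : L.Formula (Fin m ⊕ ((ℕ × Fin m) ⊕ S)) := χ.relabel
      (Sum.elim (fun p => if p.1 = k then Sum.inl p.2 else Sum.inr (Sum.inl p))
        fun s => Sum.inr (Sum.inr s))
    have hχ' : ∀ y : Fin m → 𝕄, χ'.Realize (Sum.elim y c) ↔
        Holds χ fun p => if p.1 = k then y p.2 else
          if p.1 < k then B p.1 p.2 else (w p.1 p.2 : 𝕄) := by
      intro y
      rw [Formula.realize_relabel, Holds]
      refine iff_of_eq (congrArg χ.Realize ?_)
      ext (p | s)
      · by_cases hp : p.1 = k <;> simp [hp, c]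
      · simp [c]
    have h1 := hV.eventually_iff (hB.2 k) χ' (c := c) (by
      rintro (p | s)
      · by_cases hp : p.1 < k
        · simp only [c, Sum.elim_inl, hp, if_true]
          exact Or.inr (Set.mem_biUnion hp ⟨p.2, rfl⟩)
        · simp only [c, Sum.elim_inl, hp, if_false]
          exact Or.inl (w p.1 p.2).2
      · exact Or.inl s.2)
    simp only [hχ'] at h1
    have h2 : (fun p : ℕ × Fin m => if p.1 < k + 1 then B p.1 p.2 else (w p.1 p.2 : 𝕄)) =
        fun p => if p.1 = k then B k p.2 else if p.1 < k then B p.1 p.2 else (w p.1 p.2 : 𝕄) := by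
      ext p
      rcases lt_trichotomy p.1 k with hp | hp | hp
      · simp [hp, hp.ne, Nat.lt_succ_of_lt hp]
      · simp [hp]
      · simp [hp.ne', hp.not_gt, Nat.not_lt.2 (Nat.succ_le_of_lt hp)]
    rw [h2, ← h1, List.replicate_add k 1, ae_append]
    refine eventually_congr (Eventually.of_forall fun v => ?_)
    refine Iff.trans ?_ ((ih (Function.update w k v)).trans (ae_congr fun F hF => ?_))
    · refine iff_of_eq (congrArg _ (funext fun p => ?_))
      by_cases hp : p.1 = k
      · simp [hp]
      · simp [hp]
    · rw [List.length_replicate] at hF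
      refine iff_of_eq (congrArg _ (funext fun p => ?_))
      rcases lt_trichotomy p.1 k with hp | hp | hp
      · simp [hp, hF, List.getElem?_append]
      · simp [hp, ← hF]
      · have h3 : p.1 ≠ k := hp.ne'
        simp [hp.not_gt, h3, hF, List.getElem?_append, Nat.sub_ne_zero_of_lt hp]

/-- Consistency along an initial segment of a coheir sequence. -/
lemma MorleyIn.ae_con_iff (hB : MorleyIn q (S : Set 𝕄) B) (hV : Generates V q)
    (ψ : L.Formula ((Fin n ⊕ Fin m) ⊕ S)) (k : ℕ) :
    AE (List.replicate k V) (Con fun (x : Fin n → S) (v : Fin m → S) =>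
        Holds ψ (Sum.elim (fun i => (x i : 𝕄)) fun i => (v i : 𝕄))) ↔
      ∃ x : Fin n → 𝕄, ∀ i < k, Holds ψ (Sum.elim x (B i)) := by
  obtain ⟨v₀⟩ : Nonempty (Fin m → S) := V.neBot.nonempty
  obtain ⟨χ, hχ⟩ := exists_formula_con ψ (Finset.range k)
  have h := hB.holds_iff hV χ k fun _ => v₀
  have h1 := hχ 𝕄 (fun i j => if i < k then B i j else (v₀ j : 𝕄)) (↑)
  refine Iff.trans ?_ (h.symm.trans (h1.trans (exists_congr fun x => ?_)))
  · refine ae_congr fun F hF => Iff.symm ?_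
    rw [List.length_replicate] at hF
    refine (hχ 𝕄 (fun i j => ((F[i]?.getD v₀) j : 𝕄)) (↑)).trans ?_
    refine (exists_holds_iff ψ (Finset.range k) fun i => F[i]?.getD v₀).trans ?_
    refine exists_congr fun x => ⟨fun hx y hy => ?_, fun hx i hi => ?_⟩
    · obtain ⟨i, hi, rfl⟩ := List.mem_iff_getElem.1 hy
      simpa [hi] using hx i (by simpa [hF] using hi)
    · have hi' : i < F.length := by simpa [hF] using hi
      simpa [hi'] using hx F[i] (List.getElem_mem hi')
  · refine ⟨fun hx i hi => ?_, fun hx i hi => ?_⟩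
    · simpa [hi, Holds] using hx i (Finset.mem_range.2 hi)
    · simpa [Finset.mem_range.1 hi, Holds] using hx i (Finset.mem_range.1 hi)

lemma MorleyIn.not_exists_of_div (hB : MorleyIn q (S : Set 𝕄) B) (hV : Generates V q)
    {ψ : L.Formula ((Fin n ⊕ Fin m) ⊕ S)}
    (h : Div S L (fun (x : Fin n → S) (v : Fin m → S) =>
      Holds ψ (Sum.elim (fun i => (x i : 𝕄)) fun i => (v i : 𝕄))) V) :
    ¬ ∃ x : Fin n → 𝕄, ∀ i, Holds ψ (Sum.elim x (B i)) := by
  rintro ⟨x, hx⟩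
  obtain ⟨k, hk⟩ := h V (SameType.refl V)
  exact ae_not.1 hk ((hB.ae_con_iff hV ψ k).2 ⟨x, fun i _ => hx i⟩)

end CoheirSequences

section Saturation

open Filter Cardinal

variable {L : FirstOrder.Language.{u, u}} {𝕄 : Type u} [L.Structure 𝕄] {κ : Cardinal.{u}}

lemma IsSaturated.exists_realize (hsat : IsSaturated L 𝕄 κ) (hκ : ℵ₀ < κ) {α : Type} [Countable α]
    {A : Set 𝕄} (hA : #A < κ) {Γ : Set (FmlP L 𝕄 α)} (hΓ : ∀ p ∈ Γ, ∀ i, p.2.2 i ∈ A)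
    (hfin : ∀ t : Finset (FmlP L 𝕄 α), ↑t ⊆ Γ →
      ∃ a : α → 𝕄, ∀ p ∈ t, p.2.1.Realize (Sum.elim a p.2.2)) :
    ∃ a : α → 𝕄, ∀ p ∈ Γ, p.2.1.Realize (Sum.elim a p.2.2) := by
  classical
  let f : FmlP L 𝕄 α → FmlP L 𝕄 (ULift.{u} α) := fun p =>
    ⟨p.1, (p.2.1.relabel (Sum.map ULift.up id), p.2.2)⟩
  have hf : ∀ (p : FmlP L 𝕄 α) (a : ULift.{u} α → 𝕄),
      (f p).2.1.Realize (Sum.elim a (f p).2.2) ↔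
        p.2.1.Realize (Sum.elim (fun i => a ⟨i⟩) p.2.2) := by
    intro p a
    refine Formula.realize_relabel.trans (iff_of_eq (congrArg p.2.1.Realize ?_))
    ext (i | i) <;> rfl
  have hcard : #(ULift.{u} α) < κ := (mk_le_aleph0 (α := ULift.{u} α)).trans_lt hκ
  obtain ⟨a, ha⟩ := hsat (ULift.{u} α) A hcard hA (f '' Γ) (by
    rintro _ ⟨p, hp, rfl⟩
    exact hΓ p hp) (by
    intro t ht
    obtain ⟨s, hs, rfl⟩ := Finset.subset_set_image_iff.1 ht
    obtain ⟨a, ha⟩ := hfin s hs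
    refine ⟨fun i => a i.down, fun p' hp' => ?_⟩
    obtain ⟨p, hp, rfl⟩ := Finset.mem_image.1 hp'
    exact (hf p _).2 (ha p hp))
  exact ⟨fun i => a ⟨i⟩, fun p hp => (hf p a).1 (ha _ ⟨p, hp, rfl⟩)⟩

lemma IsSaturated.exists_realizesType (hsat : IsSaturated L 𝕄 κ) (hκ : ℵ₀ < κ) {m : ℕ}
    (q : GlobalType L 𝕄 (Fin m)) {C : Set 𝕄} (hC : #C < κ) : ∃ b, RealizesType q b C := by
  obtain ⟨b, hb⟩ := hsat.exists_realize hκ hC (Γ := {p | p ∈ q.carrier ∧ ∀ i, p.2.2 i ∈ C})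
    (fun p hp => hp.2) (fun t ht => q.consistent t fun p hp => (ht hp).1)
  exact ⟨b, fun r φ c hc hφ => hb _ ⟨hφ, hc⟩⟩

lemma IsSaturated.exists_realize_seq (hsat : IsSaturated L 𝕄 κ) (hκ : ℵ₀ < κ) {n m : ℕ}
    (φ : L.Formula (Fin n ⊕ Fin m)) (B : ℕ → Fin m → 𝕄)
    (h : ∀ k, ∃ x : Fin n → 𝕄, ∀ i < k, φ.Realize (Sum.elim x (B i))) :
    ∃ x : Fin n → 𝕄, ∀ i, φ.Realize (Sum.elim x (B i)) := by
  classical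
  have hA : #(Set.range fun p : ℕ × Fin m => B p.1 p.2) < κ :=
    (Set.countable_range _).le_aleph0.trans_lt hκ
  obtain ⟨x, hx⟩ := hsat.exists_realize hκ hA
    (Γ := Set.range fun i : ℕ => (⟨m, (φ, B i)⟩ : FmlP L 𝕄 (Fin n))) (by
    rintro _ ⟨i, rfl⟩ j
    exact ⟨(i, j), rfl⟩) (by
    intro t ht
    rw [← Set.image_univ] at ht
    obtain ⟨s, -, rfl⟩ := Finset.subset_set_image_iff.1 ht
    obtain ⟨x, hx⟩ := h (s.sup id + 1)
    refine ⟨x, fun p hp => ?_⟩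
    obtain ⟨i, hi, rfl⟩ := Finset.mem_image.1 hp
    exact hx i (Nat.lt_succ_of_le (Finset.le_sup (f := id) hi)))
  exact ⟨x, fun i => hx _ ⟨i, rfl⟩⟩

lemma IsSaturated.exists_realizesType_seq (hsat : IsSaturated L 𝕄 κ) (hκ : ℵ₀ < κ) {m : ℕ}
    (q : GlobalType L 𝕄 (Fin m)) {C : Set 𝕄} (hC : #C < κ) {c : Fin m → 𝕄}
    (hc : RealizesType q c C) : ∃ B : ℕ → Fin m → 𝕄, B 0 = c ∧
      ∀ i, RealizesType q (B i) (C ∪ ⋃ (j : ℕ) (_ : j < i), Set.range (B j)) := by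
  classical
  have hstep : ∀ D : Set 𝕄, ∃ b, #D < κ → RealizesType q b D := fun D =>
    if hD : #D < κ then (hsat.exists_realizesType hκ q hD).imp fun _ hb _ => hb
    else ⟨c, fun h => (hD h).elim⟩
  choose pick hpick using hstep
  let s : ℕ → Set 𝕄 × (Fin m → 𝕄) := fun i => Nat.rec (C, c)
    (fun _ p => (p.1 ∪ Set.range p.2, pick (p.1 ∪ Set.range p.2))) i
  have hs : ∀ i, (s i).1 = C ∪ ⋃ (j : ℕ) (_ : j < i), Set.range (s j).2 := by
    intro i
    induction i with
    | zero => simp [s]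
    | succ i ih =>
      rw [Set.biUnion_lt_succ, ← Set.union_assoc, ← ih]
  have hcard : ∀ i, #(s i).1 < κ := by
    intro i
    induction i with
    | zero => exact hC
    | succ i ih =>
      exact (mk_union_le _ _).trans_lt (add_lt_of_lt hκ.le ih
        ((Set.countable_range _).le_aleph0.trans_lt hκ))
  refine ⟨fun i => (s i).2, rfl, fun i => ?_⟩
  rw [← hs]
  cases i with
  | zero => exact hc
  | succ i => exact hpick _ (hcard (i + 1))

variable {S : L.ElementarySubstructure 𝕄} {m n : ℕ}

/-- The global type generated by an ultrafilter on tuples from `S`. -/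
def ultraType (V : Ultrafilter (Fin m → S)) : GlobalType L 𝕄 (Fin m) where
  carrier := {p | ∀ᶠ v : Fin m → S in V, p.2.1.Realize (Sum.elim (fun i => (v i : 𝕄)) p.2.2)}
  consistent t ht := by
    obtain ⟨v, hv⟩ := ((eventually_all_finset t).2 fun p hp => ht hp).exists
    exact ⟨_, hv⟩
  complete r φ c := by
    simp only [Set.mem_ofPred_eq, Formula.realize_not, Ultrafilter.eventually_not]
    exact em _

lemma finSatInM_ultraType (V : Ultrafilter (Fin m → S)) :
    (ultraType V).FinSatInM (S : Set 𝕄) := by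
  intro t ht
  obtain ⟨v, hv⟩ := ((eventually_all_finset t).2 fun p hp => ht hp).exists
  exact ⟨_, fun i => (v i).2, hv⟩

lemma generates_ultraType (V : Ultrafilter (Fin m → S)) : Generates V (ultraType V) :=
  fun _ _ _ h => h

lemma Rep.realizesType {V : Ultrafilter (Fin m → S)} {c : Fin m → 𝕄} (h : Rep V c) :
    RealizesType (ultraType V) c (S : Set 𝕄) := by
  intro r φ e he hφ
  have h1 := h.eventually_iff (φ.relabel (Sum.map id fun i => (⟨e i, he i⟩ : S)))
  have h2 : ∀ z : Fin m → 𝕄, Holds (φ.relabel (Sum.map id fun i => (⟨e i, he i⟩ : S))) z ↔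
      φ.Realize (Sum.elim z e) := by
    intro z
    rw [Holds, Formula.realize_relabel]
    exact iff_of_eq (congrArg φ.Realize (by ext (i | i) <;> rfl))
  simp only [h2] at h1
  exact h1.1 hφ

/-- A formula which Conant-divides over `S` divides along all ultrafilters of the right type. -/
lemma ConantDivides.div (hsat : IsSaturated L 𝕄 κ) (hκ : ℵ₀ < κ) (hS : #S < κ)
    {ψ : L.Formula (Fin n ⊕ Fin m)} {c : Fin m → 𝕄}
    (h : ConantDivides L (S : Set 𝕄) ψ c) {P : Ultrafilter (Fin m → S)} (hP : Rep P c) :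
    Div S L (fun (x : Fin n → S) (v : Fin m → S) =>
      ψ.Realize (Sum.elim (fun i => (x i : 𝕄)) fun i => (v i : 𝕄))) P := by
  intro V hV
  by_contra! hcon
  simp only [ae_not, not_not] at hcon
  have hVc := hP.of_sameType hV
  obtain ⟨B, hB0, hB⟩ := hsat.exists_realizesType_seq hκ (ultraType V) hS hVc.realizesType
  have hM : MorleyIn (ultraType V) (S : Set 𝕄) B := ⟨finSatInM_ultraType V, hB⟩
  refine h B ⟨_, hM⟩ hB0 (hsat.exists_realize_seq hκ ψ B fun k => ?_)
  have hψ : ∀ z : Fin n ⊕ Fin m → 𝕄, Holds (S := S) (ψ.relabel Sum.inl) z ↔ ψ.Realize z := by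
    intro z
    rw [Holds, Formula.realize_relabel, Sum.elim_comp_inl]
  have h1 := hM.ae_con_iff (generates_ultraType V) (ψ.relabel Sum.inl) k
  simp only [hψ] at h1
  exact h1.1 (hcon k)

end Saturation

section ConantIndependence

open Filter Cardinal

variable {L : FirstOrder.Language.{u, u}} {𝕄 : Type u} [L.Structure 𝕄]
  {S : L.ElementarySubstructure 𝕄}

lemma CoordMap.sumElim {M : Type u} {ι κ : Type} [Finite ι] [Finite κ] :
    CoordMap M fun p : (ι → M) × (κ → M) => Sum.elim p.1 p.2 := by
  rintro ⟨i | i, j⟩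
  · exact ⟨Sum.inl (Sum.inl (i, j)), fun _ => rfl⟩
  · exact ⟨Sum.inl (Sum.inr (i, j)), fun _ => rfl⟩

lemma exists_formula_of_dfn_prod {ι κ : Type} [Finite ι] [Finite κ]
    {θ : (ι → S) → (κ → S) → Prop} (hθ : Dfn S L fun p : (ι → S) × (κ → S) => θ p.1 p.2) :
    ∃ χ : L.Formula ((ι ⊕ κ) ⊕ S), ∀ x z,
      θ x z ↔ Holds χ (Sum.elim (fun i => (x i : 𝕄)) fun i => (z i : 𝕄)) := by
  obtain ⟨χ, hχ⟩ := exists_formula_of_dfn (hθ.comp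
    (f := fun v : ι ⊕ κ → S => (v ∘ Sum.inl, v ∘ Sum.inr))
    ((CoordMap.precomp Sum.inl).prodMk (CoordMap.precomp Sum.inr)))
  refine ⟨χ, fun x z => (hχ (Sum.elim x z)).trans (iff_of_eq (congrArg _ ?_))⟩
  ext (i | i) <;> rfl

lemma dfn_realize {ι κ : Type} [Finite ι] [Finite κ] (ψ : L.Formula (ι ⊕ κ)) :
    Dfn S L fun p : (ι → S) × (κ → S) =>
      ψ.Realize (Sum.elim (fun i => (p.1 i : 𝕄)) fun i => (p.2 i : 𝕄)) := by
  convert (dfn_holds (S := S) (ψ.relabel Sum.inl)).comp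
    (CoordMap.sumElim (M := S) (ι := ι) (κ := κ)) using 2 with p
  rw [Holds, Formula.realize_relabel, Sum.elim_comp_inl]
  exact iff_of_eq (congrArg ψ.Realize (by ext (i | i) <;> rfl))

lemma ConantDivides.conantForks {Ms : Set 𝕄} {α : Type v} {n : ℕ} {φ : L.Formula (α ⊕ Fin n)}
    {b : Fin n → 𝕄} (h : ConantDivides L Ms φ b) : ConantForks L Ms φ b :=
  ⟨1, fun _ => n, fun _ => φ, fun _ => b, fun _ => h, fun _ ha => ⟨0, ha⟩⟩

lemma ConantIndep.nonDiv {α : Type v} {β : Type w} {a : α → 𝕄} {b : β → 𝕄}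
    (h : ConantIndep L (S : Set 𝕄) a b) {n q : ℕ} {d : Fin n → 𝕄}
    (hd : ∀ i, d i ∈ (S : Set 𝕄) ∪ Set.range a) {f : Fin q → β}
    {W : Ultrafilter (Fin n ⊕ Fin q → S)} (hW : Rep W (Sum.elim d (b ∘ f))) :
    NonDiv S L (W.map fun v => (v ∘ Sum.inl, v ∘ Sum.inr)) := by
  intro θ hθ hθW hdiv
  obtain ⟨χ, hχ⟩ := exists_formula_of_dfn_prod hθ
  have hχd : Holds χ (Sum.elim d (b ∘ f)) := by
    refine (hW.eventually_iff χ).1 ((eventually_ultraMap.1 hθW).mono fun v hv => ?_)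
    refine (iff_of_eq (congrArg (Holds χ) ?_)).1 ((hχ _ _).1 hv)
    ext (i | i) <;> rfl
  have ht : ∀ i, ∃ t : α ⊕ S, Sum.elim a (↑) t = d i := by
    intro i
    rcases hd i with hi | ⟨j, hj⟩
    · exact ⟨Sum.inr ⟨_, hi⟩, rfl⟩
    · exact ⟨Sum.inl j, hj⟩
  choose t ht using ht
  let χ' : L.Formula ((α ⊕ Fin q) ⊕ S) := χ.relabel
    (Sum.elim (Sum.elim (fun i => Sum.map Sum.inl id (t i)) fun j => Sum.inl (Sum.inr j)) Sum.inr)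
  have hχ' : ∀ (x : α → 𝕄) (z : Fin q → 𝕄), χ'.Realize (Sum.elim (Sum.elim x z) (↑)) ↔
      Holds χ (Sum.elim (fun i => Sum.elim x (↑) (t i)) z) := by
    intro x z
    rw [Formula.realize_relabel, Holds]
    refine iff_of_eq (congrArg χ.Realize ?_)
    ext ((i | i) | i)
    · simp only [Function.comp_apply, Sum.elim_inl]
      cases t i <;> rfl
    · rfl
    · rfl
  obtain ⟨r, e, φ₀, hφ₀⟩ := exists_formula_finite_params χ'
  let φ : L.Formula (α ⊕ Fin (q + r)) := φ₀.relabel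
    (Sum.elim (Sum.map id (Fin.castAdd r)) fun i => Sum.inr (Fin.natAdd q i))
  have hφ : ∀ (x : α → 𝕄) (y : Fin (q + r) → 𝕄), (∀ i, y (Fin.natAdd q i) = e i) →
      (φ.Realize (Sum.elim x y) ↔
        Holds χ (Sum.elim (fun i => Sum.elim x (↑) (t i)) (y ∘ Fin.castAdd r))) := by
    intro x y hy
    rw [← hχ', ← hφ₀, Formula.realize_relabel]
    refine iff_of_eq (congrArg φ₀.Realize ?_)
    ext ((i | i) | i)
    · rfl
    · rfl
    · exact hy i
  let c : Fin (q + r) → 𝕄 := Fin.append (b ∘ f) fun i => (e i : 𝕄)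
  have hce : ∀ i, c (Fin.natAdd q i) = e i := fun i => Fin.append_right _ _ i
  have hcb : c ∘ Fin.castAdd r = b ∘ f := funext fun i => Fin.append_left _ _ i
  have h1 : ¬ ConantDivides L (S : Set 𝕄) φ c := fun hdiv => h _ φ c (by
    intro i
    refine Fin.addCases (fun i => ?_) (fun i => ?_) i
    · exact Or.inr ⟨f i, (congrFun hcb i).symm⟩
    · rw [hce]
      exact Or.inl (e i).2) ((hφ a c hce).2 (by simpa only [ht, hcb] using hχd)) hdiv.conantForks
  simp only [ConantDivides, not_forall, not_not] at h1
  obtain ⟨B, ⟨p, hB⟩, hB0, x, hx⟩ := h1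
  obtain ⟨V, hV⟩ := hB.1.exists_generates
  have hBe : ∀ i k, B i (Fin.natAdd q k) = e k := by
    intro i k
    rw [hB.eq_of_mem (by rw [hB0, hce]; exact (e k).2) i, hB0, hce]
  have hVb : Rep (V.map fun v => v ∘ Fin.castAdd r) (b ∘ f) := by
    rw [← hcb, ← hB0]
    exact (hB.rep hV 0).map _
  have hψ : ∀ (x : Fin n → 𝕄) (y : Fin (q + r) → 𝕄),
      Holds (χ.relabel (Sum.map (Sum.map id (Fin.castAdd r)) id)) (Sum.elim x y) ↔
        Holds χ (Sum.elim x (y ∘ Fin.castAdd r)) := by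
    intro x y
    rw [holds_relabel]
    exact iff_of_eq (congrArg (Holds χ) (by ext (i | i) <;> rfl))
  refine hB.not_exists_of_div hV (ψ := χ.relabel (Sum.map (Sum.map id (Fin.castAdd r)) id)) ?_
    ⟨fun i => Sum.elim x (↑) (t i), fun i => (hψ _ _).2 ((hφ x _ (hBe i)).1 (hx i))⟩
  refine ((div_comp (CoordMap.precomp (Fin.castAdd r))).2
    (hdiv.congr (hVb.sameType (hW.map Sum.inr)))).mono fun x v hv => ?_
  exact (hχ _ _).2 ((hψ _ _).1 hv)

lemma ConantForks.exists_finite_variables {Ms : Set 𝕄} {β : Type v} (b : β → 𝕄) {n : ℕ}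
    {φ : L.Formula (β ⊕ Fin n)} {d : Fin n → 𝕄} (h : ConantForks L Ms φ d) :
    ∃ (q : ℕ) (f : Fin q → β) (φ' : L.Formula (Fin q ⊕ Fin n)),
      (∀ x y, φ'.Realize (Sum.elim (x ∘ f) y : _ → 𝕄) ↔ φ.Realize (Sum.elim x y)) ∧
        ConantForks L Ms φ' d := by
  obtain ⟨N, m, ψ, c, hdiv, hφψ⟩ := h
  obtain ⟨q, f, hf, hχ⟩ := NSOP2Paper.exists_finite_variables
    (γ := fun j : Option (Fin N) => Fin (j.elim n m)) (Option.rec φ ψ)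
  obtain ⟨φ', hφ'⟩ := hχ none
  choose ψ' hψ' using fun j => hχ (some j)
  have hext : ∀ x : Fin q → 𝕄, Function.extend f x b ∘ f = x := fun x =>
    Function.extend_comp hf x b
  refine ⟨q, f, φ', hφ' 𝕄, N, m, ψ', c, fun j B hB hB0 => ?_, fun x hx => ?_⟩
  · rintro ⟨x, hx⟩
    refine hdiv j B hB hB0 ⟨Function.extend f x b, fun i => (hψ' j 𝕄 _ _).1 ?_⟩
    rw [hext]
    exact hx i
  · rw [← hext x] at hx
    obtain ⟨j, hj⟩ := hφψ _ ((hφ' 𝕄 _ _).1 hx)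
    refine ⟨j, ?_⟩
    rw [← hext x]
    exact (hψ' j 𝕄 _ _).2 hj

variable {κ : Cardinal.{u}}

/-- A formula which Conant-forks over `S` divides along ultrafilters, in the absence of trees. -/
lemma ConantForks.div (hsat : IsSaturated L 𝕄 κ) (hκ : ℵ₀ < κ) (hS : #S < κ)
    (hno : NoTrees S L) {n q : ℕ} {φ : L.Formula (Fin q ⊕ Fin n)} {d : Fin n → 𝕄}
    (h : ConantForks L (S : Set 𝕄) φ d) {P : Ultrafilter (Fin n → S)} (hP : Rep P d) :
    Div S L (fun (x : Fin q → S) (v : Fin n → S) =>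
      φ.Realize (Sum.elim (fun i => (x i : 𝕄)) fun i => (v i : 𝕄))) P := by
  obtain ⟨N, m, ψ, c, hdiv, hφψ⟩ := h
  let ι := Fin n ⊕ (j : Fin N) × Fin (m j)
  let z : ι → 𝕄 := Sum.elim d fun p => c p.1 p.2
  obtain ⟨Q, hQ⟩ := exists_rep (S := S) z
  let Δ : L.Formula (ι ⊕ S) := (Formula.iExs (Fin q)
    (φ.relabel (Sum.elim Sum.inr fun i => Sum.inl (Sum.inl (Sum.inl i))) ⊓
      Formula.iInf fun j : Fin N => ((ψ j).relabel
        (Sum.elim Sum.inr fun i => Sum.inl (Sum.inl (Sum.inr ⟨j, i⟩)))).not)).not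
  have hΔ : ∀ v : ι → 𝕄, Holds Δ v ↔ ∀ x : Fin q → 𝕄,
      φ.Realize (Sum.elim x fun i => v (Sum.inl i)) →
        ∃ j, (ψ j).Realize (Sum.elim x fun i => v (Sum.inr ⟨j, i⟩)) := by
    intro v
    simp only [Holds, Δ, Formula.realize_not, Formula.realize_iExs, Formula.realize_inf,
      Formula.realize_iInf, Formula.realize_relabel, not_exists, not_and, not_forall, not_not]
    refine forall_congr' fun x => imp_congr ?_ (exists_congr fun j => ?_)
    · exact iff_of_eq (congrArg φ.Realize (by ext (i | i) <;> rfl))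
    · exact iff_of_eq (congrArg (ψ j).Realize (by ext (i | i) <;> rfl))
  let D : (ι → S) → Prop := fun v => Holds Δ fun i => (v i : 𝕄)
  let θ : Fin N → (Fin q → S) → (ι → S) → Prop := fun j x v =>
    (ψ j).Realize (Sum.elim (fun i => (x i : 𝕄)) fun i => (v (Sum.inr ⟨j, i⟩) : 𝕄))
  have hθ : ∀ j, Dfn S L (fun p : (Fin q → S) × (ι → S) => θ j p.1 p.2) ∧ Div S L (θ j) Q := by
    intro j
    have hmap : CoordMap S fun v : ι → S => fun i => v (Sum.inr ⟨j, i⟩) := CoordMap.precomp _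
    constructor
    · exact (dfn_realize (ψ j)).comp
        (f := fun p : (Fin q → S) × (ι → S) => (p.1, fun i => p.2 (Sum.inr ⟨j, i⟩)))
        (CoordMap.fst.prodMk (hmap.comp CoordMap.snd))
    · exact (div_comp hmap).2 ((hdiv j).div hsat hκ hS (hQ.map fun i => Sum.inr ⟨j, i⟩))
  have hlist := (Div.exists_mem_list hno ((fun _ v => ¬ D v) :: (List.finRange N).map θ) (by
    simp only [List.mem_cons, List.mem_map, List.mem_finRange, true_and]
    rintro _ (rfl | ⟨j, rfl⟩)
    · exact ⟨((dfn_holds Δ).comp CoordMap.snd).not, div_compl (dfn_holds Δ)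
        ((hQ.eventually_iff Δ).2 ((hΔ z).2 hφψ))⟩
    · exact hθ j)).2
  refine Div.congr ((div_comp (CoordMap.precomp Sum.inl)).1 (hlist.mono fun x v hv => ?_))
    (hP.sameType (hQ.map Sum.inl))
  by_cases hD : D v
  · obtain ⟨j, hj⟩ := (hΔ _).1 hD _ hv
    exact ⟨θ j, List.mem_cons_of_mem _ (List.mem_map_of_mem (List.mem_finRange j)), hj⟩
  · exact ⟨_, List.mem_cons_self, hD⟩

theorem ConantIndep.symm (hsat : IsSaturated L 𝕄 κ) (hκ : ℵ₀ < κ) (hS : #S < κ)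
    (hno : NoTrees S L) {α : Type v} {β : Type w} {a : α → 𝕄} {b : β → 𝕄}
    (h : ConantIndep L (S : Set 𝕄) a b) : ConantIndep L (S : Set 𝕄) b a := by
  intro n φ d hd hφ hfork
  obtain ⟨q, f, φ', hφ', hfork'⟩ := hfork.exists_finite_variables b
  obtain ⟨W, hW⟩ := exists_rep (S := S) (Sum.elim d (b ∘ f))
  refine (h.nonDiv hd hW).symm hno (Ψ := fun x y =>
    φ'.Realize (Sum.elim (fun i => (y i : 𝕄)) fun i => (x i : 𝕄))) ?_ ?_ ?_
  · exact (dfn_realize φ').comp (f := fun p : (Fin n → S) × (Fin q → S) => (p.2, p.1))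
      (CoordMap.snd.prodMk CoordMap.fst)
  · have h1 := hW.eventually_iff (φ'.relabel fun i => Sum.inl i.swap)
    have h2 : ∀ z : Fin n ⊕ Fin q → 𝕄, Holds (S := S) (φ'.relabel fun i => Sum.inl i.swap) z ↔
        φ'.Realize (Sum.elim (z ∘ Sum.inr) (z ∘ Sum.inl)) := by
      intro z
      rw [Holds, Formula.realize_relabel]
      exact iff_of_eq (congrArg φ'.Realize (by ext (i | i) <;> rfl))
    simp only [h2] at h1
    exact h1.2 ((hφ' b d).2 hφ)
  · exact hfork'.div hsat hκ hS hno (hW.map Sum.inl)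

end ConantIndependence

section Compactness

open Filter Cardinal TupleSpace

variable {L : FirstOrder.Language.{u, u}} {𝕄 : Type u} [L.Structure 𝕄] {κ : Cardinal.{u}}

/-- Some tuple satisfies all formulas which hold for all tuples far enough in a decreasing
sequence of nonempty conditions. -/
lemma IsSaturated.exists_limit (hsat : IsSaturated L 𝕄 κ) (hκ : ℵ₀ < κ) {α : Type} [Countable α]
    (P : ℕ → (α → 𝕄) → Prop) (hmono : ∀ i j b, i ≤ j → P j b → P i b) (hP : ∀ i, ∃ b, P i b) :
    ∃ b : α → 𝕄, ∀ (χ : L.Formula (α ⊕ Fin 0)) (i : ℕ),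
      (∀ b', P i b' → χ.Realize (Sum.elim b' Fin.elim0)) → χ.Realize (Sum.elim b Fin.elim0) := by
  classical
  let Γ : Set (L.Formula (α ⊕ Fin 0)) :=
    {χ | ∃ i, ∀ b', P i b' → χ.Realize (Sum.elim b' Fin.elim0)}
  obtain ⟨b, hb⟩ := hsat.exists_realize hκ (A := ∅) (by simpa using aleph0_pos.trans hκ)
    (Γ := (fun χ => (⟨0, (χ, Fin.elim0)⟩ : FmlP L 𝕄 α)) '' Γ) (by
    rintro _ ⟨χ, -, rfl⟩ i
    exact i.elim0) (by
    intro t ht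
    obtain ⟨s, hs, rfl⟩ := Finset.subset_set_image_iff.1 ht
    have hs' : ∀ χ : s, ∃ i, ∀ b', P i b' → χ.1.Realize (Sum.elim b' Fin.elim0) :=
      fun χ => hs χ.2
    choose i hi using hs'
    obtain ⟨b, hb⟩ := hP (Finset.univ.sup i)
    refine ⟨b, fun p hp => ?_⟩
    obtain ⟨χ, hχ, rfl⟩ := Finset.mem_image.1 hp
    exact hi ⟨χ, hχ⟩ b (hmono _ _ b (Finset.le_sup (Finset.mem_univ _)) hb))
  exact ⟨b, fun χ i hχ => hb _ ⟨χ, ⟨i, hχ⟩, rfl⟩⟩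

lemma ofFn_prefix_ofFn {γ : Type*} (σ : ℕ → γ) {i k : ℕ} (h : i ≤ k) :
    (List.ofFn fun j : Fin i => σ j) <+: List.ofFn fun j : Fin k => σ j := by
  obtain ⟨l, rfl⟩ := Nat.exists_eq_add_of_le h
  rw [List.ofFn_add]
  exact List.prefix_append _ _

/-- Arbitrarily tall finite trees witnessing `SOP₂` suffice for `SOP₂`. -/
lemma IsSaturated.hasSOP2 (hsat : IsSaturated L 𝕄 κ) (hκ : ℵ₀ < κ) {n m : ℕ}
    (φ : L.Formula (Fin n ⊕ Fin m))
    (h : ∀ k : ℕ, ∃ b : List Bool → Fin m → 𝕄,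
      (∀ η : List Bool, η.length < k →
        ∃ x : Fin n → 𝕄, ∀ ν ∈ η.inits.toFinset, φ.Realize (Sum.elim x (b ν))) ∧
      ∀ η ν : List Bool, η.length < k → ν.length < k → ¬ η <+: ν → ¬ ν <+: η →
        ¬ ∃ x : Fin n → 𝕄, ∀ i ∈ ({η, ν} : Finset (List Bool)), φ.Realize (Sum.elim x (b i))) :
    HasSOP2 L 𝕄 := by
  choose χ hχ using fun T : Finset (List Bool) =>
    exists_formula_con (φ.relabel Sum.inl : L.Formula ((Fin n ⊕ Fin m) ⊕ Fin 0)) T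
  have hχ' : ∀ T (b : List Bool × Fin m → 𝕄), (χ T).Realize (Sum.elim b Fin.elim0) ↔
      ∃ x : Fin n → 𝕄, ∀ ν ∈ T, φ.Realize (Sum.elim x fun j => b (ν, j)) := by
    intro T b
    simpa only [Formula.realize_relabel, Sum.elim_comp_inl] using
      hχ T 𝕄 (fun i j => b (i, j)) Fin.elim0
  obtain ⟨b, hb⟩ := hsat.exists_limit hκ
    (fun k (b : List Bool × Fin m → 𝕄) =>
      (∀ η : List Bool, η.length < k → (χ η.inits.toFinset).Realize (Sum.elim b Fin.elim0)) ∧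
      ∀ η ν : List Bool, η.length < k → ν.length < k → ¬ η <+: ν → ¬ ν <+: η →
        (χ {η, ν}).not.Realize (Sum.elim b Fin.elim0))
    (fun i j b hij hb => ⟨fun η hη => hb.1 η (hη.trans_le hij),
      fun η ν hη hν => hb.2 η ν (hη.trans_le hij) (hν.trans_le hij)⟩)
    (fun k => by
      obtain ⟨b, hb1, hb2⟩ := h k
      refine ⟨fun p => b p.1 p.2, fun η hη => (hχ' _ _).2 (hb1 η hη),
        fun η ν hη hν h1 h2 => ?_⟩
      rw [Formula.realize_not, hχ']
      exact hb2 η ν hη hν h1 h2)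
  refine ⟨n, m, φ, fun η j => b (η, j), fun σ => ?_, fun η ν h1 h2 => ?_⟩
  · refine hsat.exists_realize_seq hκ φ
      (fun k j => b (List.ofFn fun i : Fin k => σ i, j)) fun k => ?_
    obtain ⟨x, hx⟩ := (hχ' _ b).1 (hb (χ (List.ofFn fun i : Fin k => σ i).inits.toFinset) (k + 1)
      fun b' hb' => hb'.1 _ (by simp))
    refine ⟨x, fun i hi => hx _ ?_⟩
    rw [List.mem_toFinset, List.mem_inits]
    exact ofFn_prefix_ofFn σ hi.le
  · rintro ⟨x, hx1, hx2⟩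
    have h3 := hb (χ {η, ν}).not (max η.length ν.length + 1) fun b' hb' =>
      hb'.2 η ν (by omega) (by omega) h1 h2
    rw [Formula.realize_not, hχ'] at h3
    exact h3 ⟨x, by simpa using ⟨hx1, hx2⟩⟩

variable {S : L.ElementarySubstructure 𝕄}

theorem noTrees_of_not_hasSOP2 (hsat : IsSaturated L 𝕄 κ) (hκ : ℵ₀ < κ) (h : ¬ HasSOP2 L 𝕄) :
    NoTrees S L := by
  intro X Y _ _ R hR k hT
  obtain ⟨l, hl⟩ := hT.hasBinaryTrees
  obtain ⟨χ, hχ⟩ := exists_formula_of_definable hR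
  obtain ⟨r, e, φ₀, hφ₀⟩ := exists_formula_finite_params χ
  let n := Nat.card (idx S X)
  let m := Nat.card ((Fin l × idx S Y) ⊕ Fin r)
  let eX : idx S X ≃ Fin n := Finite.equivFin _
  let eY : (Fin l × idx S Y) ⊕ Fin r ≃ Fin m := Finite.equivFin _
  let φ : L.Formula (Fin n ⊕ Fin m) := Formula.iInf fun i : Fin l => φ₀.relabel
    (Sum.elim (Sum.elim (fun j => Sum.inl (eX j)) fun j => Sum.inr (eY (Sum.inl (i, j))))
      fun j => Sum.inr (eY (Sum.inr j)))
  let b : (Fin l → Y) → Fin m → S := fun y j =>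
    Sum.elim (fun p => (coord (y p.1) : idx S Y → S) p.2) e (eY.symm j)
  have hφ : ∀ (x : X) (y : Fin l → Y),
      φ.Realize (Sum.elim (fun i => ((coord x : idx S X → S) (eX.symm i) : 𝕄))
        fun i => (b y i : 𝕄)) ↔ ∀ i, R x (y i) := by
    intro x y
    rw [Formula.realize_iInf]
    refine forall_congr' fun i => ?_
    have h1 := hχ (coord (x, y i))
    rw [Set.mem_ofPred_eq, Equiv.symm_apply_apply] at h1
    refine Iff.trans ?_ h1.symm
    rw [Holds, ← hφ₀, Formula.realize_relabel]
    refine iff_of_eq (congrArg φ₀.Realize ?_)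
    ext ((j | j) | j)
    · simp [coord]
    · simp [coord, b]
    · simp [b]
  have hcon : ∀ (y : List Bool → Fin l → Y) (T : Finset (List Bool)),
      (∃ x : Fin n → 𝕄, ∀ ν ∈ T, φ.Realize (Sum.elim x fun j => (b (y ν) j : 𝕄))) ↔
        ∃ x : X, ∀ ν ∈ T, ∀ i, R x (y ν i) := by
    intro y T
    have h1 := exists_holds_iff (S := S) (φ.relabel Sum.inl) T fun ν => b (y ν)
    simp only [Holds, Formula.realize_relabel, Sum.elim_comp_inl] at h1
    rw [h1]
    constructor
    · rintro ⟨x, hx⟩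
      refine ⟨coord.symm fun i => x (eX i), fun ν hν => (hφ _ _).1 ?_⟩
      simpa using hx ν hν
    · rintro ⟨x, hx⟩
      exact ⟨fun i => (coord x : idx S X → S) (eX.symm i), fun ν hν => (hφ _ _).2 (hx ν hν)⟩
  refine h (hsat.hasSOP2 hκ φ fun k => ?_)
  obtain ⟨g, hg1, hg2, hg3⟩ := hl (k + 1)
  have hg : ∀ η, η.length < k + 1 → ∃ y : Fin l → Y, g η = List.ofFn y := by
    intro η hη
    obtain rfl := hg1 η hη
    exact ⟨_, (List.ofFn_get _).symm⟩
  have hg' : ∀ η, ∃ y : Fin l → Y, η.length < k + 1 → g η = List.ofFn y := by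
    intro η
    by_cases hη : η.length < k + 1
    · exact (hg η hη).imp fun _ h _ => h
    · exact (hg [] k.succ_pos).imp fun _ _ h => (hη h).elim
  choose y hy using hg'
  refine ⟨fun η j => b (y η) j, fun η hη => (hcon y _).2 ?_,
    fun η ν hη hν h1 h2 hx => ?_⟩
  · obtain ⟨x, hx⟩ := hg2 η (by omega)
    refine ⟨x, fun ν hν i => hx ν (by simpa using hν) _ ?_⟩
    have h1 : ν.length ≤ η.length := List.IsPrefix.length_le (by simpa using hν)
    rw [hy ν (by omega)]
    exact List.mem_ofFn.2 ⟨i, rfl⟩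
  · obtain ⟨x, hx⟩ := (hcon y _).1 hx
    refine hg3 η ν (by omega) (by omega) h1 h2 ⟨x, fun z hz => ?_⟩
    rw [hy η (by omega), hy ν (by omega), List.mem_append, List.mem_ofFn, List.mem_ofFn] at hz
    rcases hz with ⟨i, rfl⟩ | ⟨i, rfl⟩
    · exact hx η (by simp) i
    · exact hx ν (by simp) i

end Compactness

/-- **Theorem 5.4.** Let `T` be `NSOP₂`.  Then Conant-independence is
symmetric: `a ⫝^{K*}_M b` implies `b ⫝^{K*}_M a`. -/
theorem conant_independence_symmetric (L : FirstOrder.Language.{u, u}) (𝕄 : Type u)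
    [L.Structure 𝕄] (κ : Cardinal.{u}) (hmonster : IsMonster L 𝕄 κ)
    (hNSOP2 : ¬ HasSOP2 L 𝕄)
    (Ms : Set 𝕄) (hMs : IsElemSubmodel L Ms) (hMssmall : Cardinal.mk Ms < κ)
    (α β : Type u) (hα : Cardinal.mk α < κ) (hβ : Cardinal.mk β < κ)
    (a : α → 𝕄) (b : β → 𝕄) :
    ConantIndep L Ms a b → ConantIndep L Ms b a := by
  intro h
  obtain ⟨S, rfl⟩ := hMs
  exact h.symm hmonster.2.1 hmonster.1 hMssmall
    (noTrees_of_not_hasSOP2 hmonster.2.1 hmonster.1 hNSOP2)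

end NSOP2Paper
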